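/- arXiv:2206.12583 — 3 statements merged into one kernel-verified Lean document; each statement's English description precedes it below -/
import Mathlib

section
/- Let p ∈ (2 + 4s/N, 2*_s) and η > 0, and let u₀ : ℝ^N → ℝ be measurable with 0 < [u₀]² < ∞, ‖u₀‖_{2*_s} < ∞ and 0 < ‖u₀‖_p^p < ∞. Then for every ξ ∈ ℝ, I_η(ξ⋆u₀) ≤ (1/2) [u₀]² ( (2 s p [u₀]²) / ((Np−2N) η ‖u₀‖_p^p) )^{4s/(Np−2N−4s)}; in particular this upper bound tends to 0 as η → ∞. -/
open MeasureTheory Filter Topology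
open scoped ENNReal

noncomputable section

/-- Squared Gagliardo seminorm `[u]²` (possibly infinite). -/
def gagliardo (N : ℕ) (s : ℝ) (u : EuclideanSpace ℝ (Fin N) → ℝ) : ℝ≥0∞ :=
  ∫⁻ x : EuclideanSpace ℝ (Fin N), ∫⁻ y : EuclideanSpace ℝ (Fin N),
    ENNReal.ofReal (|u x - u y| ^ 2 / ‖x - y‖ ^ ((N : ℝ) + 2 * s))

/-- `∫ |u|^q dx`, i.e. `‖u‖_q^q` (possibly infinite). -/
def lpint (N : ℕ) (q : ℝ) (u : EuclideanSpace ℝ (Fin N) → ℝ) : ℝ≥0∞ :=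
  ∫⁻ x : EuclideanSpace ℝ (Fin N), ENNReal.ofReal (|u x| ^ q)

/-- The scaling `(ξ ⋆ u)(x) = e^{Nξ/2} u(e^ξ x)`. -/
def scaleFn (N : ℕ) (ξ : ℝ) (u : EuclideanSpace ℝ (Fin N) → ℝ) :
    EuclideanSpace ℝ (Fin N) → ℝ :=
  fun x => Real.exp ((N : ℝ) * ξ / 2) * u (Real.exp ξ • x)

/-- The fractional critical Sobolev exponent `2*_s = 2N/(N-2s)`. -/
def critExp (N : ℕ) (s : ℝ) : ℝ := 2 * N / ((N : ℝ) - 2 * s)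

/-- `ζ_p = N(p-2)/(2ps)`. -/
def zetaP (N : ℕ) (s p : ℝ) : ℝ := (N : ℝ) * (p - 2) / (2 * p * s)

/-- The energy functional `I_η`. -/
def energy (N : ℕ) (s p η : ℝ) (u : EuclideanSpace ℝ (Fin N) → ℝ) : ℝ :=
  (1 / 2) * (gagliardo N s u).toReal - (1 / critExp N s) * (lpint N (critExp N s) u).toReal
    - (η / p) * (lpint N p u).toReal

/-- The Pohozaev functional `P_η`. -/
def pohozaev (N : ℕ) (s p η : ℝ) (u : EuclideanSpace ℝ (Fin N) → ℝ) : ℝ :=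
  (gagliardo N s u).toReal - (lpint N (critExp N s) u).toReal
    - η * zetaP N s p * (lpint N p u).toReal

/-- The quantity `ρ(m,η)` from Lemma 2.2. -/
def rhoDef (N : ℕ) (s p η m S C : ℝ) : ℝ :=
  min ((p / (8 * η * C ^ p * (2 : ℝ) ^ (((N : ℝ) * p - 2 * N) / (4 * s)) *
        m ^ ((2 * s * p - (N : ℝ) * p + 2 * N) / (2 * s)))) ^
          (4 * s / ((N : ℝ) * p - 2 * N - 4 * s)))
      ((critExp N s / 8) ^ (((N : ℝ) - 2 * s) / (2 * s)) * (S / 2) ^ ((N : ℝ) / (2 * s)))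

theorem lintegral_comp_exp_smul (N : ℕ) (ξ : ℝ) (f : EuclideanSpace ℝ (Fin N) → ℝ≥0∞) :
    ∫⁻ x, f (Real.exp ξ • x) = ENNReal.ofReal (Real.exp (-(N * ξ))) * ∫⁻ x, f x := by
  have h := lintegral_map_equiv (μ := (volume : Measure (EuclideanSpace ℝ (Fin N)))) f
    (MeasurableEquiv.smul₀ (Real.exp ξ) (Real.exp_ne_zero ξ))
  rw [MeasurableEquiv.coe_smul₀, Measure.map_addHaar_smul volume (Real.exp_ne_zero ξ),
    lintegral_smul_measure] at h
  rw [← h, finrank_euclideanSpace_fin, abs_of_pos (by positivity), ← Real.exp_nat_mul,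
    ← Real.exp_neg, smul_eq_mul]

theorem lpint_scaleFn (N : ℕ) (q ξ : ℝ) (u : EuclideanSpace ℝ (Fin N) → ℝ) :
    lpint N q (scaleFn N ξ u) =
      ENNReal.ofReal (Real.exp ((N * q - 2 * N) / 2 * ξ)) * lpint N q u := by
  have h : ∀ x, ENNReal.ofReal (|scaleFn N ξ u x| ^ q) =
      ENNReal.ofReal (Real.exp (N * ξ / 2 * q)) *
        ENNReal.ofReal (|u (Real.exp ξ • x)| ^ q) := fun x => by
    rw [← ENNReal.ofReal_mul (Real.exp_nonneg _), scaleFn, abs_mul, Real.abs_exp,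
      Real.mul_rpow (Real.exp_nonneg _) (abs_nonneg _), ← Real.exp_mul]
  simp only [lpint, h]
  rw [lintegral_const_mul' _ _ ENNReal.ofReal_ne_top,
    lintegral_comp_exp_smul N ξ fun x => ENNReal.ofReal (|u x| ^ q), ← mul_assoc,
    ← ENNReal.ofReal_mul (Real.exp_nonneg _), ← Real.exp_add]
  ring_nf

theorem gagliardo_scaleFn (N : ℕ) (s ξ : ℝ) (u : EuclideanSpace ℝ (Fin N) → ℝ) :
    gagliardo N s (scaleFn N ξ u) =
      ENNReal.ofReal (Real.exp (2 * s * ξ)) * gagliardo N s u := by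
  let F : EuclideanSpace ℝ (Fin N) → EuclideanSpace ℝ (Fin N) → ℝ≥0∞ := fun x y =>
    ENNReal.ofReal (|u x - u y| ^ 2 / ‖x - y‖ ^ ((N : ℝ) + 2 * s))
  have h : ∀ x y, ENNReal.ofReal
      (|scaleFn N ξ u x - scaleFn N ξ u y| ^ 2 / ‖x - y‖ ^ ((N : ℝ) + 2 * s)) =
      ENNReal.ofReal (Real.exp (N * ξ + ξ * (N + 2 * s))) *
        F (Real.exp ξ • x) (Real.exp ξ • y) := fun x y => by
    have h2 : Real.exp (N * ξ / 2) ^ 2 = Real.exp (N * ξ) := by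
      rw [← Real.exp_nat_mul]; ring_nf
    rw [← ENNReal.ofReal_mul (Real.exp_nonneg _), scaleFn, scaleFn, ← mul_sub, abs_mul,
      Real.abs_exp, mul_pow, h2, ← smul_sub, norm_smul, Real.norm_eq_abs, Real.abs_exp,
      Real.mul_rpow (Real.exp_nonneg _) (norm_nonneg _), ← Real.exp_mul, Real.exp_add]
    congr 1
    rw [mul_div_assoc, mul_assoc, ← mul_div_assoc (Real.exp (ξ * _)),
      mul_div_mul_left _ _ (Real.exp_ne_zero _)]
  have hin : ∀ x, ∫⁻ y, F x (Real.exp ξ • y) =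
      ENNReal.ofReal (Real.exp (-(N * ξ))) * ∫⁻ y, F x y :=
    fun x => lintegral_comp_exp_smul N ξ (F x)
  simp only [gagliardo, h]
  simp only [lintegral_const_mul' _ _ ENNReal.ofReal_ne_top, hin]
  rw [lintegral_comp_exp_smul N ξ fun x => ∫⁻ y, F x y]
  simp only [← mul_assoc, ← ENNReal.ofReal_mul (Real.exp_nonneg _), ← Real.exp_add]
  congr 3
  ring

theorem sub_rpow_div_le_one {r γ : ℝ} (hr : 0 ≤ r) (hγ : 1 ≤ γ) : r - r ^ γ / γ ≤ 1 := by
  have h := one_add_mul_self_le_rpow_one_add (s := r - 1) (by linarith) hγ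
  rw [add_sub_cancel] at h
  have h' : r - 1 ≤ r ^ γ / γ := by
    rw [le_div_iff₀ (by linarith)]
    nlinarith
  linarith

/-- The maximum over `t ≥ 0` of `a t - b t ^ γ` is at most `a` times its maximizer. -/
theorem mul_sub_mul_rpow_le {a b γ t : ℝ} (ha : 0 < a) (hb : 0 < b) (hγ : 1 < γ)
    (ht : 0 ≤ t) : a * t - b * t ^ γ ≤ a * (a / (γ * b)) ^ (γ - 1)⁻¹ := by
  have hγ0 : 0 < γ := by linarith
  set T := (a / (γ * b)) ^ (γ - 1)⁻¹ with hT
  have hTpos : 0 < T := by positivity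
  have hTγ : b * T ^ γ = a * T / γ := by
    have h1 : T ^ (γ - 1) = a / (γ * b) :=
      Real.rpow_inv_rpow (by positivity) (by linarith)
    have h2 : T ^ γ = T ^ (γ - 1) * T := by
      conv_lhs => rw [show γ = γ - 1 + 1 by ring, Real.rpow_add_one hTpos.ne']
    rw [h2, h1]
    field_simp
  have hr := sub_rpow_div_le_one (r := t / T) (by positivity) hγ.le
  have ht' : t ^ γ = (t / T) ^ γ * T ^ γ := by
    rw [← Real.mul_rpow (by positivity) hTpos.le, div_mul_cancel₀ _ hTpos.ne']
  calc a * t - b * t ^ γ = a * T * (t / T - (t / T) ^ γ / γ) := by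
        rw [ht', show b * ((t / T) ^ γ * T ^ γ) = (t / T) ^ γ * (b * T ^ γ) by ring, hTγ]
        field_simp
    _ ≤ a * T * 1 := by gcongr
    _ = a * T := mul_one _

/-- `I_η(ξ⋆u₀)` is bounded above by an `η`-dependent constant tending to `0`. -/
theorem energy_scaling_bound (N : ℕ) (hN : 2 ≤ N) (s : ℝ) (hs : s ∈ Set.Ioo (0 : ℝ) 1)
    (p η : ℝ) (hp : p ∈ Set.Ioo (2 + 4 * s / N) (critExp N s)) (hη : 0 < η)
    (u₀ : EuclideanSpace ℝ (Fin N) → ℝ) (hu : Measurable u₀)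
    (hgag0 : gagliardo N s u₀ ≠ 0) (hgag : gagliardo N s u₀ ≠ ⊤)
    (hcrit : lpint N (critExp N s) u₀ ≠ ⊤)
    (hLp0 : lpint N p u₀ ≠ 0) (hLp : lpint N p u₀ ≠ ⊤) :
    (∀ ξ : ℝ,
      energy N s p η (scaleFn N ξ u₀) ≤
        (1 / 2) * (gagliardo N s u₀).toReal *
          ((2 * s * p * (gagliardo N s u₀).toReal) /
              (((N : ℝ) * p - 2 * N) * η * (lpint N p u₀).toReal)) ^
            (4 * s / ((N : ℝ) * p - 2 * N - 4 * s))) ∧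
      Tendsto (fun η' : ℝ =>
        (1 / 2) * (gagliardo N s u₀).toReal *
          ((2 * s * p * (gagliardo N s u₀).toReal) /
              (((N : ℝ) * p - 2 * N) * η' * (lpint N p u₀).toReal)) ^
            (4 * s / ((N : ℝ) * p - 2 * N - 4 * s))) atTop (𝓝 0) := by
  obtain ⟨hs0, hs1⟩ := hs
  obtain ⟨hp1, -⟩ := hp
  have hN0 : (2 : ℝ) ≤ N := by exact_mod_cast hN
  have hNpos : (0 : ℝ) < N := by linarith
  have hA : 0 < (gagliardo N s u₀).toReal := ENNReal.toReal_pos hgag0 hgag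
  have hB : 0 < (lpint N p u₀).toReal := ENNReal.toReal_pos hLp0 hLp
  set A := (gagliardo N s u₀).toReal
  set B := (lpint N p u₀).toReal
  have hd : 0 < (N : ℝ) * p - 2 * N - 4 * s := by
    have h : (N : ℝ) * (2 + 4 * s / N) < N * p := by gcongr
    rw [mul_add, mul_div_cancel₀ _ hNpos.ne'] at h
    linarith
  have hd' : 0 < (N : ℝ) * p - 2 * N := by linarith
  have hp0 : 0 < p := lt_trans (by positivity) hp1
  refine ⟨fun ξ => ?_, ?_⟩
  · have hcrit0 : 0 ≤ 1 / critExp N s :=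
      one_div_nonneg.2 (div_nonneg (by positivity) (by linarith))
    have hγ : 1 < ((N : ℝ) * p - 2 * N) / (4 * s) := by
      rw [one_lt_div (by positivity)]; linarith
    have key := mul_sub_mul_rpow_le (a := A / 2) (b := η / p * B) (by positivity)
      (by positivity) hγ (Real.exp_nonneg (2 * s * ξ))
    have he : Real.exp (2 * s * ξ) ^ (((N : ℝ) * p - 2 * N) / (4 * s)) =
        Real.exp ((N * p - 2 * N) / 2 * ξ) := by
      rw [← Real.exp_mul]
      congr 1
      field_simp
      ring
    have hbase : A / 2 / (((N : ℝ) * p - 2 * N) / (4 * s) * (η / p * B)) =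
        2 * s * p * A / ((N * p - 2 * N) * η * B) := by
      field_simp
      ring
    have hexp : (((N : ℝ) * p - 2 * N) / (4 * s) - 1)⁻¹ =
        4 * s / (N * p - 2 * N - 4 * s) := by
      rw [div_sub_one (by positivity), inv_div]
    rw [he, hbase, hexp] at key
    have hc := mul_nonneg hcrit0
      (ENNReal.toReal_nonneg (a := lpint N (critExp N s) (scaleFn N ξ u₀)))
    rw [energy, gagliardo_scaleFn, lpint_scaleFn N p, ENNReal.toReal_mul, ENNReal.toReal_mul,
      ENNReal.toReal_ofReal (Real.exp_nonneg _), ENNReal.toReal_ofReal (Real.exp_nonneg _)]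
    linear_combination key + hc
  · have hden : Tendsto (fun η' : ℝ => ((N : ℝ) * p - 2 * N) * η' * B) atTop atTop :=
      (tendsto_id.const_mul_atTop hd').atTop_mul_const hB
    have hα : 0 < 4 * s / ((N : ℝ) * p - 2 * N - 4 * s) := by positivity
    have h := ((hden.const_div_atTop (2 * s * p * A)).rpow_const
      (Or.inr hα.le)).const_mul (1 / 2 * A)
    rwa [Real.zero_rpow hα.ne', mul_zero] at h
end
end

section
/- Let p ∈ (2 + 4s/N, 2*_s), η > 0 and m > 0. Let (u_n) be a sequence of measurable functions ℝ^N → ℝ with ‖u_n‖₂² = m², [u_n]² < ∞, ‖u_n‖_{2*_s} < ∞ and ‖u_n‖_p < ∞ for every n, such that the sequence (I_η(u_n)) is bounded and P_η(u_n) → 0 as n → ∞. Then the sequences (‖u_n‖_p^p), (‖u_n‖_{2*_s}^{2*_s}) and ([u_n]²) are all bounded. -/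
open MeasureTheory Filter Topology
open scoped ENNReal

noncomputable section

lemma half_sub_inv_critExp {N : ℕ} {s : ℝ} (hN : 0 < (N : ℝ)) :
    1 / 2 - 1 / critExp N s = s / N := by
  unfold critExp
  rw [one_div_div]
  field_simp
  ring

lemma inv_lt_half_zetaP {N : ℕ} {s p : ℝ} (hN : 0 < (N : ℝ)) (hs : 0 < s)
    (hp : 2 + 4 * s / N < p) : 1 / p < zetaP N s p / 2 := by
  have hp0 : 0 < p := lt_trans (by positivity) hp
  have hsN : 4 * s < N * (p - 2) := by
    rw [← div_lt_iff₀' hN]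
    linarith
  unfold zetaP
  rw [div_div, div_lt_div_iff₀ hp0 (by positivity)]
  nlinarith [mul_lt_mul_of_pos_right hsN hp0]

/-- The combination of `I_η` and `P_η` in which the Gagliardo seminorm cancels. -/
lemma energy_sub_half_pohozaev {N : ℕ} {s p η : ℝ} (hN : 0 < (N : ℝ))
    (u : EuclideanSpace ℝ (Fin N) → ℝ) :
    energy N s p η u - pohozaev N s p η u / 2 =
      s / N * (lpint N (critExp N s) u).toReal +
        η * (zetaP N s p / 2 - 1 / p) * (lpint N p u).toReal := by
  rw [← half_sub_inv_critExp hN]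
  unfold energy pohozaev
  ring

/-- boundedness of Palais-Smale sequences (Lemma 2.5). -/
theorem ps_bounded (N : ℕ) (hN : 2 ≤ N) (s : ℝ) (hs : s ∈ Set.Ioo (0 : ℝ) 1)
    (p η m : ℝ) (hp : p ∈ Set.Ioo (2 + 4 * s / N) (critExp N s)) (hη : 0 < η) (hm : 0 < m)
    (u : ℕ → EuclideanSpace ℝ (Fin N) → ℝ)
    (hmeas : ∀ n, Measurable (u n))
    (hmass : ∀ n, (lpint N 2 (u n)).toReal = m ^ 2)
    (hL2 : ∀ n, lpint N 2 (u n) ≠ ⊤)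
    (hgag : ∀ n, gagliardo N s (u n) ≠ ⊤)
    (hcrit : ∀ n, lpint N (critExp N s) (u n) ≠ ⊤)
    (hLp : ∀ n, lpint N p (u n) ≠ ⊤)
    (hI : ∃ M : ℝ, ∀ n, |energy N s p η (u n)| ≤ M)
    (hP : Tendsto (fun n => pohozaev N s p η (u n)) atTop (𝓝 0)) :
    (∃ M : ℝ, ∀ n, (lpint N p (u n)).toReal ≤ M) ∧
      (∃ M : ℝ, ∀ n, (lpint N (critExp N s) (u n)).toReal ≤ M) ∧
      ∃ M : ℝ, ∀ n, (gagliardo N s (u n)).toReal ≤ M := by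
  have hN0 : 0 < (N : ℝ) := by exact_mod_cast lt_of_lt_of_le two_pos hN
  obtain ⟨M, hM⟩ := hI
  obtain ⟨K, hK⟩ := hP.abs.bddAbove_range
  replace hK : ∀ n, |pohozaev N s p η (u n)| ≤ K := fun n => hK ⟨n, rfl⟩
  have hα : 0 < s / N := div_pos hs.1 hN0
  have hβ : 0 < η * (zetaP N s p / 2 - 1 / p) :=
    mul_pos hη (sub_pos.2 (inv_lt_half_zetaP hN0 hs.1 hp.1))
  have key : ∀ n, s / N * (lpint N (critExp N s) (u n)).toReal +
      η * (zetaP N s p / 2 - 1 / p) * (lpint N p (u n)).toReal ≤ M + K / 2 := fun n => by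
    rw [← energy_sub_half_pohozaev hN0]
    linarith [(abs_le.1 (hM n)).2, (abs_le.1 (hK n)).1]
  have hA : ∀ n, (lpint N p (u n)).toReal ≤
      (M + K / 2) / (η * (zetaP N s p / 2 - 1 / p)) := fun n => by
    rw [le_div_iff₀' hβ]
    linarith [key n, mul_nonneg hα.le (ENNReal.toReal_nonneg (a := lpint N (critExp N s) (u n)))]
  have hC : ∀ n, (lpint N (critExp N s) (u n)).toReal ≤ (M + K / 2) / (s / N) := fun n => by
    rw [le_div_iff₀' hα]
    linarith [key n, mul_nonneg hβ.le (ENNReal.toReal_nonneg (a := lpint N p (u n)))]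
  have hp0 : 0 < p := lt_trans (by have := hs.1; positivity) hp.1
  have hζ : 0 ≤ η * zetaP N s p :=
    mul_nonneg hη.le (by linarith [inv_lt_half_zetaP hN0 hs.1 hp.1, one_div_pos.2 hp0])
  refine ⟨⟨_, hA⟩, ⟨_, hC⟩, K + (M + K / 2) / (s / N) +
    η * zetaP N s p * ((M + K / 2) / (η * (zetaP N s p / 2 - 1 / p))), fun n => ?_⟩
  have hPn := (abs_le.1 (hK n)).2
  unfold pohozaev at hPn
  linarith [hC n, mul_le_mul_of_nonneg_left (hA n) hζ]
end
end

section
/- Let N ≥ 2 be an integer, s ∈ (0,1), p ∈ (2 + 4s/N, 2*_s) and m > 0. Then there exists η* > 0 such that for every η ≥ η* there exist a measurable function u : ℝ^N → ℝ and a real number μ < 0 with the following properties: u is radial (u(x) = u(y) whenever |x| = |y|); u ∈ L²(ℝ^N) with ∫_{ℝ^N} u² dx = m²; [u]² < ∞; and u is a weak solution of the fractional equation (−Δ)^s u = μ u + |u|^{2*_s−2} u + η |u|^{p−2} u, in the sense that for every measurable φ : ℝ^N → ℝ with φ ∈ L²(ℝ^N) and [φ]² < ∞, ∫_{ℝ^N}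 ∫_{ℝ^N} (u(x) − u(y))(φ(x) − φ(y)) / |x − y|^{N+2s} dx dy = ∫_{ℝ^N} ( μ u(x) φ(x) + |u(x)|^{2*_s−2} u(x) φ(x) + η |u(x)|^{p−2} u(x) φ(x) ) dx. -/
open MeasureTheory Filter Topology
open scoped ENNReal

noncomputable section

/-- Euclidean `N`-space. -/
abbrev Sp (N : ℕ) := EuclideanSpace ℝ (Fin N)

/-- The weighted difference quotient whose `L²` norm is the Gagliardo seminorm. -/
def dq (N : ℕ) (s : ℝ) (u : Sp N → ℝ) (z : Sp N × Sp N) : ℝ :=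
  (u z.1 - u z.2) / ‖z.1 - z.2‖ ^ (((N : ℝ) + 2 * s) / 2)

/-- Measurable functions in the fractional Sobolev space `H^s`. -/
structure Hs (N : ℕ) (s : ℝ) (u : Sp N → ℝ) : Prop where
  meas : Measurable u
  l2 : MemLp u 2
  gag : MemLp (dq N s u) 2

/-- Real-valued squared Gagliardo seminorm. -/
def gag (N : ℕ) (s : ℝ) (u : Sp N → ℝ) : ℝ := ∫ z, dq N s u z ^ 2

/-- The bilinear form polarizing `gag`. -/
def gform (N : ℕ) (s : ℝ) (u v : Sp N → ℝ) : ℝ := ∫ z, dq N s u z * dq N s v z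

/-- Real-valued `∫ |u|^q`. -/
def pint (N : ℕ) (q : ℝ) (u : Sp N → ℝ) : ℝ := ∫ x, |u x| ^ q

/-- Radial functions. -/
def Rad {N : ℕ} (u : Sp N → ℝ) : Prop := ∀ x y : Sp N, ‖x‖ = ‖y‖ → u x = u y

section

variable {N : ℕ} {s : ℝ} {u v w : Sp N → ℝ}

lemma measurable_dq (hu : Measurable u) : Measurable (dq N s u) := by
  unfold dq; fun_prop

lemma rpow_half_sq {a b : ℝ} (ha : 0 ≤ a) : (a ^ (b / 2)) ^ 2 = a ^ b := by
  rw [← Real.rpow_natCast, ← Real.rpow_mul ha]; norm_num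

lemma dq_mul (z : Sp N × Sp N) :
    dq N s u z * dq N s v z =
      (u z.1 - u z.2) * (v z.1 - v z.2) / ‖z.1 - z.2‖ ^ ((N : ℝ) + 2 * s) := by
  unfold dq
  rw [div_mul_div_comm, ← sq, rpow_half_sq (norm_nonneg _)]

lemma dq_sq (z : Sp N × Sp N) :
    dq N s u z ^ 2 = |u z.1 - u z.2| ^ 2 / ‖z.1 - z.2‖ ^ ((N : ℝ) + 2 * s) := by
  rw [sq, dq_mul, sq_abs, sq]

lemma gagliardo_eq (hu : Measurable u) :
    gagliardo N s u = ∫⁻ z, ENNReal.ofReal (dq N s u z ^ 2) := by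
  rw [Measure.volume_eq_prod, lintegral_prod]
  · simp only [dq_sq]; rfl
  · exact ((measurable_dq hu).pow_const 2).ennreal_ofReal.aemeasurable

lemma lintegral_ne_top_iff_memLp_two {α : Type*} [MeasurableSpace α] {μ : Measure α} {f : α → ℝ}
    (hf : Measurable f) : (∫⁻ x, ENNReal.ofReal (f x ^ 2) ∂μ ≠ ⊤) ↔ MemLp f 2 μ := by
  rw [memLp_two_iff_integrable_sq hf.aestronglyMeasurable,
    ← lintegral_ofReal_ne_top_iff_integrable (hf.pow_const 2).aestronglyMeasurable
      (Eventually.of_forall fun x => sq_nonneg (f x))]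

lemma lpint_two (u : Sp N → ℝ) : lpint N 2 u = ∫⁻ x, ENNReal.ofReal (u x ^ 2) := by
  simp [lpint]

lemma Hs.of_ne_top (hu : Measurable u) (h2 : lpint N 2 u ≠ ⊤) (hg : gagliardo N s u ≠ ⊤) :
    Hs N s u :=
  ⟨hu, (lintegral_ne_top_iff_memLp_two hu).1 (by rwa [← lpint_two]),
    (lintegral_ne_top_iff_memLp_two (measurable_dq hu)).1 (by rwa [← gagliardo_eq hu])⟩

lemma Hs.lpint_ne_top (h : Hs N s u) : lpint N 2 u ≠ ⊤ := by
  rw [lpint_two]; exact (lintegral_ne_top_iff_memLp_two h.meas).2 h.l2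

lemma Hs.gagliardo_ne_top (h : Hs N s u) : gagliardo N s u ≠ ⊤ := by
  rw [gagliardo_eq h.meas]; exact (lintegral_ne_top_iff_memLp_two (measurable_dq h.meas)).2 h.gag

lemma ofReal_gag (h : Hs N s u) : ENNReal.ofReal (gag N s u) = gagliardo N s u := by
  rw [gagliardo_eq h.meas, gag, ofReal_integral_eq_lintegral_ofReal h.gag.integrable_sq
    (Eventually.of_forall fun x => sq_nonneg _)]

lemma gag_nonneg : 0 ≤ gag N s u := integral_nonneg fun _ => sq_nonneg _

lemma pint_nonneg {q : ℝ} : 0 ≤ pint N q u := integral_nonneg fun _ => by positivity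

lemma ofReal_pint {q : ℝ} (h : Integrable (fun x => |u x| ^ q)) :
    ENNReal.ofReal (pint N q u) = lpint N q u := by
  rw [pint, ofReal_integral_eq_lintegral_ofReal h (Eventually.of_forall fun x => by positivity)]
  rfl

lemma Hs.int_two (h : Hs N s u) : Integrable (fun x => |u x| ^ (2 : ℝ)) := by
  simpa using h.l2.integrable_sq

lemma lpint_two_toReal (h : Hs N s u) : (lpint N 2 u).toReal = pint N 2 u := by
  rw [← ofReal_pint h.int_two, ENNReal.toReal_ofReal pint_nonneg]

lemma dq_add : dq N s (fun x => u x + v x) = fun z => dq N s u z + dq N s v z := by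
  ext z; unfold dq; ring

lemma dq_smul (c : ℝ) : dq N s (fun x => c * u x) = fun z => c * dq N s u z := by
  ext z; unfold dq; ring

lemma Hs.add (hu : Hs N s u) (hv : Hs N s v) : Hs N s (fun x => u x + v x) :=
  ⟨hu.meas.add hv.meas, hu.l2.add hv.l2, by rw [dq_add]; exact hu.gag.add hv.gag⟩

lemma Hs.smul (hu : Hs N s u) (c : ℝ) : Hs N s (fun x => c * u x) :=
  ⟨hu.meas.const_mul c, hu.l2.const_mul c, by rw [dq_smul]; exact hu.gag.const_mul c⟩

lemma Hs.sub (hu : Hs N s u) (hv : Hs N s v) : Hs N s (fun x => u x - v x) := by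
  have := hu.add (hv.smul (-1))
  simpa [sub_eq_add_neg] using this

lemma dq_sub : dq N s (fun x => u x - v x) = fun z => dq N s u z - dq N s v z := by
  ext z; unfold dq; ring

lemma Rad.add (hu : Rad u) (hv : Rad v) : Rad (fun x => u x + v x) := fun x y h => by
  simp [hu x y h, hv x y h]

lemma Rad.sub (hu : Rad u) (hv : Rad v) : Rad (fun x => u x - v x) := fun x y h => by
  simp [hu x y h, hv x y h]

lemma Rad.smul (hu : Rad u) (c : ℝ) : Rad (fun x => c * u x) := fun x y h => by
  simp [hu x y h]

lemma integral_sq_line {α : Type*} [MeasurableSpace α] {μ : Measure α} {f g : α → ℝ}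
    (hf : MemLp f 2 μ) (hg : MemLp g 2 μ) (t : ℝ) :
    ∫ x, (f x + t * g x) ^ 2 ∂μ =
      (∫ x, f x ^ 2 ∂μ) + 2 * t * (∫ x, f x * g x ∂μ) + t ^ 2 * ∫ x, g x ^ 2 ∂μ := by
  have e : ∀ x, (f x + t * g x) ^ 2 = (f x ^ 2 + (2 * t) * (f x * g x)) + t ^ 2 * g x ^ 2 := by
    intro x; ring
  have i1 := hf.integrable_sq
  have i2 : Integrable (fun x => (2 * t) * (f x * g x)) μ := (hf.integrable_mul hg).const_mul _
  have i3 := hg.integrable_sq.const_mul (t ^ 2)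
  have i12 : Integrable (fun x => f x ^ 2 + (2 * t) * (f x * g x)) μ := i1.add i2
  simp_rw [e]
  rw [integral_add i12 i3, integral_add i1 i2, integral_const_mul, integral_const_mul]

/-- Expansion of the Gagliardo seminorm along a line. -/
lemma gag_line (hu : Hs N s u) (hv : Hs N s v) (t : ℝ) :
    gag N s (fun x => u x + t * v x) = gag N s u + 2 * t * gform N s u v + t ^ 2 * gag N s v := by
  unfold gag gform
  rw [← integral_sq_line hu.gag hv.gag, dq_add, dq_smul]

lemma pint_two_line (hu : Hs N s u) (hv : Hs N s v) (t : ℝ) :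
    pint N 2 (fun x => u x + t * v x) =
      pint N 2 u + 2 * t * (∫ x, u x * v x) + t ^ 2 * pint N 2 v := by
  unfold pint
  simp only [Real.rpow_ofNat, sq_abs]
  exact integral_sq_line hu.l2 hv.l2 t

/-- The iterated integral in the weak formulation is the bilinear form. -/
lemma integral_integral_eq_gform (hu : Hs N s u) (hv : Hs N s v) :
    (∫ x : Sp N, ∫ y : Sp N, (u x - u y) * (v x - v y) / ‖x - y‖ ^ ((N : ℝ) + 2 * s)) =
      gform N s u v := by
  have i2 : Integrable (fun z => dq N s u z * dq N s v z) := hu.gag.integrable_mul hv.gag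
  unfold gform
  rw [Measure.volume_eq_prod, integral_prod _ (by rwa [← Measure.volume_eq_prod])]
  simp only [dq_mul]

lemma critExp_pos (hN : 2 ≤ N) (hs : s ∈ Set.Ioo (0 : ℝ) 1) : 2 < critExp N s := by
  have : (2 : ℝ) ≤ N := by exact_mod_cast hN
  unfold critExp
  rw [lt_div_iff₀ (by linarith [hs.2])]; linarith [hs.1]

/-- Volume of the unit ball, as a real number. -/
def ballVol (N : ℕ) : ℝ := (volume (Metric.ball (0 : Sp N) 1)).toReal

lemma ballVol_pos : 0 < ballVol N :=
  ENNReal.toReal_pos (Metric.measure_ball_pos _ _ one_pos).ne' measure_ball_lt_top.ne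

lemma volume_ball_eq (x : Sp N) {r : ℝ} (hr : 0 < r) :
    volume (Metric.ball x r) = ENNReal.ofReal (r ^ N * ballVol N) := by
  rw [Measure.addHaar_ball_of_pos _ _ hr, ENNReal.ofReal_mul (by positivity), ballVol,
    ENNReal.ofReal_toReal measure_ball_lt_top.ne]
  simp

/-- If `|u| ≤ |u x| / 2` on a large part of a ball around `x`, the inner Gagliardo integral is
large at `x`. -/
lemma le_inner_gagliardo (hs : 0 < s) (hu : Measurable u) (x : Sp N) {r a : ℝ}
    (hr : 0 < r) (ha : |u x| = 2 * a) (ha0 : 0 < a)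
    (hvol : volume {y | a ≤ |u y|} ≤ ENNReal.ofReal (r ^ N * ballVol N / 2)) :
    ENNReal.ofReal (a ^ 2 / r ^ (2 * s) * (ballVol N / 2)) ≤
      ∫⁻ y, ENNReal.ofReal (|u x - u y| ^ 2 / ‖x - y‖ ^ ((N : ℝ) + 2 * s)) := by
  set E : Set (Sp N) := Metric.ball x r \ {y | a ≤ |u y|} with hE
  have hV := ballVol_pos (N := N)
  have hEm : MeasurableSet E :=
    measurableSet_ball.diff (measurableSet_le measurable_const hu.abs)
  have hEv : ENNReal.ofReal (r ^ N * ballVol N / 2) ≤ volume E := by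
    have h1 : volume (Metric.ball x r) - volume {y | a ≤ |u y|} ≤ volume E := le_measure_sdiff
    refine le_trans ?_ h1
    rw [volume_ball_eq x hr]
    refine le_trans ?_ (tsub_le_tsub_left hvol _)
    rw [← ENNReal.ofReal_sub _ (by positivity)]
    apply ENNReal.ofReal_le_ofReal; linarith
  calc ENNReal.ofReal (a ^ 2 / r ^ (2 * s) * (ballVol N / 2))
      = ENNReal.ofReal (a ^ 2 / r ^ ((N : ℝ) + 2 * s)) *
        ENNReal.ofReal (r ^ N * ballVol N / 2) := by
        rw [← ENNReal.ofReal_mul (by positivity), Real.rpow_add hr, Real.rpow_natCast]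
        congr 1
        have : 0 < r ^ N := by positivity
        have : 0 < r ^ (2 * s) := by positivity
        field_simp
    _ ≤ ENNReal.ofReal (a ^ 2 / r ^ ((N : ℝ) + 2 * s)) * volume E := by gcongr
    _ = ∫⁻ y in E, ENNReal.ofReal (a ^ 2 / r ^ ((N : ℝ) + 2 * s)) := by
        rw [setLIntegral_const]
    _ ≤ ∫⁻ y in E, ENNReal.ofReal (|u x - u y| ^ 2 / ‖x - y‖ ^ ((N : ℝ) + 2 * s)) := by
        refine setLIntegral_mono' hEm fun y hy => ENNReal.ofReal_le_ofReal ?_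
        have h1 : ‖x - y‖ < r := by
          have := hy.1; rwa [Metric.mem_ball, dist_comm, dist_eq_norm] at this
        have h2 : |u y| < a := not_le.1 hy.2
        have h3 : a ≤ |u x - u y| := by
          have := abs_sub_abs_le_abs_sub (u x) (u y); linarith
        have h4 : 0 < ‖x - y‖ := by
          rw [norm_pos_iff, sub_ne_zero]; rintro rfl; linarith
        gcongr
    _ ≤ _ := setLIntegral_le_lintegral _ _

lemma abs_rpow_le_inner_gagliardo (hN : 2 ≤ N) (hs : s ∈ Set.Ioo (0 : ℝ) 1) (hu : Measurable u)
    {Q : ℝ} (hQ : 0 < Q) (hle : lpint N (critExp N s) u ≤ ENNReal.ofReal Q) (x : Sp N) :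
    ENNReal.ofReal (|u x| ^ critExp N s) ≤
      ENNReal.ofReal (2 ^ critExp N s * (2 / ballVol N) *
        (2 * Q / ballVol N) ^ (2 * s / N)) *
      ∫⁻ y, ENNReal.ofReal (|u x - u y| ^ 2 / ‖x - y‖ ^ ((N : ℝ) + 2 * s)) := by
  have hq := critExp_pos hN hs
  have hN' : (2 : ℝ) ≤ N := by exact_mod_cast hN
  have hV := ballVol_pos (N := N)
  set q := critExp N s with hqdef
  rcases eq_or_ne (u x) 0 with h0 | h0
  · simp [h0, Real.zero_rpow (by linarith : q ≠ 0)]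
  set a := |u x| / 2 with hadef
  have ha : 0 < a := by positivity
  have haq : 0 < a ^ q := by positivity
  set r := (2 * Q / (ballVol N * a ^ q)) ^ (1 / (N : ℝ)) with hrdef
  have hr : 0 < r := by positivity
  have hrN : r ^ N * ballVol N / 2 = Q / a ^ q := by
    rw [hrdef, ← Real.rpow_natCast, ← Real.rpow_mul (by positivity), one_div,
      inv_mul_cancel₀ (by positivity), Real.rpow_one]
    field_simp
  have hrs : r ^ (2 * s) = (2 * Q / ballVol N) ^ (2 * s / N) / a ^ (q * (2 * s / N)) := by
    rw [hrdef, ← Real.rpow_mul (by positivity), ← div_div, Real.div_rpow (by positivity)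
      (by positivity), ← Real.rpow_mul ha.le]
    congr 2 <;> ring
  have hexp : 2 + q * (2 * s / N) = q := by
    have : (N : ℝ) - 2 * s ≠ 0 := by linarith [hs.2]
    rw [hqdef, critExp]; field_simp; ring
  have hvol : volume {y | a ≤ |u y|} ≤ ENNReal.ofReal (r ^ N * ballVol N / 2) := by
    rw [hrN, ENNReal.ofReal_div_of_pos haq]
    refine (ENNReal.le_div_iff_mul_le (by simp [haq]) (by simp)).2 ?_
    rw [mul_comm]
    refine le_trans ?_ hle
    refine le_trans ?_ (mul_meas_ge_le_lintegral ?_ (ENNReal.ofReal (a ^ q)))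
    · gcongr with y
      intro hy
      exact ENNReal.ofReal_le_ofReal (Real.rpow_le_rpow ha.le hy (by linarith))
    · exact (hu.abs.pow_const q).ennreal_ofReal
  have key := le_inner_gagliardo hs.1 hu x hr (by rw [hadef]; ring) ha hvol
  refine le_trans (le_of_eq ?_) (mul_le_mul_right key _)
  rw [← ENNReal.ofReal_mul (by positivity)]
  congr 1
  have h2a : |u x| = 2 * a := by rw [hadef]; ring
  have e1 : a ^ q = a ^ 2 * a ^ (q * (2 * s / N)) := by
    nth_rewrite 1 [← hexp]
    rw [Real.rpow_add ha]; norm_num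
  rw [hrs, h2a, Real.mul_rpow (by norm_num) ha.le, e1]
  have : 0 < (2 * Q / ballVol N) ^ (2 * s / N) := by positivity
  have : 0 < a ^ (q * (2 * s / N)) := by positivity
  field_simp

/-- The constant in the fractional Sobolev inequality. -/
def sobConst (N : ℕ) (s : ℝ) : ℝ :=
  (2 ^ critExp N s * (2 / ballVol N) * (2 / ballVol N) ^ (2 * s / N)) ^ (critExp N s / 2)

lemma sobConst_pos : 0 < sobConst N s := by
  have hV := ballVol_pos (N := N)
  unfold sobConst; positivity

lemma lpint_crit_le_of_ne_top (hN : 2 ≤ N) (hs : s ∈ Set.Ioo (0 : ℝ) 1) (hu : Measurable u)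
    (hf : lpint N (critExp N s) u ≠ ⊤) {A : ℝ} (hA0 : 0 ≤ A)
    (hA : gagliardo N s u ≤ ENNReal.ofReal A) :
    lpint N (critExp N s) u ≤ ENNReal.ofReal (sobConst N s * A ^ (critExp N s / 2)) := by
  have hq := critExp_pos hN hs
  have hN' : (2 : ℝ) ≤ N := by exact_mod_cast hN
  have hV := ballVol_pos (N := N)
  set q := critExp N s with hqdef
  set Q := (lpint N q u).toReal with hQdef
  rcases (ENNReal.toReal_nonneg : 0 ≤ Q).eq_or_lt with h0 | hQ
  · have : lpint N q u = 0 := by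
      rcases (ENNReal.toReal_eq_zero_iff _).1 h0.symm with h | h
      · exact h
      · exact absurd h hf
    rw [this]; exact bot_le
  have hQe : lpint N q u = ENNReal.ofReal Q := (ENNReal.ofReal_toReal hf).symm
  have h1 : lpint N q u ≤ ENNReal.ofReal (2 ^ q * (2 / ballVol N) *
        (2 * Q / ballVol N) ^ (2 * s / N)) * ENNReal.ofReal A := by
    refine le_trans (lintegral_mono
      (abs_rpow_le_inner_gagliardo hN hs hu hQ hQe.le)) ?_
    rw [lintegral_const_mul']
    · gcongr; exact hA
    · simp
  rw [hQe, ← ENNReal.ofReal_mul (by positivity), ENNReal.ofReal_le_ofReal_iff (by positivity)] at h1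
  rw [hQe]
  apply ENNReal.ofReal_le_ofReal
  have hθ : 0 < 1 - 2 * s / N := by
    rw [sub_pos, div_lt_one (by linarith)]; linarith [hs.2]
  have hconj : (1 - 2 * s / N) * (q / 2) = 1 := by
    have : (N : ℝ) - 2 * s ≠ 0 := by linarith [hs.2]
    rw [hqdef, critExp]; field_simp
  have h2 : Q ^ (1 - 2 * s / N) ≤
      2 ^ q * (2 / ballVol N) * (2 / ballVol N) ^ (2 * s / N) * A := by
    rw [Real.rpow_sub hQ, Real.rpow_one, div_le_iff₀ (by positivity)]
    refine h1.trans (le_of_eq ?_)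
    rw [show 2 * Q / ballVol N = 2 / ballVol N * Q by ring,
      Real.mul_rpow (by positivity) hQ.le]
    ring
  have h3 := Real.rpow_le_rpow (by positivity) h2 (by positivity : 0 ≤ q / 2)
  rwa [← Real.rpow_mul hQ.le, hconj, Real.rpow_one, Real.mul_rpow (by positivity) hA0] at h3

lemma lpint_crit_le (hN : 2 ≤ N) (hs : s ∈ Set.Ioo (0 : ℝ) 1) (hu : Hs N s u) :
    lpint N (critExp N s) u ≤ ENNReal.ofReal (sobConst N s * gag N s u ^ (critExp N s / 2)) := by
  have hq := critExp_pos hN hs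
  set q := critExp N s with hqdef
  let w : ℕ → Sp N → ℝ := fun k x => min |u x| k
  have hwm : ∀ k, Measurable (w k) := fun k => hu.meas.abs.min measurable_const
  have hw0 : ∀ k x, 0 ≤ w k x := fun k x => le_min (abs_nonneg _) (Nat.cast_nonneg _)
  have hbound : ∀ k, lpint N q (w k) ≤ ENNReal.ofReal (sobConst N s * gag N s u ^ (q / 2)) := by
    intro k
    apply lpint_crit_le_of_ne_top hN hs (hwm k) _ gag_nonneg
    · rw [ofReal_gag hu]
      unfold gagliardo
      refine lintegral_mono fun x => lintegral_mono fun y => ENNReal.ofReal_le_ofReal ?_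
      gcongr ?_ ^ 2 / _
      have h1 : |w k x - w k y| ≤ max |(|u x| - |u y|)| |(k : ℝ) - k| :=
        abs_min_sub_min_le_max _ _ _ _
      rw [sub_self, abs_zero, max_eq_left (abs_nonneg _)] at h1
      exact h1.trans (abs_abs_sub_abs_le_abs_sub _ _)
    · have : lpint N q (w k) ≤ ENNReal.ofReal ((k : ℝ) ^ (q - 2)) * lpint N 2 u := by
        unfold lpint
        rw [← lintegral_const_mul' _ _ (by simp)]
        refine lintegral_mono fun x => ?_
        rw [← ENNReal.ofReal_mul (by positivity)]
        apply ENNReal.ofReal_le_ofReal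
        rw [abs_of_nonneg (hw0 k x)]
        rcases (hw0 k x).eq_or_lt with h | h
        · rw [← h, Real.zero_rpow (by linarith)]; positivity
        · have e : w k x ^ q = w k x ^ (q - 2) * w k x ^ (2 : ℝ) := by
            rw [← Real.rpow_add h]; ring_nf
          rw [e]
          refine mul_le_mul (Real.rpow_le_rpow h.le (min_le_right _ _) (by linarith))
            (Real.rpow_le_rpow h.le (min_le_left _ _) (by norm_num)) (by positivity)
            (by positivity)
      exact ne_top_of_le_ne_top (ENNReal.mul_ne_top (by simp) hu.lpint_ne_top) this
  have hlim : ∀ x, Tendsto (fun k => ENNReal.ofReal (|w k x| ^ q)) atTop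
      (𝓝 (ENNReal.ofReal (|u x| ^ q))) := by
    intro x
    apply tendsto_const_nhds.congr'
    obtain ⟨k0, hk0⟩ := exists_nat_ge |u x|
    filter_upwards [eventually_ge_atTop k0] with k hk
    have : |u x| ≤ k := hk0.trans (by exact_mod_cast hk)
    simp [w, min_eq_left this]
  calc lpint N q u = ∫⁻ x, liminf (fun k => ENNReal.ofReal (|w k x| ^ q)) atTop := by
        unfold lpint; congr 1; ext x; exact (hlim x).liminf_eq.symm
    _ ≤ liminf (fun k => lpint N q (w k)) atTop :=
        lintegral_liminf_le fun k => ((hwm k).abs.pow_const q).ennreal_ofReal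
    _ ≤ liminf (fun _ : ℕ => ENNReal.ofReal (sobConst N s * gag N s u ^ (q / 2))) atTop :=
        liminf_le_liminf (Eventually.of_forall hbound)
    _ = _ := by simp

lemma Hs.int_crit (hN : 2 ≤ N) (hs : s ∈ Set.Ioo (0 : ℝ) 1) (hu : Hs N s u) :
    Integrable (fun x => |u x| ^ critExp N s) := by
  rw [← lintegral_ofReal_ne_top_iff_integrable (hu.meas.abs.pow_const _).aestronglyMeasurable
      (Eventually.of_forall fun x => by positivity)]
  exact ne_top_of_le_ne_top ENNReal.ofReal_ne_top (lpint_crit_le hN hs hu)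

/-- Fractional Sobolev inequality. -/
lemma sobolev (hN : 2 ≤ N) (hs : s ∈ Set.Ioo (0 : ℝ) 1) (hu : Hs N s u) :
    pint N (critExp N s) u ≤ sobConst N s * gag N s u ^ (critExp N s / 2) := by
  have h := lpint_crit_le hN hs hu
  rwa [← ofReal_pint (hu.int_crit hN hs), ENNReal.ofReal_le_ofReal_iff] at h
  have := gag_nonneg (N := N) (s := s) (u := u)
  have := sobConst_pos (N := N) (s := s)
  positivity

lemma rpow_le_add_rpow {a p q : ℝ} (ha : 0 ≤ a) (hp : 2 ≤ p) (hpq : p ≤ q) :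
    a ^ p ≤ a ^ (2 : ℝ) + a ^ q := by
  rcases ha.eq_or_lt with rfl | ha
  · rw [Real.zero_rpow (by linarith), Real.zero_rpow (by linarith), Real.zero_rpow (by linarith)]
    simp
  rcases le_total a 1 with h | h
  · have := Real.rpow_le_rpow_of_exponent_ge ha h hp
    have : 0 < a ^ q := by positivity
    linarith
  · have := Real.rpow_le_rpow_of_exponent_le h hpq
    have : 0 < a ^ (2 : ℝ) := by positivity
    linarith

lemma Hs.int_rpow (hN : 2 ≤ N) (hs : s ∈ Set.Ioo (0 : ℝ) 1) (hu : Hs N s u) {p : ℝ}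
    (hp : 2 ≤ p) (hpq : p ≤ critExp N s) : Integrable (fun x => |u x| ^ p) := by
  refine (hu.int_two.add (hu.int_crit hN hs)).mono' (hu.meas.abs.pow_const _).aestronglyMeasurable
    (Eventually.of_forall fun x => ?_)
  rw [Real.norm_of_nonneg (by positivity)]
  exact rpow_le_add_rpow (abs_nonneg _) hp hpq

lemma pint_le_add (hN : 2 ≤ N) (hs : s ∈ Set.Ioo (0 : ℝ) 1) (hu : Hs N s u) {p : ℝ}
    (hp : 2 ≤ p) (hpq : p ≤ critExp N s) : pint N p u ≤ pint N 2 u + pint N (critExp N s) u := by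
  unfold pint
  rw [← integral_add hu.int_two (hu.int_crit hN hs)]
  exact integral_mono (hu.int_rpow hN hs hp hpq) (hu.int_two.add (hu.int_crit hN hs))
    fun x => rpow_le_add_rpow (abs_nonneg _) hp hpq

/-- Cauchy-Schwarz against constants. -/
lemma sq_integral_le {α : Type*} [MeasurableSpace α] {μ : Measure α} [IsFiniteMeasure μ]
    {f : α → ℝ} (hf : MemLp f 2 μ) (hμ : 0 < μ.real Set.univ) :
    (∫ x, f x ∂μ) ^ 2 ≤ μ.real Set.univ * ∫ x, f x ^ 2 ∂μ := by
  set c := (∫ x, f x ∂μ) / μ.real Set.univ with hc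
  have h := integral_sq_line hf (memLp_const (1 : ℝ)) (-c)
  have h0 : 0 ≤ ∫ x, (f x + -c * 1) ^ 2 ∂μ := integral_nonneg fun x => sq_nonneg _
  rw [h] at h0
  simp only [mul_one, one_pow, integral_const, smul_eq_mul] at h0
  have e : ∫ x, f x ∂μ = c * μ.real Set.univ := by rw [hc]; field_simp
  rw [e] at h0 ⊢
  nlinarith

/-- Ball averages. -/
def bavg (N : ℕ) (r : ℝ) (w : Sp N → ℝ) (x : Sp N) : ℝ :=
  (∫ y in Metric.ball x r, w y) / (r ^ N * ballVol N)

lemma volume_real_ball (x : Sp N) {r : ℝ} (hr : 0 < r) :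
    volume.real (Metric.ball x r) = r ^ N * ballVol N := by
  have := ballVol_pos (N := N)
  rw [measureReal_def, volume_ball_eq x hr, ENNReal.toReal_ofReal (by positivity)]

lemma measurable_bavg {r : ℝ} (hw : Measurable w) : Measurable (bavg N r w) := by
  unfold bavg
  refine Measurable.div_const ?_ _
  have e : (fun x => ∫ y in Metric.ball x r, w y) =
      fun x => ∫ y, (if dist y x < r then w y else 0) := by
    ext x
    rw [← integral_indicator measurableSet_ball]
    congr 1
  rw [e]
  refine StronglyMeasurable.measurable ?_
  refine StronglyMeasurable.integral_prod_right (f := fun x y => if dist y x < r then w y else 0) ?_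
  refine Measurable.stronglyMeasurable ?_
  refine Measurable.ite (measurableSet_lt ?_ measurable_const) ?_ measurable_const
  · exact (measurable_snd.dist measurable_fst)
  · exact hw.comp measurable_snd

lemma sq_bavg_le {r : ℝ} (hr : 0 < r) (hw : MemLp w 2) (x : Sp N) :
    bavg N r w x ^ 2 ≤ (∫ y in Metric.ball x r, w y ^ 2) / (r ^ N * ballVol N) := by
  have hV := ballVol_pos (N := N)
  have : IsFiniteMeasure (volume.restrict (Metric.ball x r)) :=
    ⟨by rw [Measure.restrict_apply_univ]; exact measure_ball_lt_top⟩
  have hm : (volume.restrict (Metric.ball x r)).real Set.univ = r ^ N * ballVol N := by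
    rw [measureReal_restrict_apply_univ, volume_real_ball x hr]
  have h := sq_integral_le (hw.restrict (Metric.ball x r)) (by rw [hm]; positivity)
  rw [hm] at h
  unfold bavg
  rw [div_pow, div_le_div_iff₀ (by positivity) (by positivity)]
  nlinarith [mul_le_mul_of_nonneg_right h (by positivity : 0 ≤ r ^ N * ballVol N)]

lemma sq_bavg_le_pint {r : ℝ} (hr : 0 < r) (hw : MemLp w 2) (x : Sp N) :
    bavg N r w x ^ 2 ≤ pint N 2 w / (r ^ N * ballVol N) := by
  have hV := ballVol_pos (N := N)
  refine (sq_bavg_le hr hw x).trans ?_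
  gcongr
  unfold pint
  simp only [Real.rpow_ofNat, sq_abs]
  exact setIntegral_le_integral hw.integrable_sq (Eventually.of_forall fun y => sq_nonneg _)

lemma sub_bavg (hw : MemLp w 2) {r : ℝ} (hr : 0 < r) (x : Sp N) :
    w x - bavg N r w x = bavg N r (fun y => w x - w y) x := by
  have hV := ballVol_pos (N := N)
  have : IsFiniteMeasure (volume.restrict (Metric.ball x r)) :=
    ⟨by rw [Measure.restrict_apply_univ]; exact measure_ball_lt_top⟩
  unfold bavg
  rw [integral_sub (integrable_const _) ((hw.restrict _).integrable (by norm_num)), integral_const,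
    measureReal_restrict_apply_univ, volume_real_ball x hr, smul_eq_mul]
  have : 0 < r ^ N * ballVol N := by positivity
  field_simp

lemma ofReal_sq_sub_bavg_le (hs : 0 < s) (hw : MemLp w 2) {r : ℝ} (hr : 0 < r)
    (x : Sp N) :
    ENNReal.ofReal ((w x - bavg N r w x) ^ 2) ≤ ENNReal.ofReal (r ^ (2 * s) / ballVol N) *
      ∫⁻ y, ENNReal.ofReal (|w x - w y| ^ 2 / ‖x - y‖ ^ ((N : ℝ) + 2 * s)) := by
  have hV := ballVol_pos (N := N)
  have : IsFiniteMeasure (volume.restrict (Metric.ball x r)) :=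
    ⟨by rw [Measure.restrict_apply_univ]; exact measure_ball_lt_top⟩
  have hd : MemLp (fun y => w x - w y) 2 (volume.restrict (Metric.ball x r)) :=
    (memLp_const _).sub (hw.restrict _)
  have hmu : (volume.restrict (Metric.ball x r)).real Set.univ = r ^ N * ballVol N := by
    rw [measureReal_restrict_apply_univ, volume_real_ball x hr]
  have h := sq_integral_le hd (by rw [hmu]; positivity)
  rw [hmu] at h
  have h2 : (w x - bavg N r w x) ^ 2 ≤
      (r ^ N * ballVol N)⁻¹ * ∫ y in Metric.ball x r, (w x - w y) ^ 2 := by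
    rw [sub_bavg hw hr]; unfold bavg
    have : 0 < r ^ N * ballVol N := by positivity
    rw [div_pow, div_le_iff₀ (by positivity)]
    refine h.trans (le_of_eq ?_)
    field_simp
  calc ENNReal.ofReal ((w x - bavg N r w x) ^ 2)
      ≤ ENNReal.ofReal ((r ^ N * ballVol N)⁻¹ * ∫ y in Metric.ball x r, (w x - w y) ^ 2) :=
        ENNReal.ofReal_le_ofReal h2
    _ = ENNReal.ofReal ((r ^ N * ballVol N)⁻¹) *
        ∫⁻ y in Metric.ball x r, ENNReal.ofReal ((w x - w y) ^ 2) := by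
        rw [ENNReal.ofReal_mul (by positivity), ofReal_integral_eq_lintegral_ofReal
          hd.integrable_sq (Eventually.of_forall fun y => sq_nonneg _)]
    _ ≤ ENNReal.ofReal ((r ^ N * ballVol N)⁻¹) * (∫⁻ y in Metric.ball x r,
          ENNReal.ofReal (r ^ ((N : ℝ) + 2 * s)) *
          ENNReal.ofReal (|w x - w y| ^ 2 / ‖x - y‖ ^ ((N : ℝ) + 2 * s))) := by
        refine mul_le_mul_right ?_ _
        refine setLIntegral_mono' (measurableSet_ball (x := x) (ε := r)) fun y hy => ?_
        rw [← ENNReal.ofReal_mul (by positivity)]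
        apply ENNReal.ofReal_le_ofReal
        have h1 : ‖x - y‖ < r := by
          rwa [Metric.mem_ball, dist_comm, dist_eq_norm] at hy
        rcases eq_or_ne x y with rfl | hxy
        · simp
        have h4 : 0 < ‖x - y‖ := by rwa [norm_pos_iff, sub_ne_zero]
        rw [sq_abs, ← mul_div_assoc, le_div_iff₀ (by positivity), mul_comm]
        gcongr
    _ ≤ ENNReal.ofReal ((r ^ N * ballVol N)⁻¹) * (ENNReal.ofReal (r ^ ((N : ℝ) + 2 * s)) *
        ∫⁻ y, ENNReal.ofReal (|w x - w y| ^ 2 / ‖x - y‖ ^ ((N : ℝ) + 2 * s))) := by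
        rw [lintegral_const_mul' _ _ (by simp)]
        gcongr
        exact Measure.restrict_le_self
    _ = _ := by
        rw [← mul_assoc, ← ENNReal.ofReal_mul (by positivity)]
        congr 2
        rw [Real.rpow_add hr, Real.rpow_natCast]
        field_simp

lemma lintegral_sq_sub_bavg_le (hs : 0 < s) (hw : Hs N s w) {r : ℝ} (hr : 0 < r) :
    ∫⁻ x, ENNReal.ofReal ((w x - bavg N r w x) ^ 2) ≤
      ENNReal.ofReal (r ^ (2 * s) / ballVol N * gag N s w) := by
  have hV := ballVol_pos (N := N)
  refine (lintegral_mono (ofReal_sq_sub_bavg_le hs hw.l2 hr)).trans ?_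
  rw [lintegral_const_mul' _ _ (by simp), ENNReal.ofReal_mul (by positivity), ofReal_gag hw]
  rfl

lemma memLp_sub_bavg (hs : 0 < s) (hw : Hs N s w) {r : ℝ} (hr : 0 < r) :
    MemLp (fun x => w x - bavg N r w x) 2 := by
  refine (lintegral_ne_top_iff_memLp_two (hw.meas.sub (measurable_bavg hw.meas))).1 ?_
  exact ne_top_of_le_ne_top ENNReal.ofReal_ne_top (lintegral_sq_sub_bavg_le hs hw hr)

lemma integral_sq_sub_bavg_le (hs : 0 < s) (hw : Hs N s w) {r : ℝ} (hr : 0 < r) :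
    ∫ x, (w x - bavg N r w x) ^ 2 ≤ r ^ (2 * s) / ballVol N * gag N s w := by
  have hV := ballVol_pos (N := N)
  have := gag_nonneg (N := N) (s := s) (u := w)
  rw [← ENNReal.ofReal_le_ofReal_iff (by positivity), ofReal_integral_eq_lintegral_ofReal
    (memLp_sub_bavg hs hw hr).integrable_sq (Eventually.of_forall fun y => sq_nonneg _)]
  exact lintegral_sq_sub_bavg_le hs hw hr

lemma memLp_bavg (hs : 0 < s) (hw : Hs N s w) {r : ℝ} (hr : 0 < r) :
    MemLp (bavg N r w) 2 := by
  have := hw.l2.sub (memLp_sub_bavg hs hw hr)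
  convert this using 1
  ext x; simp

lemma integral_sq_bavg_le (hs : 0 < s) (hw : Hs N s w) {r : ℝ} (hr : 0 < r) :
    ∫ x, bavg N r w x ^ 2 ≤ 2 * pint N 2 w + 2 * (r ^ (2 * s) / ballVol N * gag N s w) := by
  have h1 := (memLp_sub_bavg hs hw hr).integrable_sq
  have h2 := integral_sq_sub_bavg_le hs hw hr
  have e : ∫ x, bavg N r w x ^ 2 ≤ ∫ x, (2 * w x ^ 2 + 2 * (w x - bavg N r w x) ^ 2) := by
    refine integral_mono (memLp_bavg hs hw hr).integrable_sq
      ((hw.l2.integrable_sq.const_mul 2).add (h1.const_mul 2)) fun x => ?_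
    simp only
    nlinarith [sq_nonneg (2 * w x - bavg N r w x)]
  rw [integral_add (hw.l2.integrable_sq.const_mul 2) (h1.const_mul 2), integral_const_mul,
    integral_const_mul] at e
  unfold pint
  simp only [Real.rpow_ofNat, sq_abs]
  linarith

/-- A linear isometry moving `x` to `y` when their norms agree. -/
lemma exists_isometry {x y : Sp N} (h : ‖x‖ = ‖y‖) : ∃ R : Sp N ≃ₗᵢ[ℝ] Sp N, R x = y :=
  ⟨_, Submodule.reflection_sub h⟩

lemma setIntegral_ball_isometry (R : Sp N ≃ₗᵢ[ℝ] Sp N) (f : Sp N → ℝ) (x : Sp N) (r : ℝ) :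
    ∫ y in Metric.ball (R x) r, f y = ∫ y in Metric.ball x r, f (R y) := by
  have := R.measurePreserving.setIntegral_preimage_emb
    R.toHomeomorph.measurableEmbedding f (Metric.ball (R x) r)
  rw [← this]
  congr 2
  ext y; simp

lemma Rad.comp_isometry (hw : Rad w) (R : Sp N ≃ₗᵢ[ℝ] Sp N) (x : Sp N) : w (R x) = w x :=
  hw _ _ (R.norm_map x)

/-- Mass of a radial function in far away balls is small. -/
lemma exists_far_ball_le (hN : 2 ≤ N) {r : ℝ} (hr : 0 < r) (k : ℕ) :
    ∃ R : ℝ, ∀ w : Sp N → ℝ, Rad w → MemLp w 2 → ∀ x, R ≤ ‖x‖ →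
      k * ∫ y in Metric.ball x r, w y ^ 2 ≤ pint N 2 w := by
  have hrank : 1 < Module.rank ℝ (Sp N) := by
    rw [← Module.finrank_eq_rank, finrank_euclideanSpace_fin]; exact_mod_cast hN
  have : Nontrivial (Sp N) := rank_pos_iff_nontrivial.1 (by exact zero_lt_one.trans hrank)
  have hinf : (Metric.sphere (0 : Sp N) 1).Infinite := by
    refine (isPreconnected_sphere hrank 0 1).infinite_of_nontrivial ?_
    obtain ⟨v, hv⟩ := exists_norm_eq (Sp N) (zero_le_one' ℝ)
    refine ⟨v, by simpa using hv, -v, by simpa using hv, ?_⟩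
    intro h
    have h2 : (2 : ℝ) • v = 0 := by rw [two_smul]; nth_rewrite 1 [h]; simp
    have : v = 0 := by simpa using h2
    rw [this] at hv; simp at hv
  obtain ⟨t, hts, htk⟩ := hinf.exists_subset_card_eq k
  have hδ : ∃ δ > 0, ∀ e ∈ t, ∀ e' ∈ t, e ≠ e' → δ ≤ dist e e' := by
    have hd : Set.Finite ((fun p : Sp N × Sp N => dist p.1 p.2) ''
        ((t ×ˢ t : Finset _) : Set (Sp N × Sp N))) := (Finset.finite_toSet _).image _
    have h1 : ∀ᶠ δ : ℝ in 𝓝[>] 0, ∀ p ∈ (t ×ˢ t), p.1 ≠ p.2 → δ ≤ dist p.1 p.2 := by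
      rw [Filter.eventually_all_finset]
      intro p _
      by_cases hp : p.1 = p.2
      · simp [hp]
      · have : 0 < dist p.1 p.2 := dist_pos.2 hp
        filter_upwards [Ioo_mem_nhdsGT this] with δ hδ _ using hδ.2.le
    obtain ⟨δ, h2, h3⟩ := (h1.and self_mem_nhdsWithin).exists
    exact ⟨δ, h3, fun e he e' he' hne => h2 (e, e') (Finset.mk_mem_product he he') hne⟩
  obtain ⟨δ, hδ0, hδ⟩ := hδ
  refine ⟨2 * r / δ, fun w hw hw2 x hx => ?_⟩
  rw [div_le_iff₀ hδ0] at hx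
  have hball : ∀ e ∈ t, ∫ y in Metric.ball (‖x‖ • e) r, w y ^ 2 =
      ∫ y in Metric.ball x r, w y ^ 2 := by
    intro e he
    have he1 : ‖e‖ = 1 := by simpa using hts he
    obtain ⟨R, hR⟩ := exists_isometry (N := N) (x := x) (y := ‖x‖ • e) (by
      rw [norm_smul, he1]; simp)
    rw [← hR, setIntegral_ball_isometry]
    simp_rw [hw.comp_isometry R]
  have hdisj : Set.Pairwise (↑t) (fun e e' : Sp N =>
      Disjoint (Metric.ball (‖x‖ • e) r) (Metric.ball (‖x‖ • e') r)) := by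
    intro e he e' he' hne
    apply Metric.ball_disjoint_ball
    rw [dist_smul₀, Real.norm_of_nonneg (norm_nonneg _)]
    have := hδ e he e' he' hne
    nlinarith [norm_nonneg x]
  have hsum : ∫ y in ⋃ e ∈ t, Metric.ball (‖x‖ • e) r, w y ^ 2 =
      ∑ e ∈ t, ∫ y in Metric.ball (‖x‖ • e) r, w y ^ 2 :=
    integral_biUnion_finset t (fun _ _ => measurableSet_ball) hdisj
      (fun _ _ => hw2.integrable_sq.integrableOn)
  rw [Finset.sum_congr rfl hball, Finset.sum_const, htk, nsmul_eq_mul] at hsum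
  rw [← hsum]
  unfold pint
  simp only [Real.rpow_ofNat, sq_abs]
  exact setIntegral_le_integral hw2.integrable_sq (Eventually.of_forall fun y => sq_nonneg _)

lemma exists_young {p q ε : ℝ} (hp : 2 < p) (hpq : p < q) (hε : 0 < ε) :
    ∃ C > 0, ∀ a : ℝ, 0 ≤ a → a ^ p ≤ ε * a ^ q + C * a ^ 2 := by
  set T := ε ^ (-(1 / (q - p))) with hT
  have hT0 : 0 < T := by positivity
  refine ⟨T ^ (p - 2), by positivity, fun a ha => ?_⟩
  rcases ha.eq_or_lt with rfl | ha
  · rw [Real.zero_rpow (by linarith), Real.zero_rpow (by linarith)]; simp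
  have e2 : a ^ p = a ^ (p - 2) * a ^ 2 := by
    rw [← Real.rpow_natCast a 2, ← Real.rpow_add ha]; norm_num
  have eq : a ^ q = a ^ p * a ^ (q - p) := by
    rw [← Real.rpow_add ha]; ring_nf
  rcases le_total a T with h | h
  · have : a ^ (p - 2) ≤ T ^ (p - 2) := Real.rpow_le_rpow ha.le h (by linarith)
    have : 0 ≤ ε * a ^ q := by positivity
    rw [e2]
    nlinarith [sq_nonneg a]
  · have h1 : T ^ (q - p) ≤ a ^ (q - p) := Real.rpow_le_rpow hT0.le h (by linarith)
    have h2 : T ^ (q - p) = ε⁻¹ := by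
      rw [hT, ← Real.rpow_mul hε.le, neg_mul, one_div, inv_mul_cancel₀ (by linarith),
        Real.rpow_neg_one]
    rw [h2, inv_le_iff_one_le_mul₀ hε] at h1
    have : 0 ≤ T ^ (p - 2) * a ^ 2 := by positivity
    have : 0 < a ^ p := by positivity
    rw [eq]
    nlinarith

lemma integrable_rpow_bavg (hs : 0 < s) (hw : Hs N s w) {r p : ℝ} (hr : 0 < r) (hp : 2 < p) :
    Integrable (fun x => |bavg N r w x| ^ p) := by
  set c := √(pint N 2 w / (r ^ N * ballVol N)) with hc
  refine ((memLp_bavg hs hw hr).integrable_sq.const_mul (c ^ (p - 2))).mono'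
    ((measurable_bavg hw.meas).abs.pow_const _).aestronglyMeasurable
    (Eventually.of_forall fun x => ?_)
  rw [Real.norm_of_nonneg (by positivity)]
  have h1 : |bavg N r w x| ≤ c := Real.abs_le_sqrt (sq_bavg_le_pint hr hw.l2 x)
  rcases (abs_nonneg (bavg N r w x)).eq_or_lt with h | h
  · rw [← h, Real.zero_rpow (by linarith)]; positivity
  · have e : |bavg N r w x| ^ p = |bavg N r w x| ^ (p - 2) * bavg N r w x ^ 2 := by
      rw [← sq_abs, ← Real.rpow_natCast _ 2, ← Real.rpow_add h]; norm_num
    rw [e]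
    gcongr

/-- Ball averages of a bounded radial family which tend to zero pointwise tend to zero in `L^p`. -/
lemma tendsto_pint_bavg (hN : 2 ≤ N) (hs : 0 < s) {p : ℝ} (hp : 2 < p) {ι : Type*}
    {l : Filter ι} [l.IsCountablyGenerated] {w : ι → Sp N → ℝ} (hw : ∀ i, Hs N s (w i))
    (hrad : ∀ i, Rad (w i)) {K : ℝ} (h2 : ∀ i, pint N 2 (w i) ≤ K) (hg : ∀ i, gag N s (w i) ≤ K)
    {r : ℝ} (hr : 0 < r) (hlim : ∀ x, Tendsto (fun i => bavg N r (w i) x) l (𝓝 0)) :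
    Tendsto (fun i => pint N p (bavg N r (w i))) l (𝓝 0) := by
  rcases isEmpty_or_nonempty ι with he | ⟨⟨i0⟩⟩
  · have : l = ⊥ := filter_eq_bot_of_isEmpty l
    rw [this]; exact tendsto_bot
  have hV := ballVol_pos (N := N)
  have hK : 0 ≤ K := pint_nonneg.trans (h2 i0)
  have hB : 0 < r ^ N * ballVol N := by positivity
  set K' := 2 * K + 2 * (r ^ (2 * s) / ballVol N * K) with hK'
  have hK'0 : 0 ≤ K' := by positivity
  have hKi : ∀ i, ∫ x, bavg N r (w i) x ^ 2 ≤ K' := fun i => by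
    refine (integral_sq_bavg_le hs (hw i) hr).trans ?_
    have := h2 i; have := hg i
    rw [hK']; gcongr
  rw [Metric.tendsto_nhds]
  intro ε hε
  have htail : ∃ R : ℝ, ∀ i, ∫ x in (Metric.ball (0 : Sp N) R)ᶜ,
    |bavg N r (w i) x| ^ p ≤ ε / 2 := by
    have h1 : Tendsto (fun k : ℕ => √(K / (r ^ N * ballVol N) / k) ^ (p - 2) * K') atTop
        (𝓝 0) := by
      have a1 := tendsto_const_div_atTop_nhds_zero_nat (K / (r ^ N * ballVol N))
      have a2 := (Real.continuous_sqrt.tendsto 0).comp a1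
      rw [Real.sqrt_zero] at a2
      have a3 := (a2.rpow_const (p := p - 2) (Or.inr (by linarith))).mul_const K'
      rwa [Real.zero_rpow (by linarith), zero_mul] at a3
    obtain ⟨k, hk1, hk2⟩ := ((h1.eventually
      (eventually_le_nhds (by positivity : (0 : ℝ) < ε / 2))).and
      (eventually_gt_atTop 0)).exists
    obtain ⟨R, hR⟩ := exists_far_ball_le hN hr k
    refine ⟨R, fun i => le_trans ?_ hk1⟩
    set c := √(K / (r ^ N * ballVol N) / k) with hc
    have hk : (0 : ℝ) < k := by exact_mod_cast hk2
    have h_int := (memLp_bavg hs (hw i) hr).integrable_sq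
    calc ∫ x in (Metric.ball (0 : Sp N) R)ᶜ, |bavg N r (w i) x| ^ p
        ≤ ∫ x in (Metric.ball (0 : Sp N) R)ᶜ, c ^ (p - 2) * bavg N r (w i) x ^ 2 := by
          refine setIntegral_mono_on (integrable_rpow_bavg hs (hw i) hr hp).integrableOn
            (h_int.const_mul _).integrableOn measurableSet_ball.compl fun x hx => ?_
          have hx' : R ≤ ‖x‖ := by simpa using hx
          have h3 := hR (w i) (hrad i) (hw i).l2 x hx'
          have h4 := sq_bavg_le hr (hw i).l2 x
          have h5 : |bavg N r (w i) x| ≤ c := by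
            apply Real.abs_le_sqrt
            refine h4.trans ?_
            rw [div_right_comm]
            gcongr
            rw [le_div_iff₀ hk, mul_comm]
            exact h3.trans (h2 i)
          rcases (abs_nonneg (bavg N r (w i) x)).eq_or_lt with h | h
          · rw [← h, Real.zero_rpow (by linarith)]; positivity
          · have e : |bavg N r (w i) x| ^ p =
                |bavg N r (w i) x| ^ (p - 2) * bavg N r (w i) x ^ 2 := by
              rw [← sq_abs, ← Real.rpow_natCast _ 2, ← Real.rpow_add h]; norm_num
            rw [e]
            gcongr
      _ ≤ ∫ x, c ^ (p - 2) * bavg N r (w i) x ^ 2 :=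
          setIntegral_le_integral (h_int.const_mul _) (Eventually.of_forall fun x => by positivity)
      _ ≤ c ^ (p - 2) * K' := by
          rw [integral_const_mul]; gcongr; exact hKi i
  obtain ⟨R, hR⟩ := htail
  have hlocal : Tendsto (fun i => ∫ x in Metric.ball (0 : Sp N) R, |bavg N r (w i) x| ^ p) l
      (𝓝 (∫ x in Metric.ball (0 : Sp N) R, (0 : ℝ))) := by
    refine tendsto_integral_filter_of_dominated_convergence
      (fun _ => √(K / (r ^ N * ballVol N)) ^ p) ?_ ?_ ?_ ?_
    · exact Eventually.of_forall fun i =>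
        ((measurable_bavg (hw i).meas).abs.pow_const _).aestronglyMeasurable
    · refine Eventually.of_forall fun i => Eventually.of_forall fun x => ?_
      rw [Real.norm_of_nonneg (by positivity)]
      refine Real.rpow_le_rpow (abs_nonneg _) (Real.abs_le_sqrt ?_) (by linarith)
      refine (sq_bavg_le_pint hr (hw i).l2 x).trans ?_
      gcongr
      exact h2 i
    · exact integrableOn_const measure_ball_lt_top.ne
    · refine Eventually.of_forall fun x => ?_
      have := ((hlim x).abs).rpow_const (p := p) (Or.inr (by linarith))
      rwa [abs_zero, Real.zero_rpow (by linarith)] at this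
  rw [integral_zero] at hlocal
  filter_upwards [hlocal.eventually (eventually_lt_nhds (by positivity : (0 : ℝ) < ε / 2))]
    with i hi
  rw [Real.dist_eq, sub_zero, abs_of_nonneg pint_nonneg]
  have hsplit := integral_add_compl (measurableSet_ball (x := (0 : Sp N)) (ε := R))
    (integrable_rpow_bavg hs (hw i) hr hp)
  unfold pint
  rw [← hsplit]
  linarith [hR i]

lemma abs_rpow_le_split {p q ε C : ℝ} (hp : 0 ≤ p) (hε : 0 ≤ ε) (hC : 0 ≤ C)
    (hY : ∀ a : ℝ, 0 ≤ a → a ^ p ≤ ε * a ^ q + C * a ^ 2) (a b : ℝ) :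
    |a| ^ p ≤ 2 ^ p * |b| ^ p + ε * |a| ^ q + 4 * C * (a - b) ^ 2 := by
  rcases le_total |a| (2 * |b|) with h | h
  · have h1 := Real.rpow_le_rpow (abs_nonneg a) h hp
    rw [Real.mul_rpow (by norm_num) (abs_nonneg _)] at h1
    have : 0 ≤ ε * |a| ^ q + 4 * C * (a - b) ^ 2 := by positivity
    linarith
  · have h1 := hY |a| (abs_nonneg _)
    have h2 : |a| ≤ 2 * |a - b| := by
      have := abs_sub_abs_le_abs_sub a b; linarith
    have h3 : |a| ^ 2 ≤ 4 * (a - b) ^ 2 := by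
      rw [← sq_abs (a - b)]; nlinarith [abs_nonneg a]
    have h4 : 0 ≤ 2 ^ p * |b| ^ p := by positivity
    nlinarith

/-- Compactness of the radial embedding, in the form needed for weak null families. -/
lemma tendsto_pint_of_bavg (hN : 2 ≤ N) (hs : s ∈ Set.Ioo (0 : ℝ) 1) {p : ℝ} (hp : 2 < p)
    (hpq : p < critExp N s) {ι : Type*}
    {l : Filter ι} [l.IsCountablyGenerated] {w : ι → Sp N → ℝ} (hw : ∀ i, Hs N s (w i))
    (hrad : ∀ i, Rad (w i)) {K : ℝ} (h2 : ∀ i, pint N 2 (w i) ≤ K) (hg : ∀ i, gag N s (w i) ≤ K)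
    (hlim : ∀ r > 0, ∀ x, Tendsto (fun i => bavg N r (w i) x) l (𝓝 0)) :
    Tendsto (fun i => pint N p (w i)) l (𝓝 0) := by
  rcases isEmpty_or_nonempty ι with he | ⟨⟨i0⟩⟩
  · have : l = ⊥ := filter_eq_bot_of_isEmpty l
    rw [this]; exact tendsto_bot
  have hV := ballVol_pos (N := N)
  have hS := sobConst_pos (N := N) (s := s)
  have hq := critExp_pos hN hs
  have hK : 0 ≤ K := pint_nonneg.trans (h2 i0)
  set q := critExp N s with hqdef
  set K1 := sobConst N s * K ^ (q / 2) with hK1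
  have hK10 : 0 ≤ K1 := by positivity
  have hcrit : ∀ i, pint N q (w i) ≤ K1 := fun i => by
    refine (sobolev hN hs (hw i)).trans ?_
    exact mul_le_mul_of_nonneg_left
      (Real.rpow_le_rpow gag_nonneg (hg i) (by linarith : 0 ≤ q / 2)) hS.le
  rw [Metric.tendsto_nhds]
  intro ε hε
  set ε1 := ε / (3 * (K1 + 1)) with hε1
  have hε10 : 0 < ε1 := by positivity
  obtain ⟨C, hC, hY⟩ := exists_young hp hpq hε10
  obtain ⟨r, hr, hr2⟩ : ∃ r > 0, 4 * C * (r ^ (2 * s) / ballVol N * K) < ε / 3 := by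
    have h1 : Tendsto (fun r : ℝ => 4 * C * (r ^ (2 * s) / ballVol N * K)) (𝓝[>] 0) (𝓝 0) := by
      have a1 : Tendsto (fun r : ℝ => r ^ (2 * s)) (𝓝[>] 0) (𝓝 0) := by
        have := (tendsto_id (x := 𝓝 (0 : ℝ))).rpow_const (p := 2 * s)
          (Or.inr (by linarith [hs.1]))
        rw [Real.zero_rpow (by linarith [hs.1])] at this
        exact this.mono_left nhdsWithin_le_nhds
      have a2 := ((a1.div_const (ballVol N)).mul_const K).const_mul (4 * C)
      simpa using a2
    obtain ⟨r, h3, h4⟩ := ((h1.eventually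
      (eventually_lt_nhds (by positivity : (0 : ℝ) < ε / 3))).and
      self_mem_nhdsWithin).exists
    exact ⟨r, h4, h3⟩
  have hh := (tendsto_pint_bavg hN hs.1 hp hw hrad h2 hg hr (hlim r hr)).const_mul (2 ^ p)
  rw [mul_zero] at hh
  filter_upwards [hh.eventually (eventually_lt_nhds (by positivity : (0 : ℝ) < ε / 3))] with i hi
  rw [Real.dist_eq, sub_zero, abs_of_nonneg pint_nonneg]
  have i1 := (integrable_rpow_bavg hs.1 (hw i) hr hp).const_mul (2 ^ p)
  have i2 := ((hw i).int_crit hN hs).const_mul ε1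
  have i3 := (memLp_sub_bavg hs.1 (hw i) hr).integrable_sq.const_mul (4 * C)
  have i12 : Integrable (fun x => 2 ^ p * |bavg N r (w i) x| ^ p + ε1 * |w i x| ^ critExp N s) :=
    i1.add i2
  have hle : pint N p (w i) ≤ ∫ x, (2 ^ p * |bavg N r (w i) x| ^ p + ε1 * |w i x| ^ critExp N s +
      4 * C * (w i x - bavg N r (w i) x) ^ 2) :=
    integral_mono ((hw i).int_rpow hN hs hp.le hpq.le) (i12.add i3) fun x =>
      abs_rpow_le_split (by linarith) hε10.le hC.le hY _ _
  rw [integral_add i12 i3, integral_add i1 i2, integral_const_mul, integral_const_mul,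
    integral_const_mul] at hle
  have h3 := integral_sq_sub_bavg_le hs.1 (hw i) hr
  have h4 : 4 * C * ∫ x, (w i x - bavg N r (w i) x) ^ 2 < ε / 3 := by
    refine lt_of_le_of_lt ?_ hr2
    have := h3.trans (mul_le_mul_of_nonneg_left (hg i) (by positivity))
    gcongr
  have h5 : ε1 * ∫ x, |w i x| ^ critExp N s ≤ ε / 3 := by
    have : ε1 * pint N q (w i) ≤ ε1 * (K1 + 1) := by gcongr; linarith [hcrit i]
    refine this.trans (le_of_eq ?_)
    rw [hε1]; field_simp
  unfold pint at hi hle ⊢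
  linarith

lemma exists_brezis_lieb_ineq {q ε : ℝ} (hq : 0 < q) (hε : 0 < ε) :
    ∃ C > 0, ∀ a b : ℝ, |(|a + b| ^ q - |a| ^ q - |b| ^ q)| ≤ ε * |a| ^ q + C * |b| ^ q := by
  obtain ⟨δ, ⟨hδ0, hδ1⟩, h1, h2⟩ : ∃ δ : ℝ, δ ∈ Set.Ioo (0 : ℝ) 1 ∧
      (1 + δ) ^ q ≤ 1 + ε ∧ 1 - ε ≤ (1 - δ) ^ q := by
    have a1 : Tendsto (fun δ : ℝ => (1 + δ) ^ q) (𝓝[>] 0) (𝓝 1) := by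
      have : ContinuousAt (fun δ : ℝ => (1 + δ) ^ q) 0 :=
        ContinuousAt.rpow_const (by fun_prop) (Or.inr hq.le)
      have := this.tendsto
      simp only [add_zero, Real.one_rpow] at this
      exact this.mono_left nhdsWithin_le_nhds
    have a2 : Tendsto (fun δ : ℝ => (1 - δ) ^ q) (𝓝[>] 0) (𝓝 1) := by
      have : ContinuousAt (fun δ : ℝ => (1 - δ) ^ q) 0 :=
        ContinuousAt.rpow_const (by fun_prop) (Or.inr hq.le)
      have := this.tendsto
      simp only [sub_zero, Real.one_rpow] at this
      exact this.mono_left nhdsWithin_le_nhds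
    obtain ⟨δ, ⟨h1, h2⟩, h3⟩ := (((a1.eventually (eventually_le_nhds (by linarith : 1 < 1 + ε))).and
      (a2.eventually (eventually_ge_nhds (by linarith : 1 - ε < 1)))).and
      (Ioo_mem_nhdsGT one_pos)).exists
    exact ⟨δ, h3, h1, h2⟩
  refine ⟨(1 + 1 / δ) ^ q + 1, by positivity, fun a b => ?_⟩
  have hb0 : 0 ≤ |b| ^ q := by positivity
  have ha0 : 0 ≤ |a| ^ q := by positivity
  have hC : 0 < (1 + 1 / δ) ^ q := by positivity
  have hab := abs_add_le a b
  suffices h : |(|a + b| ^ q - |a| ^ q)| ≤ ε * |a| ^ q + (1 + 1 / δ) ^ q * |b| ^ q by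
    have := abs_sub (|a + b| ^ q - |a| ^ q) (|b| ^ q)
    rw [abs_of_nonneg hb0] at this
    linarith
  rcases le_total |b| (δ * |a|) with h | h
  · have u1 : |a + b| ^ q ≤ (1 + ε) * |a| ^ q := by
      calc |a + b| ^ q ≤ ((1 + δ) * |a|) ^ q :=
            Real.rpow_le_rpow (abs_nonneg _) (by linarith) hq.le
        _ = (1 + δ) ^ q * |a| ^ q := Real.mul_rpow (by linarith) (abs_nonneg _)
        _ ≤ _ := by gcongr
    have u2 : (1 - ε) * |a| ^ q ≤ |a + b| ^ q := by
      have : |a| - |b| ≤ |a + b| := by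
        have := abs_sub_abs_le_abs_sub a (-b); simpa using this
      calc (1 - ε) * |a| ^ q ≤ (1 - δ) ^ q * |a| ^ q := by gcongr
        _ = ((1 - δ) * |a|) ^ q := (Real.mul_rpow (by linarith) (abs_nonneg _)).symm
        _ ≤ _ := Real.rpow_le_rpow (mul_nonneg (by linarith) (abs_nonneg _)) (by linarith) hq.le
    have : 0 ≤ (1 + 1 / δ) ^ q * |b| ^ q := by positivity
    rw [abs_le]
    constructor <;> linarith
  · have hab2 : |a| ≤ 1 / δ * |b| := by
      rw [one_div, inv_mul_eq_div, le_div_iff₀ hδ0]; linarith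
    have u1 : |a + b| ^ q ≤ (1 + 1 / δ) ^ q * |b| ^ q := by
      rw [← Real.mul_rpow (by positivity) (abs_nonneg _)]
      exact Real.rpow_le_rpow (abs_nonneg _) (by linarith) hq.le
    have u2 : |a| ^ q ≤ (1 + 1 / δ) ^ q * |b| ^ q := by
      rw [← Real.mul_rpow (by positivity) (abs_nonneg _)]
      exact Real.rpow_le_rpow (abs_nonneg _) (by linarith [abs_nonneg b]) hq.le
    have : 0 ≤ |a + b| ^ q := by positivity
    have : 0 ≤ ε * |a| ^ q := by positivity
    rw [abs_le]
    constructor <;> linarith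

lemma abs_sub_rpow_le {q : ℝ} (hq : 0 ≤ q) (a b : ℝ) :
    |a - b| ^ q ≤ 2 ^ q * (|a| ^ q + |b| ^ q) := by
  have h : |a - b| ≤ 2 * max |a| |b| := by
    have := abs_sub a b
    have := le_max_left |a| |b|
    have := le_max_right |a| |b|
    linarith
  have h0 : 0 ≤ max |a| |b| := le_max_of_le_left (abs_nonneg _)
  calc |a - b| ^ q ≤ (2 * max |a| |b|) ^ q := Real.rpow_le_rpow (abs_nonneg _) h hq
    _ = 2 ^ q * (max |a| |b|) ^ q := Real.mul_rpow (by norm_num) h0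
    _ ≤ _ := by
      gcongr
      have : 0 ≤ |a| ^ q := by positivity
      have : 0 ≤ |b| ^ q := by positivity
      rcases max_choice |a| |b| with h | h <;> rw [h] <;> linarith

lemma integrable_abs_sub_rpow {α : Type*} [MeasurableSpace α] {μ : Measure α} {q : ℝ} (hq : 0 ≤ q)
    {f g : α → ℝ} (hf : Measurable f) (hg : Measurable g) (hfi : Integrable (fun x => |f x| ^ q) μ)
    (hgi : Integrable (fun x => |g x| ^ q) μ) : Integrable (fun x => |f x - g x| ^ q) μ := by
  refine ((hfi.add hgi).const_mul (2 ^ q)).mono'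
    ((hf.sub hg).abs.pow_const _).aestronglyMeasurable (Eventually.of_forall fun x => ?_)
  rw [Real.norm_of_nonneg (by positivity)]
  exact abs_sub_rpow_le hq _ _

/-- The Brezis-Lieb lemma. -/
lemma brezis_lieb {α : Type*} [MeasurableSpace α] {μ : Measure α} {q : ℝ} (hq : 0 < q)
    {f : ℕ → α → ℝ} {g : α → ℝ} (hf : ∀ n, Measurable (f n)) (hg : Measurable g)
    (hfi : ∀ n, Integrable (fun x => |f n x| ^ q) μ) (hgi : Integrable (fun x => |g x| ^ q) μ)
    {K : ℝ} (hK : ∀ n, ∫ x, |f n x| ^ q ∂μ ≤ K)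
    (hlim : ∀ᵐ x ∂μ, Tendsto (fun n => f n x) atTop (𝓝 (g x))) :
    Tendsto (fun n => (∫ x, |f n x| ^ q ∂μ) - ∫ x, |f n x - g x| ^ q ∂μ) atTop
      (𝓝 (∫ x, |g x| ^ q ∂μ)) := by
  have hdi : ∀ n, Integrable (fun x => |f n x - g x| ^ q) μ := fun n =>
    integrable_abs_sub_rpow hq.le (hf n) hg (hfi n) hgi
  set K' := 2 ^ q * (K + ∫ x, |g x| ^ q ∂μ) with hK'
  have hdK : ∀ n, ∫ x, |f n x - g x| ^ q ∂μ ≤ K' := fun n => by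
    have h1 : ∫ x, |f n x - g x| ^ q ∂μ ≤ ∫ x, 2 ^ q * (|f n x| ^ q + |g x| ^ q) ∂μ :=
      integral_mono (hdi n) (((hfi n).add hgi).const_mul _) fun x => abs_sub_rpow_le hq.le _ _
    rw [integral_const_mul, integral_add (hfi n) hgi] at h1
    refine h1.trans ?_
    have := hK n
    rw [hK']; gcongr
  have hK'0 : 0 ≤ K' := (integral_nonneg fun x => by positivity).trans (hdK 0)
  rw [Metric.tendsto_atTop]
  intro ε hε
  set ε1 := ε / (2 * (K' + 1)) with hε1
  have hε10 : 0 < ε1 := by positivity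
  obtain ⟨C, hC, hI⟩ := exists_brezis_lieb_ineq hq hε10
  let W : ℕ → α → ℝ := fun n x =>
    max (|(|f n x| ^ q - |f n x - g x| ^ q - |g x| ^ q)| - ε1 * |f n x - g x| ^ q) 0
  have hWm : ∀ n, Measurable (W n) := fun n => by
    have := hf n
    simp only [W]
    fun_prop
  have hWb : ∀ n x, W n x ≤ C * |g x| ^ q := fun n x => by
    have := hI (f n x - g x) (g x)
    rw [sub_add_cancel] at this
    exact max_le (by linarith) (by positivity)
  have hW0 : ∀ n x, 0 ≤ W n x := fun n x => le_max_right _ _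
  have hWi : ∀ n, Integrable (W n) μ := fun n =>
    (hgi.const_mul C).mono' (hWm n).aestronglyMeasurable
      (Eventually.of_forall fun x => by rw [Real.norm_of_nonneg (hW0 n x)]; exact hWb n x)
  have hWlim : Tendsto (fun n => ∫ x, W n x ∂μ) atTop (𝓝 (∫ _, (0 : ℝ) ∂μ)) := by
    refine tendsto_integral_of_dominated_convergence (fun x => C * |g x| ^ q)
      (fun n => (hWm n).aestronglyMeasurable) (hgi.const_mul C)
      (fun n => Eventually.of_forall fun x => by
        rw [Real.norm_of_nonneg (hW0 n x)]; exact hWb n x) ?_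
    filter_upwards [hlim] with x hx
    have h1 := hx.abs.rpow_const (p := q) (Or.inr hq.le)
    have h2 : Tendsto (fun n => |f n x - g x| ^ q) atTop (𝓝 0) := by
      have := ((hx.sub_const (g x)).abs).rpow_const (p := q) (Or.inr hq.le)
      rwa [sub_self, abs_zero, Real.zero_rpow hq.ne'] at this
    have h3 := ((((h1.sub h2).sub_const (|g x| ^ q)).abs).sub (h2.const_mul ε1)).max
      (tendsto_const_nhds (x := (0 : ℝ)))
    simpa using h3
  rw [integral_zero] at hWlim
  obtain ⟨n0, hn0⟩ := eventually_atTop.1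
    (hWlim.eventually (eventually_lt_nhds (by positivity : (0 : ℝ) < ε / 2)))
  refine ⟨n0, fun n hn => ?_⟩
  have i1 : Integrable (fun x => |f n x| ^ q - |f n x - g x| ^ q) μ := (hfi n).sub (hdi n)
  rw [Real.dist_eq, ← integral_sub (hfi n) (hdi n), ← integral_sub i1 hgi]
  calc |∫ x, (|f n x| ^ q - |f n x - g x| ^ q - |g x| ^ q) ∂μ|
      ≤ ∫ x, |(|f n x| ^ q - |f n x - g x| ^ q - |g x| ^ q)| ∂μ := abs_integral_le_integral_abs
    _ ≤ ∫ x, (W n x + ε1 * |f n x - g x| ^ q) ∂μ := by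
        refine integral_mono (i1.sub hgi).abs ((hWi n).add ((hdi n).const_mul _)) fun x => ?_
        have := le_max_left
          (|(|f n x| ^ q - |f n x - g x| ^ q - |g x| ^ q)| - ε1 * |f n x - g x| ^ q) 0
        simp only [W]
        linarith
    _ = (∫ x, W n x ∂μ) + ε1 * ∫ x, |f n x - g x| ^ q ∂μ := by
        rw [integral_add (hWi n) ((hdi n).const_mul _), integral_const_mul]
    _ < ε / 2 + ε / 2 := by
        refine add_lt_add_of_lt_of_le (hn0 n hn) ?_
        have : ε1 * ∫ x, |f n x - g x| ^ q ∂μ ≤ ε1 * (K' + 1) := by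
          gcongr; linarith [hdK n]
        refine this.trans (le_of_eq ?_)
        rw [hε1]; field_simp
    _ = ε := by ring

/-- Bounded sequences in a separable inner product space have weakly Cauchy subsequences. -/
lemma exists_subseq_cauchySeq_inner {H : Type*} [NormedAddCommGroup H] [InnerProductSpace ℝ H]
    [TopologicalSpace.SeparableSpace H] (f : ℕ → H) {K : ℝ} (hf : ∀ n, ‖f n‖ ≤ K) :
    ∃ φ : ℕ → ℕ, StrictMono φ ∧ ∀ g, CauchySeq (fun n => inner ℝ (f (φ n)) g) := by
  have hK : 0 ≤ K := (norm_nonneg _).trans (hf 0)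
  obtain ⟨d, hd⟩ := TopologicalSpace.exists_dense_seq H
  have hcomp : IsCompact (Set.univ.pi fun k : ℕ => Set.Icc (-(K * ‖d k‖)) (K * ‖d k‖)) :=
    isCompact_univ_pi fun k => isCompact_Icc
  obtain ⟨a, -, φ, hφ, ha⟩ := hcomp.isSeqCompact (x := fun n k => inner ℝ (f n) (d k)) (by
    intro n k _
    have h1 := abs_real_inner_le_norm (f n) (d k)
    have h2 : ‖f n‖ * ‖d k‖ ≤ K * ‖d k‖ := by gcongr; exact hf n
    exact abs_le.1 (h1.trans h2))
  refine ⟨φ, hφ, fun g => ?_⟩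
  rw [Metric.cauchySeq_iff']
  intro ε hε
  obtain ⟨k, hk⟩ : ∃ k, dist g (d k) < ε / (4 * (K + 1)) :=
    hd.exists_dist_lt g (by positivity)
  have hc : CauchySeq (fun n => inner ℝ (f (φ n)) (d k)) :=
    (tendsto_pi_nhds.1 ha k).cauchySeq
  obtain ⟨n0, hn0⟩ := Metric.cauchySeq_iff'.1 hc (ε / 2) (by positivity)
  refine ⟨n0, fun n hn => ?_⟩
  have h1 := hn0 n hn
  rw [Real.dist_eq] at h1 ⊢
  have h2 : ∀ i, |inner ℝ (f (φ i)) (g - d k)| ≤ ε / 4 := fun i => by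
    refine (abs_real_inner_le_norm _ _).trans ?_
    rw [dist_eq_norm] at hk
    calc ‖f (φ i)‖ * ‖g - d k‖ ≤ (K + 1) * (ε / (4 * (K + 1))) := by
          gcongr
          linarith [hf (φ i)]
      _ = ε / 4 := by field_simp
  have e : ∀ i, inner ℝ (f (φ i)) g = inner ℝ (f (φ i)) (d k) + inner ℝ (f (φ i)) (g - d k) :=
    fun i => by rw [← inner_add_right]; simp
  rw [e n, e n0]
  have h3 := abs_le.1 (h2 n)
  have h4 := abs_le.1 (h2 n0)
  have h5 := abs_lt.1 h1
  rw [abs_lt]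
  constructor <;> linarith

/-- Functions that are Cauchy in the `p`-th mean converge almost everywhere along a subsequence,
with convergence of the `p`-th moments. -/
lemma exists_subseq_ae_of_cauchy {α : Type*} [MeasurableSpace α] {μ : Measure α} {p : ℝ}
    (hp : 1 ≤ p) {f : ℕ → α → ℝ} (hf : ∀ n, Measurable (f n))
    (hfi : ∀ n, Integrable (fun x => |f n x| ^ p) μ)
    (hc : Tendsto (fun i : ℕ × ℕ => ∫ x, |f i.1 x - f i.2 x| ^ p ∂μ) atTop (𝓝 0)) :
    ∃ ψ : ℕ → ℕ, StrictMono ψ ∧ ∃ g : α → ℝ,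
      (∀ᵐ x ∂μ, Tendsto (fun n => f (ψ n) x) atTop (𝓝 (g x))) ∧
      Tendsto (fun n => ∫ x, |f n x| ^ p ∂μ) atTop (𝓝 (∫ x, |g x| ^ p ∂μ)) := by
  have hp0 : 0 < p := by linarith
  have hP : Fact (1 ≤ ENNReal.ofReal p) := ⟨by simpa using ENNReal.ofReal_le_ofReal hp⟩
  have hPr : (ENNReal.ofReal p).toReal = p := ENNReal.toReal_ofReal hp0.le
  have hP0 : ENNReal.ofReal p ≠ 0 := by simpa using hp0
  have hm : ∀ n, MemLp (f n) (ENNReal.ofReal p) μ := fun n => by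
    refine (integrable_norm_rpow_iff (hf n).aestronglyMeasurable hP0 ENNReal.ofReal_ne_top).1 ?_
    rw [hPr]; exact hfi n
  have hnorm : ∀ (h : α → ℝ) (hh : MemLp h (ENNReal.ofReal p) μ),
      ‖hh.toLp h‖ = (∫ x, |h x| ^ p ∂μ) ^ p⁻¹ := fun h hh => by
    rw [Lp.norm_toLp, hh.eLpNorm_eq_integral_rpow_norm hP0 ENNReal.ofReal_ne_top,
      ENNReal.toReal_ofReal (by positivity), hPr]
    rfl
  set F : ℕ → Lp ℝ (ENNReal.ofReal p) μ := fun n => (hm n).toLp (f n) with hF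
  have hcs : CauchySeq F := by
    rw [cauchySeq_iff_tendsto_dist_atTop_0]
    have e : (fun n : ℕ × ℕ => dist (F n.1) (F n.2)) =
        fun i => (∫ x, |f i.1 x - f i.2 x| ^ p ∂μ) ^ p⁻¹ := by
      ext i
      rw [dist_eq_norm, hF, ← MemLp.toLp_sub, hnorm _ ((hm i.1).sub (hm i.2))]
      rfl
    rw [e]
    have := hc.rpow_const (p := p⁻¹) (Or.inr (by positivity))
    rwa [Real.zero_rpow (by positivity)] at this
  obtain ⟨G, hG⟩ := cauchySeq_tendsto_of_complete hcs
  obtain ⟨ψ, hψ, hae⟩ := (tendstoInMeasure_of_tendsto_Lp hG).exists_seq_tendsto_ae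
  refine ⟨ψ, hψ, G, ?_, ?_⟩
  · have h1 : ∀ᵐ x ∂μ, ∀ n, F n x = f n x := ae_all_iff.2 fun n => (hm n).coeFn_toLp
    filter_upwards [hae, h1] with x hx hx1
    simpa only [hx1] using hx
  · have h2 := (hG.norm).rpow_const (p := p) (Or.inr hp0.le)
    have e1 : ∀ n, ‖F n‖ ^ p = ∫ x, |f n x| ^ p ∂μ := fun n => by
      rw [hF, hnorm, ← Real.rpow_mul (by positivity), inv_mul_cancel₀ hp0.ne', Real.rpow_one]
    have e2 : ‖G‖ ^ p = ∫ x, |G x| ^ p ∂μ := by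
      conv_lhs => rw [← Lp.toLp_coeFn G (Lp.memLp G)]
      rw [hnorm, ← Real.rpow_mul (by positivity), inv_mul_cancel₀ hp0.ne', Real.rpow_one]
    rw [← e2]
    simpa only [e1] using h2

/-- Fatou's lemma for bounded sequences of square integrable functions. -/
lemma memLp_two_of_tendsto_ae {α : Type*} [MeasurableSpace α] {μ : Measure α}
    {f : ℕ → α → ℝ} {g : α → ℝ} (hf : ∀ n, Measurable (f n)) (hg : Measurable g)
    (h2 : ∀ n, MemLp (f n) 2 μ) {K : ℝ} (hK : ∀ n, ∫ x, f n x ^ 2 ∂μ ≤ K)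
    (hae : ∀ᵐ x ∂μ, Tendsto (fun n => f n x) atTop (𝓝 (g x))) :
    MemLp g 2 μ ∧ ∫ x, g x ^ 2 ∂μ ≤ K := by
  have hK0 : 0 ≤ K := (integral_nonneg fun x => sq_nonneg _).trans (hK 0)
  have key : ∫⁻ x, ENNReal.ofReal (g x ^ 2) ∂μ ≤ ENNReal.ofReal K := by
    calc ∫⁻ x, ENNReal.ofReal (g x ^ 2) ∂μ
        = ∫⁻ x, liminf (fun n => ENNReal.ofReal (f n x ^ 2)) atTop ∂μ := by
          refine lintegral_congr_ae ?_
          filter_upwards [hae] with x hx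
          exact ((ENNReal.tendsto_ofReal (hx.pow 2)).liminf_eq).symm
      _ ≤ liminf (fun n => ∫⁻ x, ENNReal.ofReal (f n x ^ 2) ∂μ) atTop :=
          lintegral_liminf_le fun n => ((hf n).pow_const 2).ennreal_ofReal
      _ ≤ ENNReal.ofReal K := by
          refine liminf_le_of_frequently_le' (Frequently.of_forall fun n => ?_)
          rw [← ofReal_integral_eq_lintegral_ofReal (h2 n).integrable_sq
            (Eventually.of_forall fun x => sq_nonneg _)]
          exact ENNReal.ofReal_le_ofReal (hK n)
  have hmem := (lintegral_ne_top_iff_memLp_two (μ := μ) hg).1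
    (key.trans_lt ENNReal.ofReal_lt_top).ne
  refine ⟨hmem, ?_⟩
  rw [← ofReal_integral_eq_lintegral_ofReal hmem.integrable_sq
    (Eventually.of_forall fun x => sq_nonneg _)] at key
  exact (ENNReal.ofReal_le_ofReal_iff hK0).1 key

lemma pint_two_eq (u : Sp N → ℝ) : pint N 2 u = ∫ x, u x ^ 2 := by
  simp [pint]

lemma gag_sub_le (hu : Hs N s u) (hv : Hs N s v) :
    gag N s (fun x => u x - v x) ≤ 2 * gag N s u + 2 * gag N s v := by
  have h1 := gag_line hu hv 1
  have h2 := gag_line hu hv (-1)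
  have h3 : 0 ≤ gag N s (fun x => u x + 1 * v x) := gag_nonneg
  have e : (fun x => u x + -1 * v x) = fun x => u x - v x := by ext x; ring
  rw [e] at h2
  linarith

lemma pint_two_sub_le (hu : Hs N s u) (hv : Hs N s v) :
    pint N 2 (fun x => u x - v x) ≤ 2 * pint N 2 u + 2 * pint N 2 v := by
  have h1 := pint_two_line hu hv 1
  have h2 := pint_two_line hu hv (-1)
  have h3 : 0 ≤ pint N 2 (fun x => u x + 1 * v x) := pint_nonneg
  have e : (fun x => u x + -1 * v x) = fun x => u x - v x := by ext x; ring
  rw [e] at h2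
  linarith

lemma bavg_sub (hu : MemLp u 2) (hv : MemLp v 2) {r : ℝ} (x : Sp N) :
    bavg N r (fun y => u y - v y) x = bavg N r u x - bavg N r v x := by
  have : IsFiniteMeasure (volume.restrict (Metric.ball x r)) :=
    ⟨by rw [Measure.restrict_apply_univ]; exact measure_ball_lt_top⟩
  unfold bavg
  rw [integral_sub ((hu.restrict _).integrable one_le_two) ((hv.restrict _).integrable one_le_two),
    sub_div]

/-- Bounded sequences in `L²` have subsequences with convergent ball averages. -/
lemma exists_subseq_bavg {u : ℕ → Sp N → ℝ} (hu : ∀ n, MemLp (u n) 2) {K : ℝ}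
    (h2 : ∀ n, pint N 2 (u n) ≤ K) :
    ∃ φ : ℕ → ℕ, StrictMono φ ∧ ∀ r x, CauchySeq (fun n => bavg N r (u (φ n)) x) := by
  have hK : 0 ≤ K := pint_nonneg.trans (h2 0)
  have : Fact ((2 : ℝ≥0∞) ≠ ⊤) := ⟨by simp⟩
  obtain ⟨φ, hφ, hc⟩ := exists_subseq_cauchySeq_inner (H := Lp ℝ 2 (volume : Measure (Sp N)))
    (fun n => (hu n).toLp (u n)) (K := Real.sqrt K) (fun n => by
      refine Real.le_sqrt_of_sq_le ?_
      rw [← real_inner_self_eq_norm_sq, L2.inner_def]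
      refine le_trans (le_of_eq ?_) (h2 n)
      rw [pint_two_eq]
      refine integral_congr_ae ?_
      filter_upwards [(hu n).coeFn_toLp] with x hx
      simp [hx, sq])
  refine ⟨φ, hφ, fun r x => ?_⟩
  have hb : volume (Metric.ball x r) ≠ ⊤ := measure_ball_lt_top.ne
  have h := hc (indicatorConstLp 2 measurableSet_ball hb (1 : ℝ))
  have e : (fun n => bavg N r (u (φ n)) x) = fun n => inner ℝ ((hu (φ n)).toLp (u (φ n)))
      (indicatorConstLp 2 (measurableSet_ball (x := x) (ε := r)) hb (1 : ℝ)) /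
        (r ^ N * ballVol N) := by
    ext n
    rw [real_inner_comm, L2.inner_indicatorConstLp_one, bavg]
    congr 1
    exact integral_congr_ae (ae_restrict_of_ae (hu (φ n)).coeFn_toLp.symm)
  rw [e]
  obtain ⟨a, ha⟩ := cauchySeq_tendsto_of_complete h
  exact (ha.div_const _).cauchySeq

/-- Extraction of limits from bounded radial sequences. -/
lemma exists_subseq_limit (hN : 2 ≤ N) (hs : s ∈ Set.Ioo (0 : ℝ) 1) {p : ℝ} (hp : 2 < p)
    (hpq : p < critExp N s) {u : ℕ → Sp N → ℝ} (hu : ∀ n, Hs N s (u n)) (hr : ∀ n, Rad (u n))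
    {K : ℝ} (h2 : ∀ n, pint N 2 (u n) ≤ K) (hg : ∀ n, gag N s (u n) ≤ K) :
    ∃ φ : ℕ → ℕ, StrictMono φ ∧ ∃ v, Hs N s v ∧ Rad v ∧
      (∀ᵐ x, Tendsto (fun n => u (φ n) x) atTop (𝓝 (v x))) ∧
      Tendsto (fun n => pint N p (u (φ n))) atTop (𝓝 (pint N p v)) ∧
      (∀ K', (∀ n, pint N 2 (u n) ≤ K') → pint N 2 v ≤ K') := by
  obtain ⟨φ, hφ, hc⟩ := exists_subseq_bavg (fun n => (hu n).l2) h2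
  have hcau := tendsto_pint_of_bavg hN hs hp hpq (l := (atTop : Filter (ℕ × ℕ)))
    (w := fun i x => u (φ i.1) x - u (φ i.2) x) (fun i => (hu _).sub (hu _))
    (fun i => (hr _).sub (hr _)) (K := 4 * K)
    (fun i => by linarith [pint_two_sub_le (hu (φ i.1)) (hu (φ i.2)), h2 (φ i.1), h2 (φ i.2)])
    (fun i => by linarith [gag_sub_le (hu (φ i.1)) (hu (φ i.2)), hg (φ i.1), hg (φ i.2)])
    (fun r _ x => by
      simp_rw [fun i : ℕ × ℕ => bavg_sub (hu (φ i.1)).l2 (hu (φ i.2)).l2 (r := r) x]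
      obtain ⟨a, ha⟩ := cauchySeq_tendsto_of_complete (hc r x)
      rw [← prod_atTop_atTop_eq]
      have := (ha.comp (tendsto_fst (f := atTop) (g := (atTop : Filter ℕ)))).sub
        (ha.comp (tendsto_snd (f := (atTop : Filter ℕ)) (g := atTop)))
      simpa using this)
  obtain ⟨ψ, hψ, g, hae, hlim⟩ := exists_subseq_ae_of_cauchy (by linarith : 1 ≤ p)
    (f := fun n => u (φ n)) (fun n => (hu _).meas)
      (fun n => (hu _).int_rpow hN hs hp.le hpq.le) hcau
  set v : Sp N → ℝ := fun x => limsup (fun n => u (φ (ψ n)) x) atTop with hv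
  have hvm : Measurable v := Measurable.limsup fun n => (hu _).meas
  have hvg : ∀ᵐ x, v x = g x := by
    filter_upwards [hae] with x hx using hx.limsup_eq
  have haev : ∀ᵐ x, Tendsto (fun n => u (φ (ψ n)) x) atTop (𝓝 (v x)) := by
    filter_upwards [hae, hvg] with x hx h1
    rw [h1]; exact hx
  have hfat : ∀ K', (∀ n, pint N 2 (u n) ≤ K') → MemLp v 2 ∧ ∫ x, v x ^ 2 ≤ K' := fun K' hK' =>
    memLp_two_of_tendsto_ae (fun n => (hu (φ (ψ n))).meas) hvm (fun n => (hu _).l2)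
      (fun n => by rw [← pint_two_eq]; exact hK' _) haev
  have hfst : ∀ᵐ z : Sp N × Sp N, Tendsto (fun n => u (φ (ψ n)) z.1) atTop (𝓝 (v z.1)) :=
    Measure.quasiMeasurePreserving_fst.ae haev
  have hsnd : ∀ᵐ z : Sp N × Sp N, Tendsto (fun n => u (φ (ψ n)) z.2) atTop (𝓝 (v z.2)) :=
    Measure.quasiMeasurePreserving_snd.ae haev
  have hgag := memLp_two_of_tendsto_ae (f := fun n => dq N s (u (φ (ψ n)))) (g := dq N s v)
    (fun n => measurable_dq (hu _).meas) (measurable_dq hvm) (fun n => (hu _).gag)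
    (fun n => hg (φ (ψ n))) (by
      filter_upwards [hfst, hsnd] with z h1 h2
      exact (h1.sub h2).div_const _)
  refine ⟨φ ∘ ψ, hφ.comp hψ, v, ⟨hvm, (hfat K h2).1, hgag.1⟩, ?_, haev, ?_, ?_⟩
  · intro x y hxy
    simp only [hv]
    congr 1
    ext n
    exact hr _ x y hxy
  · have e : pint N p v = ∫ x, |g x| ^ p := integral_congr_ae (by
      filter_upwards [hvg] with x hx; rw [hx])
    rw [e]
    exact hlim.comp hψ.tendsto_atTop
  · intro K' hK'
    rw [pint_two_eq]; exact (hfat K' hK').2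

lemma finrank_sp_prod : Module.finrank ℝ (Sp N × Sp N) = 2 * N := by
  simp; ring

lemma isAddHaarMeasure_sp_prod :
    (volume : Measure (Sp N × Sp N)).IsAddHaarMeasure := by
  rw [Measure.volume_eq_prod]; infer_instance

lemma dq_scale {l : ℝ} (hl : 0 < l) (a : ℝ) :
    dq N s (fun x => a * u (l • x)) =
      fun z => (a * l ^ (((N : ℝ) + 2 * s) / 2)) * dq N s u (l • z) := by
  ext z
  have hl' := Real.rpow_pos_of_pos hl (((N : ℝ) + 2 * s) / 2)
  unfold dq
  simp only [Prod.smul_fst, Prod.smul_snd]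
  rw [← smul_sub, norm_smul, Real.norm_of_nonneg hl.le, Real.mul_rpow hl.le (norm_nonneg _)]
  rcases eq_or_ne (‖z.1 - z.2‖ ^ (((N : ℝ) + 2 * s) / 2)) 0 with h | h
  · simp [h]
  · field_simp

lemma MemLp.comp_smul_two {E : Type*} [NormedAddCommGroup E] [NormedSpace ℝ E]
    [FiniteDimensional ℝ E] [MeasurableSpace E] [BorelSpace E] {μ : Measure E}
    [μ.IsAddHaarMeasure] {f : E → ℝ} (hfm : Measurable f) (hf : MemLp f 2 μ) {l : ℝ} (hl : 0 < l) :
    MemLp (fun x => f (l • x)) 2 μ := by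
  refine (memLp_two_iff_integrable_sq
    (hfm.comp (measurable_const_smul l)).aestronglyMeasurable).2 ?_
  exact hf.integrable_sq.comp_smul hl.ne'

lemma Hs.scale (hu : Hs N s u) {l : ℝ} (hl : 0 < l) (a : ℝ) : Hs N s (fun x => a * u (l • x)) := by
  refine ⟨(hu.meas.comp (measurable_const_smul l)).const_mul a,
    (MemLp.comp_smul_two hu.meas hu.l2 hl).const_mul a, ?_⟩
  rw [dq_scale hl]
  have := isAddHaarMeasure_sp_prod (N := N)
  exact (MemLp.comp_smul_two (μ := (volume : Measure (Sp N × Sp N))) (measurable_dq hu.meas)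
    hu.gag hl).const_mul _

lemma Rad.scale (hu : Rad u) (l a : ℝ) : Rad (fun x => a * u (l • x)) := fun x y h => by
  simp only
  rw [hu (l • x) (l • y) (by simp [norm_smul, h])]

lemma pint_scale {l : ℝ} (hl : 0 < l) {a : ℝ} (ha : 0 ≤ a) (q : ℝ) :
    pint N q (fun x => a * u (l • x)) = a ^ q * l ^ (-(N : ℝ)) * pint N q u := by
  unfold pint
  have e : ∀ x : Sp N, |a * u (l • x)| ^ q = a ^ q * |u (l • x)| ^ q := fun x => by
    rw [abs_mul, abs_of_nonneg ha, Real.mul_rpow ha (abs_nonneg _)]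
  simp_rw [e]
  rw [integral_const_mul,
    Measure.integral_comp_smul (volume : Measure (Sp N)) (fun x => |u x| ^ q) l,
    finrank_euclideanSpace_fin, abs_of_nonneg (by positivity), Real.rpow_neg hl.le,
    Real.rpow_natCast, smul_eq_mul, mul_assoc]

lemma gag_scale {l : ℝ} (hl : 0 < l) (a : ℝ) :
    gag N s (fun x => a * u (l • x)) = a ^ 2 * l ^ (2 * s - N) * gag N s u := by
  have := isAddHaarMeasure_sp_prod (N := N)
  unfold gag
  rw [dq_scale hl]
  simp_rw [mul_pow]
  rw [integral_const_mul,
    Measure.integral_comp_smul (volume : Measure (Sp N × Sp N)) (fun x => dq N s u x ^ 2) l,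
    finrank_sp_prod, abs_of_nonneg (by positivity), smul_eq_mul, ← mul_assoc,
    rpow_half_sq hl.le, mul_assoc (a ^ 2)]
  congr 2
  rw [← Real.rpow_natCast, ← Real.rpow_neg hl.le, ← Real.rpow_add hl]
  congr 1
  push_cast; ring

/-- Every function can be rescaled to have prescribed mass and Gagliardo seminorm. -/
lemma exists_rescale (hN : 2 ≤ N) (hs : s ∈ Set.Ioo (0 : ℝ) 1) (p : ℝ) (hv : Hs N s v)
    (hr : Rad v) (hA : 0 < gag N s v) (hM : 0 < pint N 2 v) {a m : ℝ} (ha : 0 < a) (hm : 0 < m) :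
    ∃ w, Hs N s w ∧ Rad w ∧ gag N s w = a ∧ pint N 2 w = m ∧
      pint N (critExp N s) w =
        pint N (critExp N s) v * (a / gag N s v) ^ (critExp N s / 2) ∧
      pint N p w = pint N p v * (a / gag N s v) ^ (N * (p - 2) / (2 * s) / 2) *
        (m / pint N 2 v) ^ ((p - N * (p - 2) / (2 * s)) / 2) := by
  obtain ⟨hs0, hs1⟩ := hs
  have hN' : (2 : ℝ) ≤ N := by exact_mod_cast hN
  set A := gag N s v with hAd
  set M := pint N 2 v with hMd
  set α := a / A with hα
  set β := m / M with hβ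
  have hα0 : 0 < α := by positivity
  have hβ0 : 0 < β := by positivity
  set l := (α / β) ^ (1 / (2 * s)) with hl
  have hl0 : 0 < l := by positivity
  set c := (β * l ^ (N : ℝ)) ^ ((1 : ℝ) / 2) with hc
  have hc0 : 0 < c := by positivity
  have hlog : Real.log l = (1 / (2 * s)) * (Real.log α - Real.log β) := by
    rw [hl, Real.log_rpow (by positivity), Real.log_div hα0.ne' hβ0.ne']
  have hlogc : Real.log c = (1 / 2) * (Real.log β + N * Real.log l) := by
    rw [hc, Real.log_rpow (by positivity), Real.log_mul hβ0.ne' (by positivity),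
      Real.log_rpow hl0]
  have key : ∀ e : ℝ, c ^ e * l ^ (-(N : ℝ)) =
      α ^ (N * (e - 2) / (2 * s) / 2) * β ^ ((e - N * (e - 2) / (2 * s)) / 2) := fun e => by
    apply Real.log_injOn_pos (Set.mem_Ioi.2 (by positivity)) (Set.mem_Ioi.2 (by positivity))
    rw [Real.log_mul (by positivity) (by positivity), Real.log_mul (by positivity) (by positivity),
      Real.log_rpow hc0, Real.log_rpow hl0, Real.log_rpow hα0, Real.log_rpow hβ0, hlogc, hlog]
    field_simp
    ring
  have hgagk : c ^ 2 * l ^ (2 * s - N) = α := by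
    apply Real.log_injOn_pos (Set.mem_Ioi.2 (by positivity)) (Set.mem_Ioi.2 (by positivity))
    rw [Real.log_mul (by positivity) (by positivity), Real.log_pow, Real.log_rpow hl0, hlogc, hlog]
    push_cast
    field_simp
    ring
  refine ⟨fun x => c * v (l • x), hv.scale hl0 c, hr.scale l c, ?_, ?_, ?_, ?_⟩
  · rw [gag_scale hl0, hgagk, hα, ← hAd]; field_simp
  · rw [pint_scale hl0 hc0.le, key 2, ← hMd, hβ]
    simp
    field_simp
  · rw [pint_scale hl0 hc0.le, key]
    have h0 : (N : ℝ) - 2 * s > 0 := by linarith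
    have e1 : N * (critExp N s - 2) / (2 * s) = critExp N s := by
      unfold critExp; field_simp; ring
    rw [e1]; simp; ring
  · rw [pint_scale hl0 hc0.le, key]; ring

lemma pint_pos_of_not_ae_zero {q : ℝ} (hq : 0 < q)
    (hi : Integrable (fun x => |v x| ^ q)) (h : ¬ v =ᵐ[volume] 0) : 0 < pint N q v := by
  refine lt_of_le_of_ne pint_nonneg fun h0 => h ?_
  have := (integral_eq_zero_iff_of_nonneg (fun x => by positivity) hi).1 h0.symm
  filter_upwards [this] with x hx
  have h1 : |v x| ^ q = 0 := hx
  rw [Real.rpow_eq_zero (abs_nonneg _) hq.ne'] at h1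
  simpa using h1

lemma gag_pos_of_not_ae_zero (hN : 2 ≤ N) (hs : s ∈ Set.Ioo (0 : ℝ) 1) (hv : Hs N s v)
    (h : ¬ v =ᵐ[volume] 0) : 0 < gag N s v := by
  have hq := critExp_pos hN hs
  refine lt_of_le_of_ne gag_nonneg fun h0 => ?_
  have h1 := sobolev hN hs hv
  have h2 := pint_pos_of_not_ae_zero (by linarith) (hv.int_crit hN hs) h
  rw [← h0, Real.zero_rpow (by linarith)] at h1
  linarith

/-- The energy along a fibre. -/
def fib (r q A B C t : ℝ) : ℝ := A / 2 * t ^ 2 - B / r * t ^ r - C * t ^ q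

lemma fib_zero {r q A B C : ℝ} (hr : 2 < r) (hq : 2 < q) : fib r q A B C 0 = 0 := by
  unfold fib
  rw [Real.zero_rpow (by linarith), Real.zero_rpow (by linarith)]; ring

lemma continuous_fib {r q A B C : ℝ} (hr : 2 < r) (hq : 2 < q) : Continuous (fib r q A B C) := by
  unfold fib
  have h1 : Continuous fun t : ℝ => t ^ r := Real.continuous_rpow_const (by linarith)
  have h2 : Continuous fun t : ℝ => t ^ q := Real.continuous_rpow_const (by linarith)
  fun_prop

lemma rpow_eq_sq_mul {t r : ℝ} (ht : 0 < t) : t ^ r = t ^ 2 * t ^ (r - 2) := by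
  rw [← Real.rpow_natCast t 2, ← Real.rpow_add ht]; congr 1; push_cast; ring

lemma fib_eq_sq_mul {r q A B C t : ℝ} (ht : 0 < t) :
    fib r q A B C t = t ^ 2 * (A / 2 - B / r * t ^ (r - 2) - C * t ^ (q - 2)) := by
  unfold fib
  rw [rpow_eq_sq_mul (r := r) ht, rpow_eq_sq_mul (r := q) ht]; ring

lemma fib_mul {r q A B C a t : ℝ} (ha : 0 ≤ a) (ht : 0 ≤ t) :
    fib r q (A * a ^ 2) (B * a ^ r) (C * a ^ q) t = fib r q A B C (a * t) := by
  unfold fib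
  rw [Real.mul_rpow ha ht, Real.mul_rpow ha ht]; ring

lemma fib_neg_of_le {r q A B C t t1 : ℝ} (hr : 2 < r) (hq : 2 < q) (hB : 0 ≤ B) (hC : 0 ≤ C)
    (h1 : 0 < t1) (ht : t1 ≤ t) (h : fib r q A B C t1 < 0) : fib r q A B C t < 0 := by
  have ht0 : 0 < t := by linarith
  rw [fib_eq_sq_mul h1] at h
  rw [fib_eq_sq_mul ht0]
  have h2 : A / 2 - B / r * t1 ^ (r - 2) - C * t1 ^ (q - 2) < 0 := by
    by_contra! h3
    exact absurd h (not_lt.2 (by positivity))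
  refine mul_neg_of_pos_of_neg (by positivity) (lt_of_le_of_lt ?_ h2)
  have h3 : t1 ^ (r - 2) ≤ t ^ (r - 2) := Real.rpow_le_rpow h1.le ht (by linarith)
  have h4 : t1 ^ (q - 2) ≤ t ^ (q - 2) := Real.rpow_le_rpow h1.le ht (by linarith)
  have h5 : B / r * t1 ^ (r - 2) ≤ B / r * t ^ (r - 2) := by gcongr
  have h6 : C * t1 ^ (q - 2) ≤ C * t ^ (q - 2) := by gcongr
  linarith

/-- The fibre energy is positive somewhere. -/
lemma exists_fib_pos {r q A B C : ℝ} (hr : 2 < r) (hq : 2 < q) (hA : 0 < A) :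
    ∃ t > 0, 0 < fib r q A B C t := by
  have hc : Tendsto (fun t : ℝ => A / 2 - B / r * t ^ (r - 2) - C * t ^ (q - 2)) (𝓝[>] 0)
      (𝓝 (A / 2 - B / r * 0 ^ (r - 2) - C * 0 ^ (q - 2))) := by
    refine Tendsto.mono_left ?_ nhdsWithin_le_nhds
    have h1 : Continuous fun t : ℝ => t ^ (r - 2) := Real.continuous_rpow_const (by linarith)
    have h2 : Continuous fun t : ℝ => t ^ (q - 2) := Real.continuous_rpow_const (by linarith)
    exact Continuous.tendsto (by fun_prop) 0
  rw [Real.zero_rpow (by linarith), Real.zero_rpow (by linarith)] at hc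
  have hpos : ∀ᶠ t in 𝓝[>] (0 : ℝ), 0 < A / 2 - B / r * t ^ (r - 2) - C * t ^ (q - 2) :=
    hc.eventually_const_lt (by simpa using hA)
  obtain ⟨t, h1, h2⟩ := (hpos.and self_mem_nhdsWithin).exists
  refine ⟨t, h2, ?_⟩
  rw [fib_eq_sq_mul h2]
  exact mul_pos (pow_pos h2 2) h1

/-- The fibre energy attains its supremum. -/
lemma exists_fib_max {r q A B C : ℝ} (hr : 2 < r) (hq : 2 < q) (hA : 0 ≤ A) (hB : 0 < B)
    (hC : 0 ≤ C) : ∃ τ, 0 ≤ τ ∧ ∀ t, 0 ≤ t → fib r q A B C t ≤ fib r q A B C τ := by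
  set T := (A * r / (2 * B)) ^ (1 / (r - 2)) with hT
  have hT0 : 0 ≤ T := by positivity
  obtain ⟨τ, hτ, hmax⟩ := isCompact_Icc.exists_isMaxOn (Set.nonempty_Icc.2 hT0)
    (continuous_fib (A := A) (B := B) (C := C) hr hq).continuousOn
  refine ⟨τ, hτ.1, fun t ht => ?_⟩
  rcases le_total t T with h | h
  · exact hmax ⟨ht, h⟩
  · have h0 : fib r q A B C 0 ≤ fib r q A B C τ := hmax ⟨le_rfl, hT0⟩
    rw [fib_zero hr hq] at h0
    rcases ht.eq_or_lt with rfl | ht0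
    · rw [fib_zero hr hq]; exact h0
    refine le_trans ?_ h0
    rw [fib_eq_sq_mul ht0]
    have h1 : T ^ (r - 2) ≤ t ^ (r - 2) := Real.rpow_le_rpow hT0 h (by linarith)
    rw [hT, ← Real.rpow_mul (by positivity), one_div_mul_cancel (by linarith), Real.rpow_one] at h1
    have h2 : A / 2 ≤ B / r * t ^ (r - 2) := by
      calc A / 2 = B / r * (A * r / (2 * B)) := by field_simp
        _ ≤ _ := by gcongr
    have h3 : 0 ≤ C * t ^ (q - 2) := by positivity
    exact mul_nonpos_of_nonneg_of_nonpos (by positivity) (by linarith)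

/-- Transfer of an upper bound for the energy to the weak limit. -/
lemma fib_le_of_split {r q A B C S σ α τ : ℝ} (hr : 2 < r) (hq : 2 < q) (hB : 0 ≤ B) (hC : 0 ≤ C)
    (hS : 0 < S) (hα : 0 ≤ α) (hτ : 0 < τ) (hτS : S * τ ^ (r - 2) = 1) (hσ0 : 0 ≤ σ)
    (hσ : σ < τ ^ 2 * (1 / 2 - 1 / r))
    (h : ∀ t, 0 ≤ t → fib r q A B C t + (α / 2 * t ^ 2 - S * α ^ (r / 2) / r * t ^ r) ≤ σ)
    {t : ℝ} (ht : 0 ≤ t) : fib r q A B C t ≤ σ := by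
  rcases hα.eq_or_lt with rfl | hα0
  · have := h t ht
    rw [Real.zero_rpow (by linarith)] at this
    simpa using this
  set b := α ^ ((1 : ℝ) / 2) with hb
  have hb0 : 0 < b := by positivity
  have hb2 : b ^ 2 = α := by rw [hb, rpow_half_sq hα, Real.rpow_one]
  have hbr : α ^ (r / 2) = b ^ r := by
    rw [hb, ← Real.rpow_mul hα]; congr 1; ring
  have e : ∀ t, 0 < t → α / 2 * t ^ 2 - S * α ^ (r / 2) / r * t ^ r =
      (b * t) ^ 2 * (1 / 2 - S / r * (b * t) ^ (r - 2)) := fun t ht => by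
    have h1 := rpow_eq_sq_mul (r := r) (mul_pos hb0 ht)
    rw [Real.mul_rpow hb0.le ht.le] at h1
    rw [hbr, ← hb2]
    have h2 : S * b ^ r / r * t ^ r = S / r * (b ^ r * t ^ r) := by ring
    rw [h2, h1]; ring
  have hr0 : 0 < r := by linarith
  have hτS' : S / r * τ ^ (r - 2) = 1 / r := by rw [div_mul_eq_mul_div, hτS]
  rcases ht.eq_or_lt with rfl | ht0
  · rwa [fib_zero hr hq]
  rcases le_total (b * t) τ with h1 | h1
  · have h2 := h t ht
    rw [e t ht0] at h2
    have h3 : (b * t) ^ (r - 2) ≤ τ ^ (r - 2) := Real.rpow_le_rpow (by positivity) h1 (by linarith)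
    have h4 : S / r * (b * t) ^ (r - 2) ≤ 1 / 2 := by
      calc S / r * (b * t) ^ (r - 2) ≤ S / r * τ ^ (r - 2) := by gcongr
        _ = 1 / r := hτS'
        _ ≤ 1 / 2 := by gcongr
    have h5 : 0 ≤ (b * t) ^ 2 * (1 / 2 - S / r * (b * t) ^ (r - 2)) :=
      mul_nonneg (sq_nonneg _) (by linarith)
    linarith
  · have ht1 : 0 < τ / b := by positivity
    have h2 := h (τ / b) ht1.le
    rw [e _ ht1, mul_div_cancel₀ _ hb0.ne', hτS'] at h2
    refine ((fib_neg_of_le hr hq hB hC ht1 ?_ (by linarith)).le).trans hσ0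
    rw [div_le_iff₀ hb0]; linarith

/-- Each nontrivial radial function bounds the level from above after rescaling. -/
lemma exists_level_le_fib (hN : 2 ≤ N) (hs : s ∈ Set.Ioo (0 : ℝ) 1) {p q k m σ : ℝ}
    (hqd : q = N * (p - 2) / (2 * s)) (hq : 2 < q) (hp : 2 < p) (hpr : p < critExp N s)
    (hk : 0 ≤ k) (hm : 0 < m)
    (hσ : ∀ w, Hs N s w → Rad w → gag N s w = 1 → pint N 2 w = m → ∀ x,
      (∀ t, 0 ≤ t → fib (critExp N s) q 1 (pint N (critExp N s) w) (k * pint N p w) t ≤ x) → σ ≤ x)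
    (hv : Hs N s v) (hr : Rad v) (h0 : ¬ v =ᵐ[volume] 0) :
    ∃ τ, 0 ≤ τ ∧ σ ≤ fib (critExp N s) q (gag N s v) (pint N (critExp N s) v)
      (k * pint N p v * (m / pint N 2 v) ^ ((p - q) / 2)) τ := by
  have hr2 := critExp_pos hN hs
  have hA := gag_pos_of_not_ae_zero hN hs hv h0
  have hM : 0 < pint N 2 v := pint_pos_of_not_ae_zero (by norm_num) hv.int_two h0
  have hB := pint_pos_of_not_ae_zero (by linarith) (hv.int_crit hN hs) h0
  have hC : 0 ≤ pint N p v := pint_nonneg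
  obtain ⟨τ, hτ, hmax⟩ := exists_fib_max (q := q) hr2 hq hA.le hB
    (C := k * pint N p v * (m / pint N 2 v) ^ ((p - q) / 2)) (by positivity)
  refine ⟨τ, hτ, ?_⟩
  obtain ⟨w, hw, hwr, h1, h2, h3, h4⟩ := exists_rescale hN hs p hv hr hA hM one_pos hm
  rw [← hqd] at h4
  refine hσ w hw hwr h1 h2 _ fun t ht => ?_
  set b := (1 / gag N s v) ^ ((1 : ℝ) / 2) with hb
  have hb0 : 0 < b := by positivity
  have hpow : ∀ e : ℝ, (1 / gag N s v) ^ (e / 2) = b ^ e := fun e => by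
    rw [hb, ← Real.rpow_mul (by positivity)]; congr 1; ring
  have hb2 : gag N s v * b ^ 2 = 1 := by
    rw [hb, rpow_half_sq (by positivity), Real.rpow_one]; field_simp
  have e := fib_mul (r := critExp N s) (q := q) (A := gag N s v) (B := pint N (critExp N s) v)
    (C := k * pint N p v * (m / pint N 2 v) ^ ((p - q) / 2)) hb0.le ht
  rw [h3, h4, hpow, hpow]
  have e2 : k * (pint N p v * b ^ q * (m / pint N 2 v) ^ ((p - q) / 2)) =
      k * pint N p v * (m / pint N 2 v) ^ ((p - q) / 2) * b ^ q := by ring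
  rw [e2, ← hb2, e]
  exact hmax _ (by positivity)

lemma pint_zero_of_ae_zero {q : ℝ} (hq : q ≠ 0) (h : v =ᵐ[volume] 0) : pint N q v = 0 := by
  unfold pint
  rw [integral_eq_zero_of_ae]
  filter_upwards [h] with x hx
  simp only [hx, Pi.zero_apply, abs_zero, Real.zero_rpow hq]

lemma gag_zero_of_ae_zero (h : v =ᵐ[volume] 0) : gag N s v = 0 := by
  have hfst : ∀ᵐ z : Sp N × Sp N, v z.1 = 0 := Measure.quasiMeasurePreserving_fst.ae h
  have hsnd : ∀ᵐ z : Sp N × Sp N, v z.2 = 0 := Measure.quasiMeasurePreserving_snd.ae h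
  unfold gag
  rw [integral_eq_zero_of_ae]
  filter_upwards [hfst, hsnd] with z h1 h2
  simp [dq, h1, h2]

/-- A minimizing sequence below the critical threshold has a nontrivial weak limit at or below
the level. -/
lemma exists_weak_limit (hN : 2 ≤ N) (hs : s ∈ Set.Ioo (0 : ℝ) 1) {p q k m σ τ : ℝ}
    (hq : 2 < q) (hp : 2 < p) (hpr : p < critExp N s) (hk : 0 ≤ k)
    (hτ : 0 < τ) (hτS : sobConst N s * τ ^ (critExp N s - 2) = 1) (hσ0 : 0 ≤ σ)
    (hσ : σ < τ ^ 2 * (1 / 2 - 1 / critExp N s)) {u : ℕ → Sp N → ℝ}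
    (hu : ∀ n, Hs N s (u n)) (hr : ∀ n, Rad (u n)) (hg : ∀ n, gag N s (u n) = 1)
    (h2 : ∀ n, pint N 2 (u n) = m)
    (hle : ∀ n t, 0 ≤ t → fib (critExp N s) q 1 (pint N (critExp N s) (u n))
      (k * pint N p (u n)) t ≤ σ + 1 / ((n : ℝ) + 1)) :
    ∃ v, Hs N s v ∧ Rad v ∧ ¬ v =ᵐ[volume] 0 ∧ pint N 2 v ≤ m ∧
      ∀ t, 0 ≤ t → fib (critExp N s) q (gag N s v) (pint N (critExp N s) v)
        (k * pint N p v) t ≤ σ := by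
  have hr2 := critExp_pos hN hs
  have hS := sobConst_pos (N := N) (s := s)
  obtain ⟨φ, hφ, v, hv, hvr, hae, hC, hM⟩ := exists_subseq_limit hN hs hp hpr hu hr
    (K := max 1 m) (fun n => (h2 n).le.trans (le_max_right _ _))
    (fun n => (hg n).le.trans (le_max_left _ _))
  have hfst : ∀ᵐ z : Sp N × Sp N, Tendsto (fun n => u (φ n) z.1) atTop (𝓝 (v z.1)) :=
    Measure.quasiMeasurePreserving_fst.ae hae
  have hsnd : ∀ᵐ z : Sp N × Sp N, Tendsto (fun n => u (φ n) z.2) atTop (𝓝 (v z.2)) :=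
    Measure.quasiMeasurePreserving_snd.ae hae
  have hsob : ∀ n, pint N (critExp N s) (u n) ≤ sobConst N s := fun n => by
    have := sobolev hN hs (hu n)
    rwa [hg n, Real.one_rpow, mul_one] at this
  have blB : Tendsto (fun n => pint N (critExp N s) (u (φ n)) -
      pint N (critExp N s) (fun x => u (φ n) x - v x)) atTop (𝓝 (pint N (critExp N s) v)) :=
    brezis_lieb (by linarith : 0 < critExp N s) (f := fun n => u (φ n)) (fun n => (hu _).meas)
      hv.meas (fun n => (hu _).int_crit hN hs) (hv.int_crit hN hs) (fun n => hsob (φ n)) hae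
  have blA : Tendsto (fun n => 1 - gag N s (fun x => u (φ n) x - v x)) atTop
      (𝓝 (gag N s v)) := by
    have := brezis_lieb (μ := (volume : Measure (Sp N × Sp N))) (q := 2) two_pos
      (f := fun n => dq N s (u (φ n))) (g := dq N s v)
      (fun n => measurable_dq (hu _).meas) (measurable_dq hv.meas)
      (fun n => by simpa using (hu (φ n)).gag.integrable_sq) (by simpa using hv.gag.integrable_sq)
      (K := 1) (fun n => by
        have := (hg (φ n)).le
        simpa [gag] using this) (by
        filter_upwards [hfst, hsnd] with z h1 h2
        exact (h1.sub h2).div_const _)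
    simp only [Real.rpow_ofNat, sq_abs] at this
    refine this.congr fun n => ?_
    rw [← hg (φ n)]
    unfold gag
    rw [dq_sub]
  have hα : Tendsto (fun n => gag N s (fun x => u (φ n) x - v x)) atTop (𝓝 (1 - gag N s v)) := by
    simpa using blA.const_sub 1
  have hα0 : 0 ≤ 1 - gag N s v := ge_of_tendsto' hα fun n => gag_nonneg
  have hle' : ∀ t, 0 ≤ t → fib (critExp N s) q (gag N s v) (pint N (critExp N s) v)
      (k * pint N p v) t + ((1 - gag N s v) / 2 * t ^ 2 -
        sobConst N s * (1 - gag N s v) ^ (critExp N s / 2) / critExp N s *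
          t ^ critExp N s) ≤ σ := by
    intro t ht
    have hlim1 : Tendsto (fun n => σ + 1 / ((φ n : ℝ) + 1)) atTop (𝓝 (σ + 0)) :=
      (tendsto_one_div_add_atTop_nhds_zero_nat.comp hφ.tendsto_atTop).const_add σ
    rw [add_zero] at hlim1
    have hα2 : Tendsto (fun n => sobConst N s *
        gag N s (fun x => u (φ n) x - v x) ^ (critExp N s / 2)) atTop
        (𝓝 (sobConst N s * (1 - gag N s v) ^ (critExp N s / 2))) :=
      (hα.rpow_const (Or.inr (by linarith))).const_mul _
    have hlim2 := ((((blB.add hα2).div_const (critExp N s)).mul_const (t ^ critExp N s)).const_sub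
      (1 / 2 * t ^ 2)).sub ((hC.const_mul k).mul_const (t ^ q))
    refine le_trans (le_of_eq ?_) (le_of_tendsto_of_tendsto' hlim2 hlim1 fun n => ?_)
    · unfold fib; ring
    · refine le_trans ?_ (hle (φ n) t ht)
      unfold fib
      have h5 := sobolev hN hs ((hu (φ n)).sub hv)
      have h6 : pint N (critExp N s) (u (φ n)) / critExp N s * t ^ critExp N s ≤
          (pint N (critExp N s) (u (φ n)) - pint N (critExp N s) (fun x => u (φ n) x - v x) +
            sobConst N s * gag N s (fun x => u (φ n) x - v x) ^ (critExp N s / 2)) /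
              critExp N s * t ^ critExp N s := by
        gcongr
        linarith
      linarith
  refine ⟨v, hv, hvr, fun h0 => ?_, hM m fun n => (h2 n).le, fun t ht => ?_⟩
  · have h5 := hle' τ hτ.le
    rw [gag_zero_of_ae_zero h0, pint_zero_of_ae_zero (by linarith) h0,
      pint_zero_of_ae_zero (by linarith) h0] at h5
    simp only [fib, sub_zero, Real.one_rpow, mul_one, mul_zero, zero_div, zero_mul, zero_add] at h5
    have h6 : sobConst N s / critExp N s * τ ^ critExp N s = τ ^ 2 * (1 / critExp N s) := by
      rw [rpow_eq_sq_mul hτ]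
      linear_combination (τ ^ 2 / critExp N s) * hτS
    rw [h6] at h5
    linarith
  · exact fib_le_of_split hr2 hq pint_nonneg (mul_nonneg hk pint_nonneg) hS hα0 hτ hτS hσ0
      hσ hle' ht

/-- Existence of a function realizing the minimax level. -/
lemma exists_minimax (hN : 2 ≤ N) (hs : s ∈ Set.Ioo (0 : ℝ) 1) {p q k m τ x0 : ℝ}
    (hqd : q = N * (p - 2) / (2 * s)) (hq : 2 < q) (hqp : q < p) (hpr : p < critExp N s)
    (hk : 0 < k) (hm : 0 < m)
    (hτ : 0 < τ) (hτS : sobConst N s * τ ^ (critExp N s - 2) = 1)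
    (hw : Hs N s w) (hwr : Rad w) (hw1 : gag N s w = 1) (hw2 : pint N 2 w = m)
    (hwx : ∀ t, 0 ≤ t → fib (critExp N s) q 1 (pint N (critExp N s) w) (k * pint N p w) t ≤ x0)
    (hx0 : x0 < τ ^ 2 * (1 / 2 - 1 / critExp N s)) :
    ∃ σ > 0, ∃ U, Hs N s U ∧ Rad U ∧ ¬ U =ᵐ[volume] 0 ∧ pint N 2 U = m ∧
      (∀ t, 0 ≤ t → fib (critExp N s) q (gag N s U) (pint N (critExp N s) U)
        (k * pint N p U) t ≤ σ) ∧
      fib (critExp N s) q (gag N s U) (pint N (critExp N s) U) (k * pint N p U) 1 = σ ∧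
      ∀ v, Hs N s v → Rad v → ¬ v =ᵐ[volume] 0 →
        ∃ τ, 0 ≤ τ ∧ σ ≤ fib (critExp N s) q (gag N s v) (pint N (critExp N s) v)
          (k * pint N p v * (m / pint N 2 v) ^ ((p - q) / 2)) τ := by
  have hr2 := critExp_pos hN hs
  set Z : Set ℝ := {x | ∃ w, Hs N s w ∧ Rad w ∧ gag N s w = 1 ∧ pint N 2 w = m ∧
    ∀ t, 0 ≤ t → fib (critExp N s) q 1 (pint N (critExp N s) w) (k * pint N p w) t ≤ x} with hZ
  have hZ0 : ∀ x ∈ Z, 0 ≤ x := by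
    rintro x ⟨w, -, -, -, -, h⟩
    have := h 0 le_rfl
    rwa [fib_zero hr2 hq] at this
  have hbdd : BddBelow Z := ⟨0, hZ0⟩
  have hx0Z : x0 ∈ Z := ⟨w, hw, hwr, hw1, hw2, hwx⟩
  set σ := sInf Z with hσ
  have hσ0 : 0 ≤ σ := le_csInf ⟨x0, hx0Z⟩ hZ0
  have hσx : σ ≤ x0 := csInf_le hbdd hx0Z
  have hseq : ∀ n : ℕ, ∃ w, Hs N s w ∧ Rad w ∧ gag N s w = 1 ∧ pint N 2 w = m ∧
      ∀ t, 0 ≤ t → fib (critExp N s) q 1 (pint N (critExp N s) w) (k * pint N p w) t ≤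
        σ + 1 / ((n : ℝ) + 1) := fun n => by
    obtain ⟨x, ⟨w, h1, h2, h3, h4, h5⟩, hx⟩ := exists_lt_of_csInf_lt (b := σ + 1 / ((n : ℝ) + 1))
      ⟨x0, hx0Z⟩ (by linarith [(by positivity : 0 < 1 / ((n : ℝ) + 1))])
    exact ⟨w, h1, h2, h3, h4, fun t ht => (h5 t ht).trans hx.le⟩
  choose u hu1 hu2 hu3 hu4 hu5 using hseq
  obtain ⟨v, hv, hvr, hv0, hvm, hvle⟩ := exists_weak_limit hN hs hq (by linarith)
    hpr hk.le hτ hτS hσ0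
    (by linarith) hu1 hu2 hu3 hu4 hu5
  have hlev : ∀ v, Hs N s v → Rad v → ¬ v =ᵐ[volume] 0 →
        ∃ τ, 0 ≤ τ ∧ σ ≤ fib (critExp N s) q (gag N s v) (pint N (critExp N s) v)
          (k * pint N p v * (m / pint N 2 v) ^ ((p - q) / 2)) τ := fun v hv hvr hv0 =>
    exists_level_le_fib hN hs hqd hq (by linarith) hpr hk.le hm
      (fun w h1 h2 h3 h4 x hx => csInf_le hbdd ⟨w, h1, h2, h3, h4, hx⟩) hv hvr hv0
  have hA := gag_pos_of_not_ae_zero hN hs hv hv0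
  have hM : 0 < pint N 2 v := pint_pos_of_not_ae_zero (by norm_num) hv.int_two hv0
  have hσpos : 0 < σ := by
    obtain ⟨t, ht, h⟩ := exists_fib_pos (r := critExp N s) (q := q) (A := gag N s v)
      (B := pint N (critExp N s) v) (C := k * pint N p v) hr2 hq hA
    exact h.trans_le (hvle t ht.le)
  obtain ⟨b, hb, hbσ⟩ := hlev v hv hvr hv0
  have hb0 : 0 < b := by
    refine lt_of_le_of_ne hb ?_
    rintro rfl
    rw [fib_zero hr2 hq] at hbσ
    linarith
  obtain ⟨U, hU, hUr, h1, h2, h3, h4⟩ := exists_rescale hN hs p hv hvr hA hM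
    (by positivity : 0 < gag N s v * b ^ 2) hm
  rw [← hqd] at h4
  have e1 : gag N s v * b ^ 2 / gag N s v = b ^ 2 := by field_simp
  have e2 : ∀ e : ℝ, (b ^ 2) ^ (e / 2) = b ^ e := fun e => by
    rw [← Real.rpow_natCast, ← Real.rpow_mul hb]; congr 1; push_cast; ring
  rw [e1, e2] at h3 h4
  have e3 : k * pint N p U = k * pint N p v * (m / pint N 2 v) ^ ((p - q) / 2) * b ^ q := by
    rw [h4]; ring
  have hfib : ∀ t, 0 ≤ t → fib (critExp N s) q (gag N s U) (pint N (critExp N s) U)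
      (k * pint N p U) t = fib (critExp N s) q (gag N s v) (pint N (critExp N s) v)
        (k * pint N p v * (m / pint N 2 v) ^ ((p - q) / 2)) (b * t) := fun t ht => by
    rw [h1, h3, e3, fib_mul hb ht]
  have hmono : ∀ t, 0 ≤ t → fib (critExp N s) q (gag N s v) (pint N (critExp N s) v)
        (k * pint N p v * (m / pint N 2 v) ^ ((p - q) / 2)) t ≤ σ := fun t ht => by
    refine le_trans ?_ (hvle t ht)
    have h5 : 1 ≤ (m / pint N 2 v) ^ ((p - q) / 2) :=
      Real.one_le_rpow ((one_le_div hM).2 hvm) (by linarith)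
    have h6 : 0 ≤ k * pint N p v * t ^ q :=
      mul_nonneg (mul_nonneg hk.le pint_nonneg) (Real.rpow_nonneg ht q)
    unfold fib
    nlinarith
  have hone : fib (critExp N s) q (gag N s U) (pint N (critExp N s) U) (k * pint N p U) 1 = σ := by
    rw [hfib 1 zero_le_one, mul_one]
    exact le_antisymm (hmono b hb) hbσ
  refine ⟨σ, hσpos, U, hU, hUr, fun h0 => ?_, h2, fun t ht => ?_, hone, hlev⟩
  · rw [pint_zero_of_ae_zero two_ne_zero h0] at h2
    linarith
  · rw [hfib t ht]; exact hmono _ (by positivity)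

lemma hasDerivAt_fib {r q A B C t : ℝ} (hr : 2 < r) (ht : 0 < t) :
    HasDerivAt (fib r q A B C) (t * (A - B * t ^ (r - 2) - q * C * t ^ (q - 2))) t := by
  have h1 := (hasDerivAt_pow 2 t).const_mul (A / 2)
  have h2 := (Real.hasDerivAt_rpow_const (x := t) (p := r) (Or.inl ht.ne')).const_mul (B / r)
  have h3 := (Real.hasDerivAt_rpow_const (x := t) (p := q) (Or.inl ht.ne')).const_mul C
  have h := (h1.sub h2).sub h3
  have e : ∀ e : ℝ, t ^ (e - 1) = t * t ^ (e - 2) := fun e => by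
    rw [mul_comm, ← Real.rpow_add_one ht.ne']; congr 1; ring
  refine HasDerivAt.congr_deriv (f := fib r q A B C) h ?_
  rw [e r, e q]
  push_cast
  field_simp

lemma hasDerivAt_quadratic (a b c : ℝ) :
    HasDerivAt (fun t : ℝ => a + 2 * t * b + t ^ 2 * c) (2 * b) 0 := by
  have h1 := (((hasDerivAt_id (0 : ℝ)).const_mul 2).mul_const b).const_add a
  refine HasDerivAt.congr_deriv (h1.add ((hasDerivAt_pow 2 (0 : ℝ)).mul_const c)) ?_
  simp

/-- Interior maximizers of the fibre energy are unique. -/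
lemma fib_max_unique {r q A B C τ : ℝ} (hr : 2 < r) (hq : 2 < q) (hB : 0 < B)
    (hC : 0 ≤ C) (h1 : ∀ t, 0 ≤ t → fib r q A B C t ≤ fib r q A B C 1) (hτ : 0 < τ)
    (h2 : fib r q A B C 1 ≤ fib r q A B C τ) : τ = 1 := by
  have crit : ∀ t, 0 < t → fib r q A B C 1 ≤ fib r q A B C t →
      A - B * t ^ (r - 2) - q * C * t ^ (q - 2) = 0 := fun t ht h => by
    have hmax : IsLocalMax (fib r q A B C) t := by
      filter_upwards [lt_mem_nhds ht] with y hy using (h1 y hy.le).trans h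
    have := hmax.hasDerivAt_eq_zero (hasDerivAt_fib hr ht)
    exact (mul_eq_zero.1 this).resolve_left ht.ne'
  have c1 := crit 1 one_pos le_rfl
  have cτ := crit τ hτ h2
  rw [Real.one_rpow, Real.one_rpow] at c1
  rcases lt_trichotomy τ 1 with h | h | h
  · have h3 : τ ^ (r - 2) < 1 := Real.rpow_lt_one hτ.le h (by linarith)
    have h4 : τ ^ (q - 2) ≤ 1 := Real.rpow_le_one hτ.le h.le (by linarith)
    have h5 : q * C * τ ^ (q - 2) ≤ q * C * 1 := by gcongr
    nlinarith
  · exact h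
  · have h3 : 1 < τ ^ (r - 2) := Real.one_lt_rpow h (by linarith)
    have h4 : 1 ≤ τ ^ (q - 2) := Real.one_le_rpow h.le (by linarith)
    have h5 : q * C * 1 ≤ q * C * τ ^ (q - 2) := by gcongr
    nlinarith

/-- One-sided derivative test for a minimax level. -/
lemma danskin {r q : ℝ} (hr : 2 < r) (hq : 2 < q) {A B D : ℝ → ℝ} {A' B' D' : ℝ}
    (hA : HasDerivAt A A' 0) (hB : HasDerivAt B B' 0) (hD : HasDerivAt D D' 0)
    (hA0 : 0 < A 0) (hB0 : 0 < B 0) (hD0 : 0 < D 0)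
    (hmax : ∀ t, 0 ≤ t → fib r q (A 0) (B 0) (D 0) t ≤ fib r q (A 0) (B 0) (D 0) 1)
    (hev : ∀ᶠ t in 𝓝[>] (0 : ℝ), ∃ τ, 0 ≤ τ ∧
      fib r q (A 0) (B 0) (D 0) 1 ≤ fib r q (A t) (B t) (D t) τ) :
    0 ≤ A' / 2 - B' / r - D' := by
  have hr0 : 0 < r := by linarith
  obtain ⟨t0, ht0, hpos⟩ := exists_fib_pos (r := r) (q := q) (A := A 0) (B := B 0) (C := D 0)
    hr hq hA0
  have hσ : 0 < fib r q (A 0) (B 0) (D 0) 1 := hpos.trans_le (hmax t0 ht0.le)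
  have eA : ∀ᶠ t in 𝓝[>] (0 : ℝ), A t < 2 * A 0 :=
    (hA.continuousAt.tendsto.mono_left nhdsWithin_le_nhds).eventually_lt_const (by linarith)
  have eB : ∀ᶠ t in 𝓝[>] (0 : ℝ), B 0 / 2 < B t :=
    (hB.continuousAt.tendsto.mono_left nhdsWithin_le_nhds).eventually_const_lt (by linarith)
  have eD : ∀ᶠ t in 𝓝[>] (0 : ℝ), 0 < D t :=
    (hD.continuousAt.tendsto.mono_left nhdsWithin_le_nhds).eventually_const_lt (by linarith)
  have hseq : Tendsto (fun n : ℕ => 1 / ((n : ℝ) + 1)) atTop (𝓝[>] 0) :=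
    tendsto_nhdsWithin_iff.2 ⟨tendsto_one_div_add_atTop_nhds_zero_nat,
      Eventually.of_forall fun n => by
        have : 0 < 1 / ((n : ℝ) + 1) := by positivity
        exact this⟩
  obtain ⟨n0, hn0⟩ := eventually_atTop.1
    (hseq.eventually (((hev.and eA).and eB).and (eD.and self_mem_nhdsWithin)))
  have hy : Tendsto (fun n : ℕ => 1 / (((n + n0 : ℕ) : ℝ) + 1)) atTop (𝓝[>] 0) :=
    hseq.comp (tendsto_add_atTop_nat n0)
  set y : ℕ → ℝ := fun n => 1 / (((n + n0 : ℕ) : ℝ) + 1) with hyd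
  have hP : ∀ n, ((((∃ τ, 0 ≤ τ ∧ fib r q (A 0) (B 0) (D 0) 1 ≤ fib r q (A (y n)) (B (y n))
      (D (y n)) τ) ∧ A (y n) < 2 * A 0) ∧ B 0 / 2 < B (y n)) ∧ 0 < D (y n) ∧ 0 < y n) := fun n =>
    hn0 (n + n0) (by omega)
  choose τ hτ0 hτ using fun n => (hP n).1.1.1
  set T := (2 * r * A 0 / B 0) ^ (1 / (r - 2)) with hT
  have hτT : ∀ n, τ n ≤ T := fun n => by
    obtain ⟨⟨⟨-, h1⟩, h2⟩, h3, -⟩ := hP n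
    rcases (hτ0 n).eq_or_lt with h0 | h0
    · rw [← h0]; positivity
    have h4 := hσ.trans_le (hτ n)
    rw [fib_eq_sq_mul h0] at h4
    have h5 := pos_of_mul_pos_right h4 (sq_nonneg _)
    have h6 : 0 ≤ D (y n) * τ n ^ (q - 2) := by positivity
    have h7 : B 0 / 2 / r * τ n ^ (r - 2) ≤ B (y n) / r * τ n ^ (r - 2) := by gcongr
    have h8 : τ n ^ (r - 2) ≤ 2 * r * A 0 / B 0 := by
      rw [le_div_iff₀ hB0]
      have h9 : B 0 / 2 / r * τ n ^ (r - 2) ≤ A 0 := by linarith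
      have h10 : B 0 / 2 / r * τ n ^ (r - 2) = (τ n ^ (r - 2) * B 0) / (2 * r) := by
        field_simp
      rw [h10, div_le_iff₀ (by positivity)] at h9
      linarith
    have h9 := Real.rpow_le_rpow (by positivity) h8 (by
      have : 0 < r - 2 := by linarith
      positivity : 0 ≤ 1 / (r - 2))
    rwa [← Real.rpow_mul h0.le, mul_one_div_cancel (by linarith), Real.rpow_one] at h9
  obtain ⟨τs, hτs, φ, hφ, hlim⟩ := isCompact_Icc.isSeqCompact (x := τ) fun n => ⟨hτ0 n, hτT n⟩
  have hyφ : Tendsto (fun n => y (φ n)) atTop (𝓝[>] 0) := hy.comp hφ.tendsto_atTop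
  have hy0 : Tendsto (fun n => y (φ n)) atTop (𝓝 0) := hyφ.mono_right nhdsWithin_le_nhds
  have hlim' : Tendsto (fun n => τ (φ n)) atTop (𝓝 τs) := hlim
  have l2 := hlim'.pow 2
  have lr := hlim'.rpow_const (p := r) (Or.inr (by linarith))
  have lq := hlim'.rpow_const (p := q) (Or.inr (by linarith))
  have hτs1 : τs = 1 := by
    have h1 : fib r q (A 0) (B 0) (D 0) 1 ≤ fib r q (A 0) (B 0) (D 0) τs := by
      refine ge_of_tendsto' (((((hA.continuousAt.tendsto.comp hy0).div_const 2).mul l2).sub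
        (((hB.continuousAt.tendsto.comp hy0).div_const r).mul lr)).sub
        ((hD.continuousAt.tendsto.comp hy0).mul lq)) fun n => hτ (φ n)
    refine fib_max_unique hr hq hB0 hD0.le hmax (lt_of_le_of_ne hτs.1 ?_) h1
    rintro rfl
    rw [fib_zero hr hq] at h1
    linarith
  subst hτs1
  have hsl : ∀ {F : ℝ → ℝ} {F' : ℝ}, HasDerivAt F F' 0 →
      Tendsto (fun n => (y (φ n))⁻¹ * (F (y (φ n)) - F 0)) atTop (𝓝 F') := fun h => by
    have h1 := (hasDerivAt_iff_tendsto_slope_zero.1 h).comp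
      (hyφ.mono_right (nhdsWithin_mono _ fun x hx => ne_of_gt hx))
    simpa [Function.comp_def] using h1
  have hfin := ((((hsl hA).div_const 2).mul l2).sub (((hsl hB).div_const r).mul lr)).sub
    ((hsl hD).mul lq)
  simp only [one_pow, Real.one_rpow, mul_one] at hfin
  refine ge_of_tendsto' hfin fun n => ?_
  have h1 := (hmax _ (hτ0 (φ n))).trans (hτ (φ n))
  have h2 : 0 < y (φ n) := (hP (φ n)).2.2
  have e : (y (φ n))⁻¹ * (A (y (φ n)) - A 0) / 2 * τ (φ n) ^ 2 -
      (y (φ n))⁻¹ * (B (y (φ n)) - B 0) / r * τ (φ n) ^ r -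
      (y (φ n))⁻¹ * (D (y (φ n)) - D 0) * τ (φ n) ^ q =
      (y (φ n))⁻¹ * (fib r q (A (y (φ n))) (B (y (φ n))) (D (y (φ n))) (τ (φ n)) -
        fib r q (A 0) (B 0) (D 0) (τ (φ n))) := by
    unfold fib; ring
  rw [e]
  exact mul_nonneg (inv_nonneg.2 h2.le) (by linarith)

/-- The `r`-th moment is differentiable along lines. -/
lemma hasDerivAt_integral_abs_rpow {α : Type*} [MeasurableSpace α] {μ : Measure α} {r : ℝ}
    (hr : 1 < r) {f g : α → ℝ} (hf : Measurable f) (hg : Measurable g)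
    (hfi : Integrable (fun x => |f x| ^ r) μ) (hgi : Integrable (fun x => |g x| ^ r) μ) :
    Integrable (fun x => |f x| ^ (r - 2) * f x * g x) μ ∧
    HasDerivAt (fun t => ∫ x, |f x + t * g x| ^ r ∂μ)
      (r * ∫ x, |f x| ^ (r - 2) * f x * g x ∂μ) 0 := by
  have hmeas : ∀ t, Measurable fun x => f x + t * g x := fun t => hf.add (hg.const_mul t)
  have hb : ∀ a : ℝ, |(|a| ^ (r - 2) * a)| = |a| ^ (r - 1) := fun a => by
    rcases eq_or_ne a 0 with rfl | ha
    · simp [Real.zero_rpow (by linarith : r - 1 ≠ 0)]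
    · rw [abs_mul, abs_of_nonneg (by positivity : 0 ≤ |a| ^ (r - 2)),
        ← Real.rpow_add_one (abs_pos.2 ha).ne']
      congr 1; ring
  have key := hasDerivAt_integral_of_dominated_loc_of_deriv_le (μ := μ) (𝕜 := ℝ)
    (F := fun t x => |f x + t * g x| ^ r)
    (F' := fun t x => r * |f x + t * g x| ^ (r - 2) * (f x + t * g x) * g x)
    (bound := fun x => r * (2 ^ r * (|f x| ^ r + |g x| ^ r))) (x₀ := 0)
    (Metric.ball_mem_nhds 0 one_pos)
    (Eventually.of_forall fun t => ((hmeas t).abs.pow_const r).aestronglyMeasurable)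
    (by simpa using hfi)
    (((((hmeas 0).abs.pow_const (r - 2)).const_mul r).mul (hmeas 0)).mul hg).aestronglyMeasurable
    (Eventually.of_forall fun x t ht => by
      have ht1 : |t| ≤ 1 := by
        have := Metric.mem_ball.1 ht
        rw [Real.dist_eq, sub_zero] at this; exact this.le
      have h1 : |f x + t * g x| ≤ |f x| + |g x| := by
        refine (abs_add_le _ _).trans ?_
        rw [abs_mul]
        nlinarith [abs_nonneg (g x)]
      have h2 : |g x| ≤ |f x| + |g x| := by linarith [abs_nonneg (f x)]
      have h0 : 0 ≤ |f x| + |g x| := by positivity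
      have e : r * |f x + t * g x| ^ (r - 2) * (f x + t * g x) * g x =
        r * ((|f x + t * g x| ^ (r - 2) * (f x + t * g x)) * g x) := by ring
      rw [e, Real.norm_eq_abs, abs_mul, abs_mul, hb, abs_of_pos (by linarith : 0 < r)]
      refine mul_le_mul_of_nonneg_left ?_ (by linarith)
      calc |f x + t * g x| ^ (r - 1) * |g x|
          ≤ (|f x| + |g x|) ^ (r - 1) * (|f x| + |g x|) :=
            mul_le_mul (Real.rpow_le_rpow (abs_nonneg _) h1 (by linarith)) h2 (abs_nonneg _)
              (by positivity)
        _ = (|f x| + |g x|) ^ r := by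
            rw [← Real.rpow_add_one' h0 (by linarith)]; congr 1; ring
        _ ≤ 2 ^ r * (|f x| ^ r + |g x| ^ r) := by
            have := abs_sub_rpow_le (by linarith : 0 ≤ r) |f x| (-|g x|)
            rwa [sub_neg_eq_add, abs_of_nonneg h0, abs_neg, abs_abs, abs_abs] at this)
    (((hfi.add hgi).const_mul _).const_mul _)
    (Eventually.of_forall fun x t _ => by
      have h1 : HasDerivAt (fun t => f x + t * g x) (g x) t := by
        simpa using ((hasDerivAt_id t).mul_const (g x)).const_add (f x)
      exact (hasDerivAt_abs_rpow (f x + t * g x) hr).comp t h1)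
  simp only [zero_mul, add_zero] at key
  have e : ∀ x, r * |f x| ^ (r - 2) * f x * g x = r * (|f x| ^ (r - 2) * f x * g x) := fun x => by
    ring
  simp_rw [e] at key
  rw [integral_const_mul] at key
  refine ⟨?_, key.2⟩
  have := key.1.const_mul r⁻¹
  refine this.congr (Eventually.of_forall fun x => ?_)
  simp only
  rw [← mul_assoc, inv_mul_cancel₀ (by linarith), one_mul]

/-- A function realizing the minimax level solves the equation against radial test functions. -/
lemma weak_eq_of_minimax (hN : 2 ≤ N) (hs : s ∈ Set.Ioo (0 : ℝ) 1) {p q k m σ : ℝ}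
    (hq : 2 < q) (hqp : q < p) (hpr : p < critExp N s) (hk : 0 < k) (hm : 0 < m)
    (hu : Hs N s u) (hur : Rad u) (hu0 : ¬ u =ᵐ[volume] 0) (hum : pint N 2 u = m)
    (hmax : ∀ t, 0 ≤ t → fib (critExp N s) q (gag N s u) (pint N (critExp N s) u)
        (k * pint N p u) t ≤ σ)
    (hone : fib (critExp N s) q (gag N s u) (pint N (critExp N s) u) (k * pint N p u) 1 = σ)
    (hlev : ∀ v, Hs N s v → Rad v → ¬ v =ᵐ[volume] 0 →
        ∃ τ, 0 ≤ τ ∧ σ ≤ fib (critExp N s) q (gag N s v) (pint N (critExp N s) v)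
          (k * pint N p v * (m / pint N 2 v) ^ ((p - q) / 2)) τ)
    (hv : Hs N s v) (hvr : Rad v) :
    gform N s u v = (-((p - q) * (k * pint N p u) / m)) * (∫ x, u x * v x) +
      (∫ x, |u x| ^ (critExp N s - 2) * u x * v x) +
      k * p * ∫ x, |u x| ^ (p - 2) * u x * v x := by
  have hr2 := critExp_pos hN hs
  have hA0 := gag_pos_of_not_ae_zero hN hs hu hu0
  have hB0 := pint_pos_of_not_ae_zero (by linarith) (hu.int_crit hN hs) hu0
  have hC0 : 0 < pint N p u :=
    pint_pos_of_not_ae_zero (by linarith) (hu.int_rpow hN hs (by linarith) hpr.le) hu0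
  have key : ∀ v, Hs N s v → Rad v → 0 ≤ gform N s u v -
      ((-((p - q) * (k * pint N p u) / m)) * (∫ x, u x * v x) +
      (∫ x, |u x| ^ (critExp N s - 2) * u x * v x) +
      k * p * ∫ x, |u x| ^ (p - 2) * u x * v x) := by
    intro v hv hvr
    have dA : HasDerivAt (fun t => gag N s (fun x => u x + t * v x)) (2 * gform N s u v) 0 := by
      simp_rw [gag_line hu hv]
      exact hasDerivAt_quadratic _ _ _
    have dM : HasDerivAt (fun t => pint N 2 (fun x => u x + t * v x)) (2 * ∫ x, u x * v x) 0 := by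
      simp_rw [pint_two_line hu hv]
      exact hasDerivAt_quadratic _ _ _
    have dB := (hasDerivAt_integral_abs_rpow (by linarith : 1 < critExp N s) hu.meas hv.meas
      (hu.int_crit hN hs) (hv.int_crit hN hs)).2
    have dC := (hasDerivAt_integral_abs_rpow (by linarith : 1 < p) hu.meas hv.meas
      (hu.int_rpow hN hs (by linarith) hpr.le) (hv.int_rpow hN hs (by linarith) hpr.le)).2
    have e0 : (fun x => u x + 0 * v x) = u := by ext x; simp
    have dW : HasDerivAt (fun t => (m / pint N 2 (fun x => u x + t * v x)) ^ ((p - q) / 2))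
        (-((p - q) * (∫ x, u x * v x) / m)) 0 := by
      have h1 := (dM.inv (by rw [e0, hum]; exact hm.ne')).const_mul m
      have h2 := h1.rpow_const (p := (p - q) / 2) (Or.inl (by
        simp only [Pi.inv_apply]
        rw [e0, hum, mul_inv_cancel₀ hm.ne']; exact one_ne_zero))
      simp only [Pi.inv_apply] at h2
      rw [e0, hum, mul_inv_cancel₀ hm.ne', Real.one_rpow] at h2
      refine HasDerivAt.congr_deriv h2 ?_
      field_simp
    have dD := (dC.const_mul k).mul dW
    have h := danskin hr2 hq (A := fun t => gag N s (fun x => u x + t * v x))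
      (B := fun t => pint N (critExp N s) (fun x => u x + t * v x))
      (D := fun t => k * pint N p (fun x => u x + t * v x) *
        (m / pint N 2 (fun x => u x + t * v x)) ^ ((p - q) / 2)) dA dB dD
    simp only [e0, hum, div_self hm.ne', Real.one_rpow, mul_one] at h
    specialize h hA0 hB0 (by positivity) (fun t ht => by rw [hone]; exact hmax t ht) (by
      have hpos : ∀ᶠ t in 𝓝[>] (0 : ℝ), 0 < pint N 2 (fun x => u x + t * v x) := by
        refine (dM.continuousAt.tendsto.mono_left nhdsWithin_le_nhds).eventually_const_lt ?_
        rw [e0, hum]; exact hm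
      filter_upwards [hpos] with t ht
      rw [hone]
      refine hlev _ (hu.add (hv.smul t)) (hur.add (hvr.smul t)) fun h0 => ?_
      rw [pint_zero_of_ae_zero two_ne_zero h0] at ht
      exact lt_irrefl _ ht)
    have e1 : (∫ x : Sp N, |u x + 0 * v x| ^ p) = pint N p u := congrArg (pint N p) e0
    rw [e1] at h
    have hr0 : critExp N s ≠ 0 := by linarith
    refine h.trans (le_of_eq ?_)
    field_simp
    ring
  refine le_antisymm ?_ (by linarith [key v hv hvr])
  have h := key _ (hv.smul (-1)) (hvr.smul (-1))
  have e1 : gform N s u (fun x => -1 * v x) = - gform N s u v := by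
    unfold gform
    rw [dq_smul, ← integral_neg]
    congr 1; ext z; ring
  have e2 : ∀ f : Sp N → ℝ, ∫ x, f x * (-1 * v x) = - ∫ x, f x * v x := fun f => by
    rw [← integral_neg]; congr 1; ext z; ring
  rw [e1, e2, e2, e2] at h
  linarith

lemma dq_ae_congr (h : u =ᵐ[volume] v) : dq N s u =ᵐ[volume] dq N s v := by
  have hfst : ∀ᵐ z : Sp N × Sp N, u z.1 = v z.1 := Measure.quasiMeasurePreserving_fst.ae h
  have hsnd : ∀ᵐ z : Sp N × Sp N, u z.2 = v z.2 := Measure.quasiMeasurePreserving_snd.ae h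
  filter_upwards [hfst, hsnd] with z h1 h2
  simp [dq, h1, h2]

/-- The Hilbert space `L² × L²` in which `H^s` embeds isometrically. -/
abbrev HsAmb (N : ℕ) := WithLp 2 (Lp ℝ 2 (volume : Measure (Sp N)) ×
  Lp ℝ 2 (volume : Measure (Sp N × Sp N)))

/-- The space `H^s`, as the graph of the difference quotient. -/
def hsGraph (N : ℕ) (s : ℝ) : Submodule ℝ (HsAmb N) where
  carrier := {h | ∃ φ, Hs N s φ ∧ h.fst =ᵐ[volume] φ ∧ h.snd =ᵐ[volume] dq N s φ}
  add_mem' := by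
    rintro a b ⟨φ, h, h1, h2⟩ ⟨ψ, k, k1, k2⟩
    refine ⟨_, h.add k, ?_, ?_⟩
    · filter_upwards [Lp.coeFn_add a.fst b.fst, h1, k1] with x e1 e2 e3
      rw [WithLp.add_fst, e1, Pi.add_apply, e2, e3]
    · rw [dq_add]
      filter_upwards [Lp.coeFn_add a.snd b.snd, h2, k2] with x e1 e2 e3
      rw [WithLp.add_snd, e1, Pi.add_apply, e2, e3]
  zero_mem' := by
    refine ⟨fun _ => 0, ⟨measurable_const, MemLp.zero, ?_⟩, ?_, ?_⟩
    · have : dq N s (fun _ => 0) = 0 := by ext z; simp [dq]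
      rw [this]; exact MemLp.zero
    · exact Lp.coeFn_zero ℝ 2 volume
    · have : dq N s (fun _ => 0) = 0 := by ext z; simp [dq]
      rw [this]; exact Lp.coeFn_zero ℝ 2 volume
  smul_mem' := by
    rintro c a ⟨φ, h, h1, h2⟩
    refine ⟨_, h.smul c, ?_, ?_⟩
    · filter_upwards [Lp.coeFn_smul c a.fst, h1] with x e1 e2
      rw [WithLp.smul_fst, e1, Pi.smul_apply, e2, smul_eq_mul]
    · rw [dq_smul]
      filter_upwards [Lp.coeFn_smul c a.snd, h2] with x e1 e2
      rw [WithLp.smul_snd, e1, Pi.smul_apply, e2, smul_eq_mul]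

lemma isClosed_hsGraph : IsClosed (hsGraph N s : Set (HsAmb N)) := by
  refine IsSeqClosed.isClosed fun h a hh ha => ?_
  choose φ hφ h1 h2 using hh
  have c1 : Tendsto (fun n => (h n).fst) atTop (𝓝 a.fst) :=
    ((WithLp.continuous_fst 2 _ _).tendsto a).comp ha
  have c2 : Tendsto (fun n => (h n).snd) atTop (𝓝 a.snd) :=
    ((WithLp.continuous_snd 2 _ _).tendsto a).comp ha
  obtain ⟨ψ, hψ, t1⟩ := (tendstoInMeasure_of_tendsto_Lp c1).exists_seq_tendsto_ae
  obtain ⟨χ, hχ, t2⟩ := (tendstoInMeasure_of_tendsto_Lp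
    (c2.comp hψ.tendsto_atTop)).exists_seq_tendsto_ae
  set g : Sp N → ℝ := (Lp.memLp a.fst).1.mk with hg
  have hag : a.fst =ᵐ[volume] g := (Lp.memLp a.fst).1.ae_eq_mk
  have hgm : Measurable g := (Lp.memLp a.fst).1.stronglyMeasurable_mk.measurable
  have t3 : ∀ᵐ x, Tendsto (fun n => φ (ψ (χ n)) x) atTop (𝓝 (g x)) := by
    filter_upwards [t1, hag, ae_all_iff.2 h1] with x e1 e2 e3
    rw [← e2]
    refine (e1.comp hχ.tendsto_atTop).congr fun n => ?_
    exact e3 _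
  have f1 : ∀ᵐ z : Sp N × Sp N, Tendsto (fun n => φ (ψ (χ n)) z.1) atTop (𝓝 (g z.1)) :=
    Measure.quasiMeasurePreserving_fst.ae t3
  have f2 : ∀ᵐ z : Sp N × Sp N, Tendsto (fun n => φ (ψ (χ n)) z.2) atTop (𝓝 (g z.2)) :=
    Measure.quasiMeasurePreserving_snd.ae t3
  have hdq : a.snd =ᵐ[volume] dq N s g := by
    filter_upwards [t2, f1, f2, ae_all_iff.2 h2] with z e1 e2 e3 e4
    refine tendsto_nhds_unique e1 ?_
    refine ((e2.sub e3).div_const _).congr fun n => ?_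
    exact (e4 _).symm
  exact ⟨g, ⟨hgm, (memLp_congr_ae hag).1 (Lp.memLp _), (memLp_congr_ae hdq).1 (Lp.memLp _)⟩,
    hag, hdq⟩

/-- The element of `hsGraph` attached to a function in `H^s`. -/
def Hs.toGraph (h : Hs N s u) : hsGraph N s :=
  ⟨WithLp.toLp 2 (h.l2.toLp u, h.gag.toLp (dq N s u)), u, h, h.l2.coeFn_toLp, h.gag.coeFn_toLp⟩

lemma inner_of_ae {a b : HsAmb N} (h1 : a.fst =ᵐ[volume] u) (h2 : a.snd =ᵐ[volume] dq N s u)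
    (k1 : b.fst =ᵐ[volume] v) (k2 : b.snd =ᵐ[volume] dq N s v) :
    inner ℝ a b = (∫ x, u x * v x) + gform N s u v := by
  rw [WithLp.prod_inner_apply, L2.inner_def, L2.inner_def]
  unfold gform
  congr 1
  · refine integral_congr_ae ?_
    filter_upwards [h1, k1] with x e1 e2
    change inner ℝ (a.fst x) (b.fst x) = _
    rw [e1, e2]; simp [mul_comm]
  · refine integral_congr_ae ?_
    filter_upwards [h2, k2] with x e1 e2
    change inner ℝ (a.snd x) (b.snd x) = _
    rw [e1, e2]; simp [mul_comm]

lemma gform_self : gform N s u u = gag N s u := by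
  unfold gform gag; simp only [sq]

lemma integral_mul_self_eq : (∫ x, u x * u x) = pint N 2 u := by
  rw [pint_two_eq]; simp only [sq]

/-- Riesz representation in `H^s` of functionals given by integration against a function. -/
lemma exists_riesz {G : Sp N → ℝ} (hi : ∀ φ, Hs N s φ → Integrable (fun x => G x * φ x))
    {C : ℝ} (hC : ∀ φ, Hs N s φ → pint N 2 φ + gag N s φ ≤ 1 → |∫ x, G x * φ x| ≤ C) :
    ∃ g, Hs N s g ∧ ∀ φ, Hs N s φ → (∫ x, g x * φ x) + gform N s g φ = ∫ x, G x * φ x := by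
  have hcl : IsClosed (hsGraph N s : Set (HsAmb N)) := isClosed_hsGraph
  have : CompleteSpace (hsGraph N s) := hcl.completeSpace_coe
  have h_int : ∀ a : hsGraph N s, Integrable (fun x => G x * (a : HsAmb N).fst x) := fun a => by
    obtain ⟨φ, hφ, h1, -⟩ := a.2
    refine (hi φ hφ).congr ?_
    filter_upwards [h1] with x e
    rw [e]
  let L : hsGraph N s →ₗ[ℝ] ℝ :=
    { toFun := fun a => ∫ x, G x * (a : HsAmb N).fst x
      map_add' := fun a b => by
        rw [← integral_add (h_int a) (h_int b)]
        refine integral_congr_ae ?_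
        filter_upwards [Lp.coeFn_add (a : HsAmb N).fst (b : HsAmb N).fst] with x e
        rw [Submodule.coe_add, WithLp.add_fst, e, Pi.add_apply, mul_add]
      map_smul' := fun c a => by
        rw [RingHom.id_apply, smul_eq_mul, ← integral_const_mul]
        refine integral_congr_ae ?_
        filter_upwards [Lp.coeFn_smul c (a : HsAmb N).fst] with x e
        rw [Submodule.coe_smul, WithLp.smul_fst, e, Pi.smul_apply, smul_eq_mul]
        ring }
  have hL : ∀ (a : hsGraph N s) φ, (a : HsAmb N).fst =ᵐ[volume] φ →
      L a = ∫ x, G x * φ x := fun a φ h => by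
    refine integral_congr_ae ?_
    filter_upwards [h] with x e
    rw [e]
  have hb : ∀ a ∈ Metric.ball (0 : hsGraph N s) 1, ‖L a‖ ≤ C := fun a ha => by
    obtain ⟨φ, hφ, h1, h2⟩ := a.2
    rw [hL a φ h1, Real.norm_eq_abs]
    refine hC φ hφ ?_
    have e := inner_of_ae h1 h2 h1 h2
    rw [real_inner_self_eq_norm_sq, gform_self, integral_mul_self_eq] at e
    rw [← e]
    rw [mem_ball_zero_iff] at ha
    have : ‖(a : HsAmb N)‖ < 1 := ha
    nlinarith [norm_nonneg (a : HsAmb N)]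
  obtain ⟨K, hK⟩ := LinearMap.bound_of_ball_bound one_pos C L hb
  set T := L.mkContinuous K hK
  set G0 := (InnerProductSpace.toDual ℝ (hsGraph N s)).symm T with hG0
  obtain ⟨g, hg, h1, h2⟩ := G0.2
  refine ⟨g, hg, fun φ hφ => ?_⟩
  have e : inner ℝ G0 hφ.toGraph = T hφ.toGraph := by
    rw [hG0, InnerProductSpace.toDual_symm_apply]
  have e2 : T hφ.toGraph = ∫ x, G x * φ x := hL _ φ hφ.l2.coeFn_toLp
  rw [← e2, ← e]
  have k1 : (hφ.toGraph : HsAmb N).fst =ᵐ[volume] φ := hφ.l2.coeFn_toLp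
  have k2 : (hφ.toGraph : HsAmb N).snd =ᵐ[volume] dq N s φ := hφ.gag.coeFn_toLp
  exact (inner_of_ae h1 h2 k1 k2).symm

/-- A square-integrable function with bounded seminorm that is invariant under isometries up to
null sets coincides a.e. with a radial function. -/
lemma exists_rad_of_invariant (hs : 0 < s) (hw : Hs N s w)
    (hinv : ∀ R : Sp N ≃ₗᵢ[ℝ] Sp N, (fun x => w (R x)) =ᵐ[volume] w) :
    ∃ g, Hs N s g ∧ Rad g ∧ g =ᵐ[volume] w := by
  have hV := ballVol_pos (N := N)
  set ε : ℕ → ℝ := fun n => 1 / ((n : ℝ) + 1) with hε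
  have hε0 : ∀ n, 0 < ε n := fun n => by positivity
  have hlim : Tendsto (fun n => eLpNorm (fun x => w x - bavg N (ε n) w x) 2 volume)
    atTop (𝓝 0) := by
    have h0 : Tendsto (fun n =>
      ENNReal.ofReal ((ε n) ^ (2 * s) / ballVol N * gag N s w) ^ (1 / 2 : ℝ))
        atTop (𝓝 0) := by
      have e1 : Tendsto (fun n => (ε n) ^ (2 * s) / ballVol N * gag N s w) atTop (𝓝 0) := by
        have := (tendsto_one_div_add_atTop_nhds_zero_nat (𝕜 := ℝ)).rpow_const (p := 2 * s)
          (Or.inr (by linarith))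
        rw [Real.zero_rpow (by linarith)] at this
        simpa [hε] using (this.div_const (ballVol N)).mul_const (gag N s w)
      have := ((ENNReal.continuous_rpow_const (y := (1 / 2 : ℝ))).comp
        ENNReal.continuous_ofReal).continuousAt.tendsto.comp e1
      simpa [Function.comp_def] using this
    refine tendsto_of_tendsto_of_tendsto_of_le_of_le tendsto_const_nhds h0 (fun n => zero_le)
      fun n => ?_
    rw [eLpNorm_eq_lintegral_rpow_enorm_toReal two_ne_zero (by simp)]
    refine ENNReal.rpow_le_rpow ?_ (by norm_num)
    refine le_trans (le_of_eq ?_) (lintegral_sq_sub_bavg_le hs hw (hε0 n))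
    refine lintegral_congr fun x => ?_
    simp only [ENNReal.toReal_ofNat, ENNReal.rpow_ofNat]
    rw [← sq_abs, ENNReal.ofReal_pow (abs_nonneg _), Real.enorm_eq_ofReal_abs]
  have hm : TendstoInMeasure volume (fun n x => w x - bavg N (ε n) w x) atTop (fun _ => 0) := by
    refine tendstoInMeasure_of_tendsto_eLpNorm two_ne_zero
      (fun n => (hw.meas.sub (measurable_bavg hw.meas)).aestronglyMeasurable)
      measurable_const.aestronglyMeasurable ?_
    simpa [Pi.sub_def] using hlim
  obtain ⟨ψ, -, hψ⟩ := hm.exists_seq_tendsto_ae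
  have hgm : Measurable fun x => limsup (fun n => bavg N (ε (ψ n)) w x) atTop :=
    Measurable.limsup fun n => measurable_bavg hw.meas
  have hgw : (fun x => limsup (fun n => bavg N (ε (ψ n)) w x) atTop) =ᵐ[volume] w := by
    filter_upwards [hψ] with x hx
    have := (tendsto_const_nhds (x := w x)).sub hx
    simp only [sub_sub_cancel, sub_zero] at this
    exact this.limsup_eq
  refine ⟨_, ⟨hgm, (memLp_congr_ae hgw.symm).1 hw.l2,
    (memLp_congr_ae (dq_ae_congr hgw.symm)).1 hw.gag⟩, fun x y hxy => ?_, hgw⟩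
  obtain ⟨R, rfl⟩ := exists_isometry hxy
  have e : ∀ n, bavg N (ε (ψ n)) w x = bavg N (ε (ψ n)) w (R x) := fun n => by
    unfold bavg
    rw [setIntegral_ball_isometry]
    congr 1
    exact (integral_congr_ae (ae_restrict_of_ae (hinv R))).symm
  simp only [e]

/-- The product isometry acting diagonally on pairs of points is measure preserving. -/
lemma measurePreserving_isometry_prod (R : Sp N ≃ₗᵢ[ℝ] Sp N) :
    MeasurePreserving (fun z : Sp N × Sp N => (R z.1, R z.2)) :=
  R.measurePreserving.prod R.measurePreserving

lemma measurableEmbedding_isometry_prod (R : Sp N ≃ₗᵢ[ℝ] Sp N) :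
    MeasurableEmbedding (fun z : Sp N × Sp N => (R z.1, R z.2)) :=
  (R.toHomeomorph.prodCongr R.toHomeomorph).measurableEmbedding

lemma dq_isometry (R : Sp N ≃ₗᵢ[ℝ] Sp N) :
    dq N s (fun x => u (R x)) = fun z => dq N s u (R z.1, R z.2) := by
  ext z
  unfold dq
  rw [← map_sub, R.norm_map]

lemma Hs.comp_isometry (hu : Hs N s u) (R : Sp N ≃ₗᵢ[ℝ] Sp N) : Hs N s (fun x => u (R x)) := by
  refine ⟨hu.meas.comp R.continuous.measurable,
    hu.l2.comp_measurePreserving R.measurePreserving, ?_⟩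
  rw [dq_isometry]
  exact hu.gag.comp_measurePreserving (measurePreserving_isometry_prod R)

lemma integral_comp_isometry (R : Sp N ≃ₗᵢ[ℝ] Sp N) (f : Sp N → ℝ) :
    ∫ x, f (R x) = ∫ x, f x :=
  R.measurePreserving.integral_comp R.toHomeomorph.measurableEmbedding f

lemma gform_comp_isometry (R : Sp N ≃ₗᵢ[ℝ] Sp N) :
    gform N s (fun x => u (R x)) v = gform N s u (fun x => v (R.symm x)) := by
  unfold gform
  rw [dq_isometry, dq_isometry, ← (measurePreserving_isometry_prod R).integral_comp
    (measurableEmbedding_isometry_prod R)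
    (fun z => dq N s u z * dq N s v (R.symm z.1, R.symm z.2))]
  simp

lemma gform_sub_left (hu : Hs N s u) (hv : Hs N s v) (hw : Hs N s w) :
    gform N s (fun x => u x - v x) w = gform N s u w - gform N s v w := by
  unfold gform
  rw [dq_sub]
  simp only [sub_mul]
  exact integral_sub (hu.gag.integrable_mul hw.gag) (hv.gag.integrable_mul hw.gag)

lemma integral_sub_mul (hu : Hs N s u) (hv : Hs N s v) (hw : Hs N s w) :
    ∫ x, (u x - v x) * w x = (∫ x, u x * w x) - ∫ x, v x * w x := by
  simp only [sub_mul]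
  exact integral_sub (hu.l2.integrable_mul hw.l2) (hv.l2.integrable_mul hw.l2)

/-- Elements of `H^s` with the same inner products on a space containing their difference agree. -/
lemma ae_eq_of_inner_eq (hu : Hs N s u) (hv : Hs N s v)
    (h : (∫ x, u x * (u x - v x)) + gform N s u (fun x => u x - v x) =
      (∫ x, v x * (u x - v x)) + gform N s v (fun x => u x - v x)) : u =ᵐ[volume] v := by
  have hd := hu.sub hv
  have e1 := gform_sub_left hu hv hd
  have e2 := integral_sub_mul hu hv hd
  rw [gform_self] at e1
  rw [integral_mul_self_eq] at e2
  have h0 : pint N 2 (fun x => u x - v x) = 0 := by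
    have := gag_nonneg (N := N) (s := s) (u := fun x => u x - v x)
    have := pint_nonneg (N := N) (q := 2) (u := fun x => u x - v x)
    linarith
  by_contra hne
  refine (pint_pos_of_not_ae_zero two_pos hd.int_two fun h' => hne ?_).ne' h0
  filter_upwards [h'] with x hx
  exact sub_eq_zero.1 hx

/-- Symmetric criticality: a weak equation with radial data that holds for radial test functions
holds for all test functions. -/
lemma symmetric_criticality (hs : 0 < s) (hu : Hs N s u) (hur : Rad u) {G : Sp N → ℝ}
    (hG : Rad G) (hi : ∀ φ, Hs N s φ → Integrable (fun x => G x * φ x))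
    {C : ℝ} (hC : ∀ φ, Hs N s φ → pint N 2 φ + gag N s φ ≤ 1 → |∫ x, G x * φ x| ≤ C)
    (heq : ∀ φ, Hs N s φ → Rad φ → (∫ x, u x * φ x) + gform N s u φ = ∫ x, G x * φ x)
    (hv : Hs N s v) : (∫ x, u x * v x) + gform N s u v = ∫ x, G x * v x := by
  obtain ⟨g, hg, hgr⟩ := exists_riesz hi hC
  have hinv : ∀ R : Sp N ≃ₗᵢ[ℝ] Sp N, (fun x => g (R x)) =ᵐ[volume] g := fun R => by
    have hgR := hg.comp_isometry R
    refine ae_eq_of_inner_eq hgR hg ?_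
    have hd := hgR.sub hg
    rw [hgr _ hd, gform_comp_isometry, ← integral_comp_isometry R.symm]
    simp only [R.apply_symm_apply]
    have := hgr _ (hd.comp_isometry R.symm)
    simp only [R.apply_symm_apply] at this
    rw [this, ← integral_comp_isometry R]
    simp only [R.symm_apply_apply, hG.comp_isometry R]
  obtain ⟨f, hf, hfr, hfg⟩ := exists_rad_of_invariant hs hg hinv
  have hfe : ∀ φ, Hs N s φ → (∫ x, f x * φ x) + gform N s f φ = ∫ x, G x * φ x := fun φ hφ => by
    rw [← hgr φ hφ]
    congr 1
    · refine integral_congr_ae ?_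
      filter_upwards [hfg] with x hx
      rw [hx]
    · refine integral_congr_ae ?_
      filter_upwards [dq_ae_congr (s := s) hfg] with x hx
      rw [hx]
  have huf : u =ᵐ[volume] f := by
    refine ae_eq_of_inner_eq hu hf ?_
    rw [heq _ (hu.sub hf) (hur.sub hfr), hfe _ (hu.sub hf)]
  rw [← hfe v hv]
  congr 1
  · refine integral_congr_ae ?_
    filter_upwards [huf] with x hx
    rw [hx]
  · refine integral_congr_ae ?_
    filter_upwards [dq_ae_congr (s := s) huf] with x hx
    rw [hx]

lemma abs_rpow_mul_mul_le {r : ℝ} (hr : 1 < r) (a b : ℝ) :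
    |(|a| ^ (r - 2) * a * b)| ≤ |a| ^ r + |b| ^ r := by
  have hpow : ∀ c : ℝ, 0 ≤ c → c ^ (r - 1) * c = c ^ r := fun c hc => by
    rw [← Real.rpow_add_one' hc (by linarith)]; ring_nf
  have h1 : |(|a| ^ (r - 2) * a * b)| = |a| ^ (r - 1) * |b| := by
    rw [abs_mul, abs_mul, abs_of_nonneg (Real.rpow_nonneg (abs_nonneg a) _),
      ← Real.rpow_add_one' (abs_nonneg a) (by linarith)]
    ring_nf
  have ha := abs_nonneg a
  have hb := abs_nonneg b
  have ha' : 0 ≤ |a| ^ r := Real.rpow_nonneg ha r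
  have hb' : 0 ≤ |b| ^ r := Real.rpow_nonneg hb r
  rw [h1]
  rcases le_total |a| |b| with h | h
  · have : |a| ^ (r - 1) * |b| ≤ |b| ^ (r - 1) * |b| := by
      gcongr
    rw [hpow _ hb] at this
    linarith
  · have : |a| ^ (r - 1) * |b| ≤ |a| ^ (r - 1) * |a| := by gcongr
    rw [hpow _ ha] at this
    linarith

lemma abs_integral_rpow_mul_le {r : ℝ} (hr : 1 < r) (hu : Measurable u) (hv : Measurable v)
    (hui : Integrable (fun x => |u x| ^ r)) (hvi : Integrable (fun x => |v x| ^ r)) :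
    |∫ x, |u x| ^ (r - 2) * u x * v x| ≤ pint N r u + pint N r v := by
  unfold pint
  rw [← integral_add hui hvi]
  refine abs_integral_le_integral_abs.trans ?_
  exact integral_mono (hasDerivAt_integral_abs_rpow hr hu hv hui hvi).1.abs (hui.add hvi)
    fun x => abs_rpow_mul_mul_le hr _ _

/-- The weak equation extends from radial test functions to all of `H^s`. -/
lemma weak_eq_of_radial (hN : 2 ≤ N) (hs : s ∈ Set.Ioo (0 : ℝ) 1) {p μ κ : ℝ} (hp : 2 < p)
    (hpr : p < critExp N s) (hu : Hs N s u) (hur : Rad u)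
    (heq : ∀ φ, Hs N s φ → Rad φ → gform N s u φ = μ * (∫ x, u x * φ x) +
      (∫ x, |u x| ^ (critExp N s - 2) * u x * φ x) + κ * ∫ x, |u x| ^ (p - 2) * u x * φ x)
    (hv : Hs N s v) :
    gform N s u v = ∫ x, (μ * u x * v x + |u x| ^ (critExp N s - 2) * u x * v x +
      κ * |u x| ^ (p - 2) * u x * v x) := by
  have hr2 := critExp_pos hN hs
  have hS := sobConst_pos (N := N) (s := s)
  have i1 : ∀ φ, Hs N s φ → Integrable (fun x => u x * φ x) := fun φ hφ =>
    hu.l2.integrable_mul hφ.l2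
  have i2 : ∀ φ, Hs N s φ → Integrable (fun x => |u x| ^ (critExp N s - 2) * u x * φ x) :=
    fun φ hφ => (hasDerivAt_integral_abs_rpow (by linarith) hu.meas hφ.meas
      (hu.int_crit hN hs) (hφ.int_crit hN hs)).1
  have i3 : ∀ φ, Hs N s φ → Integrable (fun x => |u x| ^ (p - 2) * u x * φ x) :=
    fun φ hφ => (hasDerivAt_integral_abs_rpow (by linarith) hu.meas hφ.meas
      (hu.int_rpow hN hs hp.le hpr.le) (hφ.int_rpow hN hs hp.le hpr.le)).1
  have hsum : ∀ φ (c : ℝ), Hs N s φ →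
      Integrable (fun x => c * (u x * φ x) + |u x| ^ (critExp N s - 2) * u x * φ x +
        κ * (|u x| ^ (p - 2) * u x * φ x)) ∧
      ∫ x, (c * (u x * φ x) + |u x| ^ (critExp N s - 2) * u x * φ x +
        κ * (|u x| ^ (p - 2) * u x * φ x)) = c * (∫ x, u x * φ x) +
        (∫ x, |u x| ^ (critExp N s - 2) * u x * φ x) +
        κ * ∫ x, |u x| ^ (p - 2) * u x * φ x := fun φ c hφ => by
    have j1 := (i1 φ hφ).const_mul c
    have j3 := (i3 φ hφ).const_mul κ
    refine ⟨(j1.add (i2 φ hφ)).add j3, ?_⟩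
    rw [integral_add (by exact j1.add (i2 φ hφ)) j3, integral_add j1 (i2 φ hφ),
      integral_const_mul, integral_const_mul]
  set G : Sp N → ℝ := fun x =>
    (1 + μ) * u x + |u x| ^ (critExp N s - 2) * u x + κ * |u x| ^ (p - 2) * u x with hG
  have hGm : ∀ φ : Sp N → ℝ, (fun x => G x * φ x) = fun x =>
      (1 + μ) * (u x * φ x) + |u x| ^ (critExp N s - 2) * u x * φ x +
        κ * (|u x| ^ (p - 2) * u x * φ x) := fun φ => by
    ext x; simp only [hG]; ring
  have hGr : Rad G := fun x y hxy => by simp only [hG, hur x y hxy]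
  have key := symmetric_criticality hs.1 hu hur hGr
    (fun φ hφ => by rw [hGm]; exact (hsum φ _ hφ).1)
    (C := |1 + μ| * (pint N 2 u + 1) + (pint N (critExp N s) u + sobConst N s) +
      |κ| * (pint N p u + (1 + sobConst N s))) (fun φ hφ h1 => by
      have hg0 := gag_nonneg (N := N) (s := s) (u := φ)
      have hp0 := pint_nonneg (N := N) (q := 2) (u := φ)
      have b1 := abs_integral_rpow_mul_le one_lt_two hu.meas hφ.meas hu.int_two hφ.int_two
      simp only [sub_self, Real.rpow_zero, one_mul] at b1
      have b2 := abs_integral_rpow_mul_le (by linarith) hu.meas hφ.meas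
        (hu.int_crit hN hs) (hφ.int_crit hN hs)
      have b3 := abs_integral_rpow_mul_le (by linarith) hu.meas hφ.meas
        (hu.int_rpow hN hs hp.le hpr.le) (hφ.int_rpow hN hs hp.le hpr.le)
      have c2 : pint N (critExp N s) φ ≤ sobConst N s := by
        refine (sobolev hN hs hφ).trans ?_
        have : gag N s φ ^ (critExp N s / 2) ≤ 1 :=
          Real.rpow_le_one hg0 (by linarith) (by linarith)
        nlinarith
      have c3 := pint_le_add hN hs hφ hp.le hpr.le
      rw [hGm, (hsum φ _ hφ).2]
      refine (abs_add_three _ _ _).trans ?_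
      rw [abs_mul, abs_mul]
      gcongr
      · exact b1.trans (by linarith)
      · exact b2.trans (by linarith)
      · exact b3.trans (by linarith))
    (fun φ hφ hφr => by rw [hGm, (hsum φ _ hφ).2, heq φ hφ hφr]; ring) hv
  rw [hGm, (hsum v _ hv).2] at key
  have e : (fun x => μ * u x * v x + |u x| ^ (critExp N s - 2) * u x * v x +
      κ * |u x| ^ (p - 2) * u x * v x) = fun x =>
      μ * (u x * v x) + |u x| ^ (critExp N s - 2) * u x * v x +
        κ * (|u x| ^ (p - 2) * u x * v x) := by
    ext x; ring
  rw [e, (hsum v μ hv).2]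
  linarith

lemma integrable_min_sq_kernel (hN : 1 ≤ N) (hs : s ∈ Set.Ioo (0 : ℝ) 1) :
    Integrable (fun z : Sp N => min (‖z‖ ^ 2) 1 / ‖z‖ ^ ((N : ℝ) + 2 * s)) := by
  have : Nontrivial (Sp N) := Module.nontrivial_of_finrank_pos (R := ℝ) (by
    rw [finrank_euclideanSpace_fin]; omega)
  refine (integrable_fun_norm_addHaar volume
    (f := fun t : ℝ => min (t ^ 2) 1 / t ^ ((N : ℝ) + 2 * s))).2 ?_
  rw [finrank_euclideanSpace_fin, ← Set.Ioc_union_Ioi_eq_Ioi zero_le_one]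
  have hpow : ∀ t : ℝ, 0 < t → t ^ (N - 1) / t ^ ((N : ℝ) + 2 * s) = t ^ (-1 - 2 * s) :=
    fun t ht => by
      rw [← Real.rpow_natCast t (N - 1), ← Real.rpow_sub ht, Nat.cast_sub hN]
      congr 1; push_cast; ring
  refine IntegrableOn.union ?_ ?_
  · have h : IntegrableOn (fun t : ℝ => t ^ (1 - 2 * s)) (Set.Ioc 0 1) :=
      (intervalIntegrable_iff_integrableOn_Ioc_of_le zero_le_one).1
        (intervalIntegral.intervalIntegrable_rpow' (by linarith [hs.2]))
    refine h.congr_fun (fun t ht => ?_) measurableSet_Ioc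
    have e : (1 - 2 * s) = (-1 - 2 * s) + (2 : ℕ) := by push_cast; ring
    have h2 : t ^ 2 ≤ 1 := pow_le_one₀ ht.1.le ht.2
    simp only [smul_eq_mul]
    rw [min_eq_left h2, e, Real.rpow_add_natCast ht.1.ne', ← hpow t ht.1]
    ring
  · have h : IntegrableOn (fun t : ℝ => t ^ (-1 - 2 * s)) (Set.Ioi 1) :=
      integrableOn_Ioi_rpow_of_lt (by linarith [hs.1]) one_pos
    refine h.congr_fun (fun t ht => ?_) measurableSet_Ioi
    have ht : 1 < t := ht
    have h2 : 1 ≤ t ^ 2 := one_le_pow₀ ht.le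
    simp only [smul_eq_mul]
    rw [min_eq_right h2, ← hpow t (by linarith)]
    ring

/-- The radial tent function. -/
def tent (N : ℕ) (x : Sp N) : ℝ := max 0 (1 - ‖x‖)

lemma continuous_tent : Continuous (tent N) := by unfold tent; fun_prop

lemma tent_nonneg (x : Sp N) : 0 ≤ tent N x := le_max_left _ _

lemma tent_le_one (x : Sp N) : tent N x ≤ 1 := by
  unfold tent; exact max_le zero_le_one (by linarith [norm_nonneg x])

lemma tent_eq_zero {x : Sp N} (hx : x ∉ Metric.closedBall (0 : Sp N) 1) : tent N x = 0 := by
  rw [mem_closedBall_zero_iff, not_le] at hx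
  exact max_eq_left (by linarith)

lemma abs_tent_sub_le (x y : Sp N) : |tent N x - tent N y| ≤ ‖x - y‖ := by
  unfold tent
  rw [max_comm 0, max_comm 0]
  refine (abs_max_sub_max_le_abs _ _ _).trans ?_
  rw [sub_sub_sub_cancel_left, norm_sub_rev]
  exact abs_norm_sub_norm_le _ _

lemma rad_tent : Rad (tent N) := fun x y h => by simp only [tent, h]

lemma not_tent_ae_zero : ¬ tent N =ᵐ[volume] 0 := fun h => by
  have := (continuous_tent.ae_eq_iff_eq volume continuous_zero).1 h
  have h0 := congrFun this 0
  simp [tent] at h0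

lemma hs_tent (hN : 1 ≤ N) (hs : s ∈ Set.Ioo (0 : ℝ) 1) : Hs N s (tent N) := by
  have hcs : HasCompactSupport (tent N) :=
    HasCompactSupport.intro (isCompact_closedBall (0 : Sp N) 1) fun x hx => tent_eq_zero hx
  refine ⟨continuous_tent.measurable, continuous_tent.memLp_of_hasCompactSupport hcs, ?_⟩
  rw [memLp_two_iff_integrable_sq (measurable_dq continuous_tent.measurable).aestronglyMeasurable]
  set B := Metric.closedBall (0 : Sp N) 1 with hB
  set k : Sp N → ℝ := fun z => min (‖z‖ ^ 2) 1 / ‖z‖ ^ ((N : ℝ) + 2 * s) with hk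
  have hk0 : ∀ z, 0 ≤ k z := fun z => by positivity
  have hBi : Integrable (B.indicator fun _ => (1 : ℝ)) :=
    (integrable_indicator_iff measurableSet_closedBall).2
      (integrableOn_const measure_closedBall_lt_top.ne)
  have h1 := hBi.convolution_integrand (ContinuousLinearMap.mul ℝ ℝ)
    (integrable_min_sq_kernel hN hs)
  have h2 := h1.swap
  refine (h1.add h2).mono'
    ((measurable_dq continuous_tent.measurable).pow_const 2).aestronglyMeasurable
    (Eventually.of_forall fun z => ?_)
  simp only [Pi.add_apply, Function.comp_apply, Prod.fst_swap, Prod.snd_swap,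
    ContinuousLinearMap.mul_apply']
  rw [Real.norm_of_nonneg (sq_nonneg _), dq_sq, norm_sub_rev z.2 z.1, ← add_mul]
  change _ ≤ (B.indicator (fun _ => (1 : ℝ)) z.2 + B.indicator (fun _ => (1 : ℝ)) z.1) *
    k (z.1 - z.2)
  have hi : ∀ x, 0 ≤ B.indicator (fun _ => (1 : ℝ)) x := fun x =>
    Set.indicator_nonneg (fun _ _ => zero_le_one) x
  by_cases hz : z.1 ∈ B ∨ z.2 ∈ B
  · have hone : 1 ≤ B.indicator (fun _ => (1 : ℝ)) z.2 + B.indicator (fun _ => (1 : ℝ)) z.1 := by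
      rcases hz with hz | hz
      · have := hi z.2
        rw [Set.indicator_of_mem hz]; linarith
      · have := hi z.1
        rw [Set.indicator_of_mem hz]; linarith
    refine le_trans ?_ (le_mul_of_one_le_left (hk0 _) hone)
    have hle : |tent N z.1 - tent N z.2| ≤ 1 := by
      rw [abs_le]
      constructor <;> linarith [tent_nonneg z.1, tent_nonneg z.2, tent_le_one z.1, tent_le_one z.2]
    simp only [hk]
    gcongr
    refine le_min ?_ (pow_le_one₀ (abs_nonneg _) hle)
    gcongr
    exact abs_tent_sub_le _ _
  · push Not at hz
    rw [tent_eq_zero hz.1, tent_eq_zero hz.2]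
    have : 0 ≤ (B.indicator (fun _ => (1 : ℝ)) z.2 + B.indicator (fun _ => (1 : ℝ)) z.1) *
      k (z.1 - z.2) := mul_nonneg (add_nonneg (hi _) (hi _)) (hk0 _)
    simpa using this

lemma fib_one_le {r q B C L : ℝ} (hB : 0 ≤ B) (hr : 0 < r) (hq : 2 < q) (hL : 0 < L)
    (hC : 1 / (2 * L ^ ((q - 2) / 2)) ≤ C) {t : ℝ} (ht : 0 ≤ t) : fib r q 1 B C t ≤ L / 2 := by
  have hLp : 0 < L ^ ((q - 2) / 2) := Real.rpow_pos_of_pos hL _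
  have hC0 : 0 < C := lt_of_lt_of_le (by positivity) hC
  have h1 : 0 ≤ B / r * t ^ r := by positivity
  have h2 : 0 ≤ C * t ^ q := by positivity
  unfold fib
  rcases le_total (t ^ 2) L with h | h
  · linarith
  · have e : t ^ q = t ^ 2 * (t ^ 2) ^ ((q - 2) / 2) := by
      rw [← Real.rpow_natCast t 2, ← Real.rpow_mul ht, ← Real.rpow_add' ht (by push_cast; linarith)]
      congr 1; push_cast; ring
    have h3 : L ^ ((q - 2) / 2) ≤ (t ^ 2) ^ ((q - 2) / 2) :=
      Real.rpow_le_rpow hL.le h (by linarith)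
    have h4 : 1 / 2 ≤ C * (t ^ 2) ^ ((q - 2) / 2) := by
      calc (1 : ℝ) / 2 = 1 / (2 * L ^ ((q - 2) / 2)) * L ^ ((q - 2) / 2) := by field_simp
        _ ≤ _ := by gcongr
    have h5 : t ^ 2 / 2 ≤ C * t ^ q := by
      rw [e]; nlinarith [sq_nonneg t]
    linarith

end

/-- main theorem — for large `η` there is a radial normalized weak solution
with negative Lagrange multiplier. -/
theorem main_existence (N : ℕ) (hN : 2 ≤ N) (s : ℝ) (hs : s ∈ Set.Ioo (0 : ℝ) 1)
    (p m : ℝ) (hp : p ∈ Set.Ioo (2 + 4 * s / N) (critExp N s)) (hm : 0 < m) :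
    ∃ ηstar : ℝ, 0 < ηstar ∧ ∀ η : ℝ, ηstar ≤ η →
      ∃ (u : EuclideanSpace ℝ (Fin N) → ℝ) (μ : ℝ), μ < 0 ∧
        Measurable u ∧
        (∀ x y : EuclideanSpace ℝ (Fin N), ‖x‖ = ‖y‖ → u x = u y) ∧
        lpint N 2 u ≠ ⊤ ∧ (lpint N 2 u).toReal = m ^ 2 ∧
        gagliardo N s u ≠ ⊤ ∧
        ∀ φ : EuclideanSpace ℝ (Fin N) → ℝ, Measurable φ →
          lpint N 2 φ ≠ ⊤ → gagliardo N s φ ≠ ⊤ →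
          (∫ x : EuclideanSpace ℝ (Fin N), ∫ y : EuclideanSpace ℝ (Fin N),
              (u x - u y) * (φ x - φ y) / ‖x - y‖ ^ ((N : ℝ) + 2 * s)) =
            ∫ x : EuclideanSpace ℝ (Fin N),
              (μ * u x * φ x + |u x| ^ (critExp N s - 2) * u x * φ x +
                η * |u x| ^ (p - 2) * u x * φ x) := by
  obtain ⟨hp1, hpr⟩ := hp
  have hs0 := hs.1
  have hs1 := hs.2
  have hN' : (2 : ℝ) ≤ N := by exact_mod_cast hN
  have hr2 := critExp_pos hN hs
  have hS := sobConst_pos (N := N) (s := s)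
  have hp2 : 2 < p := by
    have : 0 < 4 * s / N := by positivity
    linarith
  set r := critExp N s with hr
  obtain ⟨q, hqd⟩ : ∃ q : ℝ, q = N * (p - 2) / (2 * s) := ⟨_, rfl⟩
  have hq : 2 < q := by
    have h1 : 4 * s / N < p - 2 := by linarith
    rw [div_lt_iff₀ (by linarith)] at h1
    rw [hqd, lt_div_iff₀ (by linarith)]
    linarith
  have hqp : q < p := by
    have h1 : p < 2 * N / ((N : ℝ) - 2 * s) := hpr
    rw [lt_div_iff₀ (by linarith)] at h1
    rw [hqd, div_lt_iff₀ (by linarith)]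
    linarith
  have hm2 : 0 < m ^ 2 := by positivity
  have htent := hs_tent (N := N) (by omega) hs
  obtain ⟨w, hw, hwr, hw1, hw2, -, hwp⟩ := exists_rescale hN hs p htent rad_tent
    (gag_pos_of_not_ae_zero hN hs htent not_tent_ae_zero)
    (pint_pos_of_not_ae_zero two_pos htent.int_two not_tent_ae_zero) one_pos hm2
  have hC0 : 0 < pint N p w := by
    refine pint_pos_of_not_ae_zero (by linarith) (hw.int_rpow hN hs hp2.le hpr.le) fun h => ?_
    rw [gag_zero_of_ae_zero h] at hw1
    exact zero_ne_one hw1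
  set τ := (1 / sobConst N s) ^ (1 / (r - 2)) with hτ
  have hτ0 : 0 < τ := by positivity
  have hτS : sobConst N s * τ ^ (r - 2) = 1 := by
    rw [hτ, ← Real.rpow_mul (by positivity), one_div_mul_cancel (by linarith), Real.rpow_one,
      mul_one_div_cancel hS.ne']
  set L := τ ^ 2 * (1 / 2 - 1 / r) with hL
  have hL0 : 0 < L := by
    have : 1 / r < 1 / 2 := one_div_lt_one_div_of_lt two_pos hr2
    have : 0 < 1 / 2 - 1 / r := by linarith
    positivity
  refine ⟨p * (1 / (2 * L ^ ((q - 2) / 2)) / pint N p w), by positivity, fun η hη => ?_⟩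
  have hk1 : 1 / (2 * L ^ ((q - 2) / 2)) ≤ η / p * pint N p w := by
    rw [← div_le_iff₀ hC0, le_div_iff₀ (by linarith), mul_comm]
    exact hη
  have hη0 : 0 < η := lt_of_lt_of_le (by positivity) hη
  have hk : 0 < η / p := by positivity
  obtain ⟨σ, -, U, hU, hUr, hU0, hUm, hmax, hone, hlev⟩ := exists_minimax hN hs hqd hq hqp hpr hk
    hm2 hτ0 hτS hw hwr hw1 hw2
    (fun t ht => fib_one_le pint_nonneg (by linarith) hq hL0 hk1 ht) (half_lt_self hL0)
  have hUp : 0 < pint N p U :=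
    pint_pos_of_not_ae_zero (by linarith) (hU.int_rpow hN hs hp2.le hpr.le) hU0
  refine ⟨U, -((p - q) * (η / p * pint N p U) / m ^ 2), ?_, hU.meas, hUr, hU.lpint_ne_top,
    ?_, hU.gagliardo_ne_top, fun φ hφ h2 hg => ?_⟩
  · have : 0 < p - q := by linarith
    have : 0 < (p - q) * (η / p * pint N p U) / m ^ 2 := by positivity
    linarith
  · rw [lpint_two_toReal hU, hUm]
  · have hφ' := Hs.of_ne_top hφ h2 hg
    rw [integral_integral_eq_gform hU hφ']
    refine weak_eq_of_radial hN hs hp2 hpr hU hUr (fun ψ hψ hψr => ?_) hφ'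
    have := weak_eq_of_minimax hN hs hq hqp hpr hk hm2 hU hUr hU0 hUm hmax hone hlev hψ hψr
    rwa [div_mul_cancel₀ η (by linarith : p ≠ 0)] at this
end
end
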